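/- Let p be a prime, K a field of characteristic p, and let a, b be p-typical Witt vectors in W(K); write u_{(k)} ∈ W_k(K) for the truncation of u ∈ W(K) to length k, F for Frobenius and V for Verschiebung. Then: (i) for m ≥ 0 and n ≥ 1, (((Fa)_{(m)}, b_{(n)}))_{p^m,p^n} = ((a_{(m)}, (Vb)_{(n)}))_{p^m,p^n} = ((a_{(m)}, b_{(n−1)}))_{p^m,p^{n−1}}; (ii) for m ≥ 1 and n ≥ 0, ((a_{(m)}, (Fb)_{(n)}))_{p^m,p^n} = (((Va)_{(m)}, b_{(n)}))_{p^m,p^n} = ((a_{(m−1)}, b_{(n)}))_{p^{m−1},p^n}; here symbols with first index p^0 or second index p^0 are 0 by convention. -/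

import Mathlib

noncomputable section

/-- The product `∏ i, x i ^ e i` over the support of `e`, with factors multiplied in
increasing order of the index. -/
def ordProd {σ M : Type*} [LinearOrder σ] [Monoid M] (x : σ → M) (e : σ →₀ ℕ) : M :=
  ((e.support.sort (· ≤ ·)).map fun i => x i ^ e i).prod

/-- Evaluation of a multivariate polynomial in a (possibly noncommutative) algebra:
each monomial is evaluated as the ordered product of the powers of the substituted
values, the variables being multiplied in increasing order of their (linearly ordered)
index. -/
def pEval {σ R A : Type*} [LinearOrder σ] [CommSemiring R] [Semiring A] [Algebra R A]
    (x : σ → A) (q : MvPolynomial σ R) : A :=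
  q.support.sum fun e => MvPolynomial.coeff e q • ordProd x e

/-- Evaluation of an integral polynomial in the commuting variables `X_d` (`d : ℕ+`, left
summand) and `Y_e` (`e : ℕ+`, right summand), substituting `x d` for `X_d` and `y e` for
`Y_e`; in each monomial all `X`-factors (in increasing index order) are multiplied to the
left of all `Y`-factors (in increasing index order), as appropriate for a polynomial in
`ℤ[X][Y]`. -/
def cEval {A : Type*} [Ring A] (x y : ℕ+ → A) (q : MvPolynomial (ℕ+ ⊕ₗ ℕ+) ℤ) : A :=
  pEval (fun v => Sum.elim x y (ofLex v)) q

/-- The `k`-th ghost value `w_k(g) = ∑_{d ∣ k} d · (g d)^(k/d)`. -/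
def ghost {A : Type*} [Ring A] (g : ℕ+ → A) (k : ℕ+) : A :=
  ∑ d ∈ (k : ℕ).divisors.attach,
    ((d : ℕ) : A) * g ⟨(d : ℕ), Nat.pos_of_mem_divisors d.2⟩ ^ ((k : ℕ) / (d : ℕ))

/-- The generator `x_d` of the free algebra underlying `B(ℚ)`. -/
def bXf (d : ℕ+) : FreeAlgebra ℚ (ℕ+ ⊕ ℕ+) := FreeAlgebra.ι ℚ (Sum.inl d)

/-- The generator `y_e` of the free algebra underlying `B(ℚ)`. -/
def bYf (e : ℕ+) : FreeAlgebra ℚ (ℕ+ ⊕ ℕ+) := FreeAlgebra.ι ℚ (Sum.inr e)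

/-- The defining relations of `B(ℚ)`: `[w_k(x), w_l(x)] = 0`, `[w_k(y), w_l(y)] = 0` and
`[w_l(y), w_k(x)] = δ_{k,l}·k` for all `k, l ≥ 1`. -/
inductive BRel : FreeAlgebra ℚ (ℕ+ ⊕ ℕ+) → FreeAlgebra ℚ (ℕ+ ⊕ ℕ+) → Prop
  | xx (k l : ℕ+) : BRel (ghost bXf k * ghost bXf l) (ghost bXf l * ghost bXf k)
  | yy (k l : ℕ+) : BRel (ghost bYf k * ghost bYf l) (ghost bYf l * ghost bYf k)
  | yx (k l : ℕ+) : BRel (ghost bYf l * ghost bXf k)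
      (ghost bXf k * ghost bYf l + if k = l then ((k : ℕ) : FreeAlgebra ℚ (ℕ+ ⊕ ℕ+)) else 0)

/-- The universal algebra `B(ℚ)`. -/
abbrev BQ : Type := RingQuot BRel

/-- The generator `x_d` of `B(ℚ)`. -/
def bx (d : ℕ+) : BQ := RingQuot.mkAlgHom ℚ BRel (bXf d)

/-- The generator `y_e` of `B(ℚ)`. -/
def by' (e : ℕ+) : BQ := RingQuot.mkAlgHom ℚ BRel (bYf e)

/-- `c` is a family of polynomials `c_{m,n}` as in the paper: `c m n` is an integral
polynomial in the variables `X_d` (`d` a proper divisor of `m`) and `Y_e` (`e` a proper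
divisor of `n`) such that `[y_n, x_m] = c_{m,n}(x, y)` holds in `B(ℚ)`. -/
def IsCFamily (c : ℕ+ → ℕ+ → MvPolynomial (ℕ+ ⊕ₗ ℕ+) ℤ) : Prop :=
  ∀ m n : ℕ+,
    (∀ v ∈ (c m n).vars,
      (∃ d : ℕ+, (d : ℕ) ∣ (m : ℕ) ∧ d ≠ m ∧ ofLex v = Sum.inl d) ∨
      (∃ e : ℕ+, (e : ℕ) ∣ (n : ℕ) ∧ e ≠ n ∧ ofLex v = Sum.inr e)) ∧
    cEval bx by' (c m n) = by' n * bx m - bx m * by' n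


/-- `p ^ i` as a positive natural number. -/
def ppow (p i : ℕ) : ℕ+ := (p ^ i).toPNat'

/-- Substitution of the generators `x_0, …, x_{m-1}` for the variables `X_{p^0}, …, X_{p^{m-1}}`
(the variable `X_{p^r}` is sent to `x_r`). -/
def sxm (R : Type*) [CommRing R] (p m n : ℕ) : ℕ+ → FreeAlgebra R (Fin m ⊕ Fin n) :=
  fun d => if h : padicValNat p (d : ℕ) < m
    then FreeAlgebra.ι R (Sum.inl ⟨padicValNat p (d : ℕ), h⟩) else 0

/-- Substitution of the generators `y_0, …, y_{n-1}` for the variables `Y_{p^0}, …, Y_{p^{n-1}}`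
(the variable `Y_{p^s}` is sent to `y_s`). -/
def syn (R : Type*) [CommRing R] (p m n : ℕ) : ℕ+ → FreeAlgebra R (Fin m ⊕ Fin n) :=
  fun e => if h : padicValNat p (e : ℕ) < n
    then FreeAlgebra.ι R (Sum.inr ⟨padicValNat p (e : ℕ), h⟩) else 0

/-- The defining relations of the truncated `p`-typical algebra `B_{m,n}(R)`:
`[x_i, x_{i'}] = 0`, `[y_j, y_{j'}] = 0` and
`[y_j, x_i] = c_{p^i, p^j}(x_0, …, x_{i-1}, y_0, …, y_{j-1})`. -/
inductive BmnRel (R : Type*) [CommRing R] (p : ℕ)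
    (c : ℕ+ → ℕ+ → MvPolynomial (ℕ+ ⊕ₗ ℕ+) ℤ) (m n : ℕ) :
    FreeAlgebra R (Fin m ⊕ Fin n) → FreeAlgebra R (Fin m ⊕ Fin n) → Prop
  | xx (i i' : Fin m) : BmnRel R p c m n
      (FreeAlgebra.ι R (Sum.inl i) * FreeAlgebra.ι R (Sum.inl i'))
      (FreeAlgebra.ι R (Sum.inl i') * FreeAlgebra.ι R (Sum.inl i))
  | yy (j j' : Fin n) : BmnRel R p c m n
      (FreeAlgebra.ι R (Sum.inr j) * FreeAlgebra.ι R (Sum.inr j'))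
      (FreeAlgebra.ι R (Sum.inr j') * FreeAlgebra.ι R (Sum.inr j))
  | yx (i : Fin m) (j : Fin n) : BmnRel R p c m n
      (FreeAlgebra.ι R (Sum.inr j) * FreeAlgebra.ι R (Sum.inl i))
      (FreeAlgebra.ι R (Sum.inl i) * FreeAlgebra.ι R (Sum.inr j) +
        cEval (sxm R p m n) (syn R p m n) (c (ppow p (i : ℕ)) (ppow p (j : ℕ))))

/-- The truncated `p`-typical algebra `B_{m,n}(R)`. -/
abbrev Bmn (R : Type*) [CommRing R] (p : ℕ) (c : ℕ+ → ℕ+ → MvPolynomial (ℕ+ ⊕ₗ ℕ+) ℤ)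
    (m n : ℕ) : Type _ := RingQuot (BmnRel R p c m n)

/-- The generator `x_i` of `B_{m,n}(R)`. -/
def gx (R : Type*) [CommRing R] (p : ℕ) (c : ℕ+ → ℕ+ → MvPolynomial (ℕ+ ⊕ₗ ℕ+) ℤ)
    (m n : ℕ) (i : Fin m) : Bmn R p c m n :=
  RingQuot.mkAlgHom R (BmnRel R p c m n) (FreeAlgebra.ι R (Sum.inl i))

/-- The generator `y_j` of `B_{m,n}(R)`. -/
def gy (R : Type*) [CommRing R] (p : ℕ) (c : ℕ+ → ℕ+ → MvPolynomial (ℕ+ ⊕ₗ ℕ+) ℤ)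
    (m n : ℕ) (j : Fin n) : Bmn R p c m n :=
  RingQuot.mkAlgHom R (BmnRel R p c m n) (FreeAlgebra.ι R (Sum.inr j))
/-- The relations `x_i^{p^n} = a_i`, `y_j^{p^m} = b_j` defining `A_{((a,b))_{p^m,p^n}}`. -/
inductive ASRel (K : Type*) [Field K] (p : ℕ) [Fact p.Prime]
    (c : ℕ+ → ℕ+ → MvPolynomial (ℕ+ ⊕ₗ ℕ+) ℤ) (m n : ℕ)
    (a : TruncatedWittVector p m K) (b : TruncatedWittVector p n K) :
    Bmn K p c m n → Bmn K p c m n → Prop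
  | xa (i : Fin m) : ASRel K p c m n a b
      (gx K p c m n i ^ p ^ n) (algebraMap K (Bmn K p c m n) (a.coeff i))
  | yb (j : Fin n) : ASRel K p c m n a b
      (gy K p c m n j ^ p ^ m) (algebraMap K (Bmn K p c m n) (b.coeff j))

/-- The central simple algebra `A_{((a,b))_{p^m,p^n}}`. -/
abbrev Asymb (K : Type*) [Field K] (p : ℕ) [Fact p.Prime]
    (c : ℕ+ → ℕ+ → MvPolynomial (ℕ+ ⊕ₗ ℕ+) ℤ) (m n : ℕ)
    (a : TruncatedWittVector p m K) (b : TruncatedWittVector p n K) : Type _ :=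
  RingQuot (ASRel K p c m n a b)

/-- The image of the generator `x_i` in `A_{((a,b))_{p^m,p^n}}`. -/
def aX (K : Type*) [Field K] (p : ℕ) [Fact p.Prime]
    (c : ℕ+ → ℕ+ → MvPolynomial (ℕ+ ⊕ₗ ℕ+) ℤ) (m n : ℕ)
    (a : TruncatedWittVector p m K) (b : TruncatedWittVector p n K) (i : Fin m) :
    Asymb K p c m n a b :=
  RingQuot.mkAlgHom K (ASRel K p c m n a b) (gx K p c m n i)

/-- The image of the generator `y_j` in `A_{((a,b))_{p^m,p^n}}`. -/
def aY (K : Type*) [Field K] (p : ℕ) [Fact p.Prime]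
    (c : ℕ+ → ℕ+ → MvPolynomial (ℕ+ ⊕ₗ ℕ+) ℤ) (m n : ℕ)
    (a : TruncatedWittVector p m K) (b : TruncatedWittVector p n K) (j : Fin n) :
    Asymb K p c m n a b :=
  RingQuot.mkAlgHom K (ASRel K p c m n a b) (gy K p c m n j)

/-- Two `K`-algebras are Brauer equivalent if they become isomorphic after tensoring with
matrix algebras, i.e. `M_r(A) ≅ M_s(B)` for some `r, s ≥ 1`. -/
def BrauerEquiv (K : Type*) [Field K] (A B : Type*) [Ring A] [Algebra K A]
    [Ring B] [Algebra K B] : Prop :=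
  ∃ r s : ℕ, 0 < r ∧ 0 < s ∧
    Nonempty (Matrix (Fin r) (Fin r) A ≃ₐ[K] Matrix (Fin s) (Fin s) B)


section
open MvPolynomial

/-- A pairwise commuting family of elements. -/
def CommFam {ι A : Type*} [Mul A] (x : ι → A) : Prop := ∀ i j, Commute (x i) (x j)

open scoped IsMulCommutative in
theorem exists_aeval_of_commFam (R : Type*) [CommRing R] {ι A : Type*} [Ring A] [Algebra R A]
    {x : ι → A} (hx : CommFam x) :
    ∃ f : MvPolynomial ι R →ₐ[R] A, ∀ i, f (X i) = x i := by
  have := Algebra.isMulCommutative_adjoin R (s := Set.range x) (by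
    rintro _ ⟨i, rfl⟩ _ ⟨j, rfl⟩
    exact hx i j)
  refine ⟨(Algebra.adjoin R (Set.range x)).val.comp
    (MvPolynomial.aeval fun i => ⟨x i, Algebra.subset_adjoin ⟨i, rfl⟩⟩), fun i => ?_⟩
  simp

/-- Evaluation of commutative polynomials at a commuting family in a noncommutative algebra. -/
def commEval (R : Type*) [CommRing R] {ι A : Type*} [Ring A] [Algebra R A]
    {x : ι → A} (hx : CommFam x) : MvPolynomial ι R →ₐ[R] A :=
  Classical.choose (exists_aeval_of_commFam R hx)

section commEval
variable {R : Type*} [CommRing R] {ι A : Type*} [Ring A] [Algebra R A]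

@[simp] theorem commEval_X {x : ι → A} (hx : CommFam x) (i : ι) :
    commEval R hx (X i) = x i :=
  Classical.choose_spec (exists_aeval_of_commFam R hx) i

theorem commEval_unique {x : ι → A} (hx : CommFam x) (f : MvPolynomial ι R →ₐ[R] A)
    (hf : ∀ i, f (X i) = x i) (q : MvPolynomial ι R) : f q = commEval R hx q := by
  induction q using MvPolynomial.induction_on with
  | C r => simp only [← MvPolynomial.algebraMap_eq, AlgHom.commutes]
  | add p q hp hq => rw [map_add, map_add, hp, hq]
  | mul_X p i hp => rw [map_mul, map_mul, hp, hf, commEval_X]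

theorem CommFam.map {B F : Type*} [Ring B] [FunLike F A B] [MulHomClass F A B] {x : ι → A}
    (hx : CommFam x) (f : F) : CommFam fun i => f (x i) :=
  fun i j => (hx i j).map f

theorem CommFam.comp {κ : Type*} {x : ι → A} (hx : CommFam x) (r : κ → ι) :
    CommFam (x ∘ r) := fun i j => hx (r i) (r j)

theorem map_commEval {B : Type*} [Ring B] [Algebra R B] {x : ι → A} (hx : CommFam x)
    (f : A →ₐ[R] B) (q : MvPolynomial ι R) :
    f (commEval R hx q) = commEval R (hx.map f) q :=
  commEval_unique (hx.map f) (f.comp (commEval R hx)) (fun i => by simp) q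

theorem commEval_rename {κ : Type*} {x : ι → A} (hx : CommFam x) (r : κ → ι)
    (q : MvPolynomial κ R) :
    commEval R hx (rename r q) = commEval R (hx.comp r) q :=
  commEval_unique (hx.comp r) ((commEval R hx).comp (rename r)) (fun i => by simp) q

theorem commEval_aeval {κ : Type*} {x : ι → A} (hx : CommFam x) {f : κ → MvPolynomial ι R}
    {z : κ → A} (hz : CommFam z) (hf : ∀ k, commEval R hx (f k) = z k) (q : MvPolynomial κ R) :
    commEval R hx (aeval f q) = commEval R hz q :=
  commEval_unique hz ((commEval R hx).comp (aeval f)) (fun i => by simp [hf]) q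

theorem commute_commEval {x : ι → A} (hx : CommFam x) {z : A} (hz : ∀ i, Commute z (x i))
    (q : MvPolynomial ι R) : Commute z (commEval R hx q) := by
  induction q using MvPolynomial.induction_on with
  | C r => rw [← MvPolynomial.algebraMap_eq, AlgHom.commutes]; exact (Algebra.commutes r z).symm
  | add p q hp hq => rw [map_add]; exact hp.add_right hq
  | mul_X p i hp => rw [map_mul, commEval_X]; exact hp.mul_right (hz i)

end commEval

/-- Normal ordered evaluation: monomials are evaluated with all `x`-factors to the left of
all `y`-factors. -/
def normEval (R : Type*) [CommRing R] {σ τ A : Type*} [LinearOrder σ] [LinearOrder τ] [Ring A]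
    [Algebra R A] (x : σ → A) (y : τ → A) : MvPolynomial (σ ⊕ₗ τ) R →ₗ[R] A :=
  (basisMonomials (σ ⊕ₗ τ) R).constr R fun e => ordProd (fun v => Sum.elim x y (ofLex v)) e

section normEval
variable {R : Type*} [CommRing R] {σ τ A : Type*} [LinearOrder σ] [LinearOrder τ] [Ring A]
  [Algebra R A]

theorem normEval_eq_sum (x : σ → A) (y : τ → A) (q : MvPolynomial (σ ⊕ₗ τ) R) :
    normEval R x y q =
      ∑ e ∈ q.support, coeff e q • ordProd (fun v => Sum.elim x y (ofLex v)) e := by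
  rw [normEval, Module.Basis.constr_apply]
  rfl

theorem normEval_monomial (x : σ → A) (y : τ → A) (e : (σ ⊕ₗ τ) →₀ ℕ) (r : R) :
    normEval R x y (monomial e r) = r • ordProd (fun v => Sum.elim x y (ofLex v)) e := by
  have : monomial e r = r • basisMonomials (σ ⊕ₗ τ) R e := by
    simp [smul_monomial]
  rw [this, map_smul, normEval, Module.Basis.constr_basis]

theorem map_ordProd {ι M N F : Type*} [LinearOrder ι] [Monoid M] [Monoid N] [FunLike F M N]
    [MonoidHomClass F M N] (f : F) (x : ι → M) (e : ι →₀ ℕ) :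
    f (ordProd x e) = ordProd (fun i => f (x i)) e := by
  simp [ordProd, map_list_prod, Function.comp_def]

theorem ordProd_congr {ι M : Type*} [LinearOrder ι] [Monoid M] {x x' : ι → M} {e : ι →₀ ℕ}
    (h : ∀ i ∈ e.support, x i = x' i) : ordProd x e = ordProd x' e := by
  unfold ordProd
  congr 1
  refine List.map_congr_left fun i hi => ?_
  rw [h i (by simpa using hi)]

theorem normEval_congr {x x' : σ → A} {y y' : τ → A} {q : MvPolynomial (σ ⊕ₗ τ) R}
    (hx : ∀ i, toLex (Sum.inl i) ∈ q.vars → x i = x' i)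
    (hy : ∀ j, toLex (Sum.inr j) ∈ q.vars → y j = y' j) :
    normEval R x y q = normEval R x' y' q := by
  rw [normEval_eq_sum, normEval_eq_sum]
  refine Finset.sum_congr rfl fun e he => ?_
  congr 1
  refine ordProd_congr fun v hv => ?_
  have hv' : v ∈ q.vars := (mem_vars_iff_mem_support v).2 ⟨e, he, hv⟩
  rcases hv2 : ofLex v with i | j
  · exact hx i (by rwa [← hv2])
  · exact hy j (by rwa [← hv2])

theorem map_normEval {B : Type*} [Ring B] [Algebra R B] (f : A →ₐ[R] B) (x : σ → A) (y : τ → A)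
    (q : MvPolynomial (σ ⊕ₗ τ) R) :
    f (normEval R x y q) = normEval R (fun i => f (x i)) (fun j => f (y j)) q := by
  rw [normEval_eq_sum, normEval_eq_sum, map_sum]
  refine Finset.sum_congr rfl fun e _ => ?_
  rw [map_smul, map_ordProd]
  congr 1
  refine ordProd_congr fun v _ => ?_
  rcases ofLex v with i | j <;> rfl

/-- The `X`-part of a monomial. -/
def leftMon (R : Type*) [CommRing R] {σ τ : Type*} (e : (σ ⊕ₗ τ) →₀ ℕ) : MvPolynomial σ R :=
  e.prod fun v k => Sum.elim X (fun _ => 1) (ofLex v) ^ k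

/-- The `Y`-part of a monomial. -/
def rightMon (R : Type*) [CommRing R] {σ τ : Type*} (e : (σ ⊕ₗ τ) →₀ ℕ) : MvPolynomial τ R :=
  e.prod fun v k => Sum.elim (fun _ => 1) X (ofLex v) ^ k

theorem list_prod_eq {x : σ → A} {y : τ → A} (hx : CommFam x) (hy : CommFam y)
    (e : (σ ⊕ₗ τ) → ℕ) (l : List (σ ⊕ₗ τ)) (hl : l.Pairwise (· ≤ ·)) :
    (l.map fun v => Sum.elim x y (ofLex v) ^ e v).prod =
      commEval R hx (l.map fun v => Sum.elim X (fun _ => 1) (ofLex v) ^ e v).prod *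
      commEval R hy (l.map fun v => Sum.elim (fun _ => 1) X (ofLex v) ^ e v).prod := by
  induction l with
  | nil => simp
  | cons v l ih =>
    rw [List.pairwise_cons] at hl
    simp only [List.map_cons, List.prod_cons, ih hl.2, map_mul, map_pow]
    rcases hv : ofLex v with i | j
    · simp [mul_assoc]
    · have h1 : (l.map fun v => (Sum.elim X (fun _ => 1) (ofLex v) : MvPolynomial σ R) ^ e v).prod
          = 1 := by
        refine List.prod_eq_one fun q hq => ?_
        obtain ⟨w, hw, rfl⟩ := List.mem_map.1 hq
        have := hl.1 w hw
        rcases hw' : ofLex w with i | j'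
        · exfalso
          have e1 : v = toLex (Sum.inr j) := by rw [← hv]; rfl
          have e2 : w = toLex (Sum.inl i) := by rw [← hw']; rfl
          rw [e1, e2] at this
          exact Sum.Lex.not_inr_le_inl this
        · simp
      simp [h1]

theorem finsupp_prod_eq_list_prod {ι B : Type*} [LinearOrder ι] [CommMonoid B] (e : ι →₀ ℕ)
    (g : ι → B) :
    (e.prod fun v k => g v ^ k) = ((e.support.sort (· ≤ ·)).map fun v => g v ^ e v).prod := by
  rw [Finsupp.prod, ← Finset.prod_map_toList]
  exact ((Finset.sort_perm_toList _ _).map _).prod_eq.symm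

theorem ordProd_eq {x : σ → A} {y : τ → A} (hx : CommFam x) (hy : CommFam y)
    (e : (σ ⊕ₗ τ) →₀ ℕ) :
    ordProd (fun v => Sum.elim x y (ofLex v)) e =
      commEval R hx (leftMon R e) * commEval R hy (rightMon R e) := by
  rw [leftMon, rightMon, finsupp_prod_eq_list_prod, finsupp_prod_eq_list_prod, ordProd,
    list_prod_eq (R := R) hx hy]
  exact Finset.pairwise_sort _ _

theorem normEval_monomial' {x : σ → A} {y : τ → A} (hx : CommFam x) (hy : CommFam y)
    (e : (σ ⊕ₗ τ) →₀ ℕ) (r : R) :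
    normEval R x y (monomial e r) =
      r • (commEval R hx (leftMon R e) * commEval R hy (rightMon R e)) := by
  rw [normEval_monomial, ordProd_eq (R := R) hx hy]

/-- The inclusion of the `X`-variables. -/
abbrev renL {σ τ : Type*} : σ → σ ⊕ₗ τ := fun i => toLex (Sum.inl i)
/-- The inclusion of the `Y`-variables. -/
abbrev renR {σ τ : Type*} : τ → σ ⊕ₗ τ := fun j => toLex (Sum.inr j)

omit [LinearOrder σ] [LinearOrder τ] in
theorem monomial_split (e : (σ ⊕ₗ τ) →₀ ℕ) (r : R) :
    monomial e r = r • (rename renL (leftMon R e) * rename renR (rightMon R e)) := by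
  rw [MvPolynomial.monomial_eq, C_mul', leftMon, rightMon, Finsupp.prod, Finsupp.prod,
    Finsupp.prod, map_prod, map_prod, ← Finset.prod_mul_distrib]
  congr 1
  refine Finset.prod_congr rfl fun v _ => ?_
  rcases hv : ofLex v with i | j
  · have : v = renL i := by rw [renL, ← hv]; rfl
    simp [this]
  · have : v = renR j := by rw [renR, ← hv]; rfl
    simp [this]

omit [LinearOrder σ] [LinearOrder τ] in
theorem leftMon_add (d e : (σ ⊕ₗ τ) →₀ ℕ) :
    leftMon R (d + e) = leftMon R d * leftMon R e :=
  Finsupp.prod_add_index' (by simp) (by simp [pow_add])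

omit [LinearOrder σ] [LinearOrder τ] in
theorem rightMon_add (d e : (σ ⊕ₗ τ) →₀ ℕ) :
    rightMon R (d + e) = rightMon R d * rightMon R e :=
  Finsupp.prod_add_index' (by simp) (by simp [pow_add])

theorem normEval_mul {x : σ → A} {y : τ → A} (hx : CommFam x) (hy : CommFam y)
    (f : MvPolynomial σ R) (g : MvPolynomial τ R) :
    normEval R x y (rename renL f * rename renR g) = commEval R hx f * commEval R hy g := by
  induction f using MvPolynomial.induction_on' with
  | add p q hp hq => simp only [map_add, add_mul, hp, hq]
  | monomial d r =>
  induction g using MvPolynomial.induction_on' with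
  | add p q hp hq => simp only [map_add, mul_add, hp, hq]
  | monomial e s =>
    rw [rename_monomial, rename_monomial, monomial_mul, normEval_monomial' hx hy, leftMon_add,
      rightMon_add]
    have l1 : leftMon R (Finsupp.mapDomain (renL : σ → σ ⊕ₗ τ) d) = monomial d 1 := by
      rw [leftMon, Finsupp.prod_mapDomain_index (by simp) (by simp [pow_add]),
        MvPolynomial.monomial_eq]
      simp
    have l2 : leftMon R (Finsupp.mapDomain (renR : τ → σ ⊕ₗ τ) e) = 1 := by
      rw [leftMon, Finsupp.prod_mapDomain_index (by simp) (by simp [pow_add])]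
      simp
    have l3 : rightMon R (Finsupp.mapDomain (renL : σ → σ ⊕ₗ τ) d) = 1 := by
      rw [rightMon, Finsupp.prod_mapDomain_index (by simp) (by simp [pow_add])]
      simp
    have l4 : rightMon R (Finsupp.mapDomain (renR : τ → σ ⊕ₗ τ) e) = monomial e 1 := by
      rw [rightMon, Finsupp.prod_mapDomain_index (by simp) (by simp [pow_add]),
        MvPolynomial.monomial_eq]
      simp
    rw [l1, l2, l3, l4, mul_one, one_mul]
    have e1 : monomial d r = r • monomial d (1 : R) := by simp [smul_monomial]
    have e2 : monomial e s = s • monomial e (1 : R) := by simp [smul_monomial]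
    rw [e1, e2, map_smul, map_smul, smul_mul_smul_comm]

omit [LinearOrder σ] [LinearOrder τ] in
/-- To check a linear statement about polynomials in two sets of variables, it suffices to
treat products. -/
theorem induction_split {P : MvPolynomial (σ ⊕ₗ τ) R → Prop} (q : MvPolynomial (σ ⊕ₗ τ) R)
    (hadd : ∀ p q, P p → P q → P (p + q))
    (hmul : ∀ (f : MvPolynomial σ R) (g : MvPolynomial τ R), P (rename renL f * rename renR g)) :
    P q := by
  induction q using MvPolynomial.induction_on' with
  | add p q hp hq => exact hadd p q hp hq
  | monomial d r =>
    rw [monomial_split, ← smul_mul_assoc, ← map_smul]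
    exact hmul _ _

theorem normEval_rename {σ' τ' : Type*} [LinearOrder σ'] [LinearOrder τ'] {x : σ → A} {y : τ → A}
    (hx : CommFam x) (hy : CommFam y) (r : σ' → σ) (s : τ' → τ) (q : MvPolynomial (σ' ⊕ₗ τ') R) :
    normEval R x y (rename (fun v => toLex (Sum.map r s (ofLex v))) q) =
      normEval R (x ∘ r) (y ∘ s) q := by
  induction q using induction_split with
  | hadd p q hp hq => rw [map_add, map_add, map_add, hp, hq]
  | hmul f g =>
    rw [map_mul, rename_rename, rename_rename, normEval_mul (hx.comp r) (hy.comp s)]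
    have e1 : rename ((fun v : σ' ⊕ₗ τ' => toLex (Sum.map r s (ofLex v))) ∘ renL) f
      = rename renL (rename r f) := by rw [rename_rename]; rfl
    have e2 : rename ((fun v : σ' ⊕ₗ τ' => toLex (Sum.map r s (ofLex v))) ∘ renR) g
      = rename renR (rename s g) := by rw [rename_rename]; rfl
    rw [e1, e2, normEval_mul hx hy, commEval_rename, commEval_rename]

/-- The exchange of the two sets of variables. -/
def swapVar {σ τ : Type*} : σ ⊕ₗ τ → τ ⊕ₗ σ := fun v => toLex (Sum.swap (ofLex v))

theorem CommFam.op {ι : Type*} {x : ι → A} (hx : CommFam x) :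
    CommFam fun i => MulOpposite.op (x i) := fun i j => (hx i j).op

theorem commEval_op {ι : Type*} {x : ι → A} (hx : CommFam x) (q : MvPolynomial ι R) :
    commEval R hx.op q = MulOpposite.op (commEval R hx q) := by
  induction q using MvPolynomial.induction_on with
  | C r => simp only [← MvPolynomial.algebraMap_eq, AlgHom.commutes]; rfl
  | add p q hp hq => rw [map_add, map_add, hp, hq]; rfl
  | mul_X p i hp =>
    rw [mul_comm, map_mul, map_mul, hp, commEval_X, commEval_X, ← MulOpposite.op_mul,
      (commute_commEval hx (hx i) p).eq]

theorem normEval_op_swap {x : σ → A} {y : τ → A} (hx : CommFam x) (hy : CommFam y)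
    (q : MvPolynomial (σ ⊕ₗ τ) R) :
    normEval R (fun j => MulOpposite.op (y j)) (fun i => MulOpposite.op (x i))
      (rename swapVar q) = MulOpposite.op (normEval R x y q) := by
  induction q using induction_split with
  | hadd p q hp hq => rw [map_add, map_add, map_add, hp, hq]; rfl
  | hmul f g =>
    rw [map_mul, rename_rename, rename_rename, normEval_mul hx hy, mul_comm]
    have e1 : rename ((swapVar : σ ⊕ₗ τ → _) ∘ renL) f = rename renR f := rfl
    have e2 : rename ((swapVar : σ ⊕ₗ τ → _) ∘ renR) g = rename renL g := rfl
    rw [e1, e2, normEval_mul hy.op hx.op, commEval_op, commEval_op]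
    rfl

end normEval

section intEval
variable {σ τ A : Type*} [LinearOrder σ] [LinearOrder τ] [Ring A]

/-- Normal ordered evaluation of integral polynomials in a ring. -/
def intEval (x : σ → A) (y : τ → A) : MvPolynomial (σ ⊕ₗ τ) ℤ →+ A :=
  (normEval ℤ x y).toAddMonoidHom

theorem cEval_eq_intEval (x y : ℕ+ → A) (q : MvPolynomial (ℕ+ ⊕ₗ ℕ+) ℤ) :
    cEval x y q = intEval x y q :=
  (normEval_eq_sum x y q).symm

theorem intEval_eq_normEval (R : Type*) [CommRing R] [Algebra R A] (x : σ → A) (y : τ → A)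
    (q : MvPolynomial (σ ⊕ₗ τ) ℤ) :
    intEval x y q = normEval R x y (map (Int.castRingHom R) q) := by
  induction q using MvPolynomial.induction_on' with
  | add p q hp hq => rw [map_add, map_add, map_add, hp, hq]
  | monomial e r =>
    rw [map_monomial, normEval_monomial]
    refine (normEval_monomial x y e r).trans ?_
    rw [Algebra.smul_def, Algebra.smul_def]
    simp

theorem intEval_congr {x x' : σ → A} {y y' : τ → A} {q : MvPolynomial (σ ⊕ₗ τ) ℤ}
    (hx : ∀ i, toLex (Sum.inl i) ∈ q.vars → x i = x' i)
    (hy : ∀ j, toLex (Sum.inr j) ∈ q.vars → y j = y' j) : intEval x y q = intEval x' y' q :=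
  normEval_congr hx hy

theorem map_intEval {B F : Type*} [Ring B] [FunLike F A B] [RingHomClass F A B] (f : F)
    (x : σ → A) (y : τ → A) (q : MvPolynomial (σ ⊕ₗ τ) ℤ) :
    f (intEval x y q) = intEval (fun i => f (x i)) (fun j => f (y j)) q :=
  map_normEval (f : A →+* B).toIntAlgHom x y q

theorem intEval_rename {σ' τ' : Type*} [LinearOrder σ'] [LinearOrder τ'] {x : σ → A} {y : τ → A}
    (hx : CommFam x) (hy : CommFam y) (r : σ' → σ) (s : τ' → τ) (q : MvPolynomial (σ' ⊕ₗ τ') ℤ) :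
    intEval x y (rename (fun v => toLex (Sum.map r s (ofLex v))) q) =
      intEval (x ∘ r) (y ∘ s) q :=
  normEval_rename hx hy r s q

theorem intEval_op_swap {x : σ → A} {y : τ → A} (hx : CommFam x) (hy : CommFam y)
    (q : MvPolynomial (σ ⊕ₗ τ) ℤ) :
    intEval (fun j => MulOpposite.op (y j)) (fun i => MulOpposite.op (x i)) (rename swapVar q) =
      MulOpposite.op (intEval x y q) := by
  rw [intEval_eq_normEval ℤ, map_rename, normEval_op_swap hx hy, ← intEval_eq_normEval]

end intEval

section Ghost
variable {A : Type*} [Ring A]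

theorem map_ghost {B : Type*} [Ring B] (f : A →+* B) (g : ℕ+ → A) (k : ℕ+) :
    f (ghost g k) = ghost (fun d => f (g d)) k := by
  simp [ghost, map_sum]

/-- The contribution of the proper divisors to the ghost value. -/
def ghostLow (g : ℕ+ → A) (k : ℕ+) : A :=
  ∑ d ∈ (k : ℕ).properDivisors.attach,
    ((d : ℕ) : A) * g ⟨(d : ℕ), Nat.pos_of_mem_properDivisors d.2⟩ ^ ((k : ℕ) / (d : ℕ))

theorem ghost_eq_sum (g : ℕ+ → A) (k : ℕ+) :
    ghost g k = ∑ d ∈ (k : ℕ).divisors, (d : A) * g d.toPNat' ^ ((k : ℕ) / d) := by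
  rw [ghost, ← Finset.sum_attach (k : ℕ).divisors]
  refine Finset.sum_congr rfl fun d _ => ?_
  congr 3
  exact PNat.coe_injective
    (by simp [Nat.toPNat'_coe, Nat.pos_of_mem_divisors d.2])

theorem ghostLow_eq_sum (g : ℕ+ → A) (k : ℕ+) :
    ghostLow g k = ∑ d ∈ (k : ℕ).properDivisors, (d : A) * g d.toPNat' ^ ((k : ℕ) / d) := by
  rw [ghostLow, ← Finset.sum_attach (k : ℕ).properDivisors]
  refine Finset.sum_congr rfl fun d _ => ?_
  congr 3
  exact PNat.coe_injective
    (by simp [Nat.toPNat'_coe, Nat.pos_of_mem_properDivisors d.2])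

theorem ghost_eq_low_add (g : ℕ+ → A) (k : ℕ+) :
    ghost g k = ghostLow g k + (k : ℕ) * g k := by
  rw [ghost_eq_sum, ghostLow_eq_sum, ← Nat.insert_self_properDivisors k.ne_zero,
    Finset.sum_insert (by simp), add_comm]
  simp

/-- The family with prescribed ghost values. -/
def ghostSolve [Algebra ℚ A] (W : ℕ+ → A) (k : ℕ+) : A :=
  ((k : ℕ) : ℚ)⁻¹ • (W k - ∑ d ∈ (k : ℕ).properDivisors.attach,
    ((d : ℕ) : A) *
      ghostSolve W ⟨(d : ℕ), Nat.pos_of_mem_properDivisors d.2⟩ ^ ((k : ℕ) / (d : ℕ)))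
termination_by (k : ℕ)
decreasing_by exact (Nat.mem_properDivisors.1 d.2).2

theorem ghost_ghostSolve [Algebra ℚ A] (W : ℕ+ → A) (k : ℕ+) : ghost (ghostSolve W) k = W k := by
  rw [ghost_eq_low_add]
  conv_lhs => rw [ghostSolve]
  have : ((k : ℕ) : ℚ) ≠ 0 := by exact_mod_cast k.ne_zero
  rw [mul_smul_comm, ← nsmul_eq_mul, ← Nat.cast_smul_eq_nsmul ℚ, smul_smul, inv_mul_cancel₀ this,
    one_smul, ghostLow]
  abel

/-- The `p`-typical ghost value. -/
def wsum (p : ℕ) (x : ℕ → A) (i : ℕ) : A :=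
  ∑ r ∈ Finset.range (i + 1), (p : A) ^ r * x r ^ p ^ (i - r)

theorem map_wsum {B : Type*} [Ring B] (f : A →+* B) (p : ℕ) (x : ℕ → A) (i : ℕ) :
    f (wsum p x i) = wsum p (fun r => f (x r)) i := by
  simp [wsum, map_sum]

theorem coe_ppow {p : ℕ} (hp : p.Prime) (i : ℕ) : (ppow p i : ℕ) = p ^ i := by
  simp [ppow, Nat.toPNat'_coe, pow_pos hp.pos]

theorem ghost_ppow {p : ℕ} (hp : p.Prime) (g : ℕ+ → A) (i : ℕ) :
    ghost g (ppow p i) = wsum p (fun r => g (ppow p r)) i := by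
  rw [ghost_eq_sum, coe_ppow hp, Nat.divisors_prime_pow hp, Finset.sum_map, wsum]
  refine Finset.sum_congr rfl fun r hr => ?_
  have : r ≤ i := Nat.lt_succ_iff.1 (Finset.mem_range.1 hr)
  simp [ppow, Nat.pow_div this hp.pos]

theorem commEval_wittPolynomial {R : Type*} [CommRing R] [Algebra R A] {p : ℕ} {x : ℕ → A}
    (hx : CommFam x) (i : ℕ) : commEval R hx (wittPolynomial p R i) = wsum p x i := by
  rw [wittPolynomial_eq_sum_C_mul_X_pow, wsum, map_sum]
  refine Finset.sum_congr rfl fun r _ => ?_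
  simp

theorem wsum_eq_add (p : ℕ) (x : ℕ → A) (i : ℕ) :
    wsum p x i =
      ∑ r ∈ Finset.range i, (p : A) ^ r * x r ^ p ^ (i - r) + (p : A) ^ i * x i := by
  rw [wsum, Finset.sum_range_succ]
  simp

variable [Algebra ℚ A]

theorem pow_mul_cancel_rat {p : ℕ} (hp : p.Prime) (i : ℕ) {u v : A}
    (h : (p : A) ^ i * u = (p : A) ^ i * v) : u = v := by
  have h0 : ((p : ℚ) ^ i) ≠ 0 := pow_ne_zero _ (by exact_mod_cast hp.ne_zero)
  have h1 : (p : A) ^ i = algebraMap ℚ A ((p : ℚ) ^ i) := by simp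
  rw [h1, ← Algebra.smul_def, ← Algebra.smul_def] at h
  simpa [smul_smul, h0] using congrArg (fun z => ((p : ℚ) ^ i)⁻¹ • z) h

theorem wsum_injective {p : ℕ} (hp : p.Prime) {x x' : ℕ → A} (h : ∀ i, wsum p x i = wsum p x' i)
    (i : ℕ) : x i = x' i := by
  induction i using Nat.strong_induction_on with
  | h i ih =>
    have h' := h i
    rw [wsum_eq_add, wsum_eq_add] at h'
    have e : ∑ r ∈ Finset.range i, (p : A) ^ r * x r ^ p ^ (i - r) =
        ∑ r ∈ Finset.range i, (p : A) ^ r * x' r ^ p ^ (i - r) :=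
      Finset.sum_congr rfl fun r hr => by rw [ih r (Finset.mem_range.1 hr)]
    rw [e] at h'
    exact pow_mul_cancel_rat hp i (add_left_cancel h')

theorem commute_of_wsum {p : ℕ} (hp : p.Prime) {x : ℕ → A} {z : A}
    (h : ∀ i, Commute z (wsum p x i)) (i : ℕ) : Commute z (x i) := by
  induction i using Nat.strong_induction_on with
  | h i ih =>
    have h' := h i
    rw [wsum_eq_add] at h'
    have e : Commute z (∑ r ∈ Finset.range i, (p : A) ^ r * x r ^ p ^ (i - r)) :=
      Commute.sum_right _ _ _ fun r hr =>
        (((Nat.cast_commute p z).symm.pow_right r)).mul_right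
          ((ih r (Finset.mem_range.1 hr)).pow_right _)
    have h2 := h'.sub_right e
    rw [add_sub_cancel_left] at h2
    refine pow_mul_cancel_rat hp i ?_
    have h3 : z * (p : A) ^ i = (p : A) ^ i * z := ((Nat.cast_commute p z).symm.pow_right i).eq
    rw [← mul_assoc, ← h3, mul_assoc, h2.eq, mul_assoc]

theorem commFam_of_wsum {p : ℕ} (hp : p.Prime) {x : ℕ → A}
    (h : ∀ i k, Commute (wsum p x i) (wsum p x k)) : CommFam x := fun i k =>
  commute_of_wsum hp (fun i' => (commute_of_wsum hp (fun k' => h i' k') i).symm |>.symm.symm) k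

end Ghost

section BQ

theorem ghost_bx (k : ℕ+) : ghost bx k = RingQuot.mkAlgHom ℚ BRel (ghost bXf k) :=
  (map_ghost (RingQuot.mkAlgHom ℚ BRel).toRingHom bXf k).symm

theorem ghost_by (k : ℕ+) : ghost by' k = RingQuot.mkAlgHom ℚ BRel (ghost bYf k) :=
  (map_ghost (RingQuot.mkAlgHom ℚ BRel).toRingHom bYf k).symm

theorem ghost_bx_comm (k l : ℕ+) : Commute (ghost bx k) (ghost bx l) := by
  rw [commute_iff_eq, ghost_bx, ghost_bx, ← map_mul, ← map_mul]
  exact RingQuot.mkAlgHom_rel ℚ (BRel.xx k l)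

theorem ghost_by_comm (k l : ℕ+) : Commute (ghost by' k) (ghost by' l) := by
  rw [commute_iff_eq, ghost_by, ghost_by, ← map_mul, ← map_mul]
  exact RingQuot.mkAlgHom_rel ℚ (BRel.yy k l)

theorem ghost_by_bx (k l : ℕ+) : ghost by' l * ghost bx k =
    ghost bx k * ghost by' l + if k = l then ((k : ℕ) : BQ) else 0 := by
  rw [ghost_bx, ghost_by, ← map_mul, ← map_mul, RingQuot.mkAlgHom_rel ℚ (BRel.yx k l), map_add]
  split_ifs <;> simp

theorem exists_bq_hom {A : Type*} [Ring A] [Algebra ℚ A] (W V : ℕ+ → A)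
    (hW : ∀ k l, Commute (W k) (W l)) (hV : ∀ k l, Commute (V k) (V l))
    (hVW : ∀ k l, V l * W k = W k * V l + if k = l then ((k : ℕ) : A) else 0) :
    ∃ f : BQ →ₐ[ℚ] A, (∀ k, f (ghost bx k) = W k) ∧ ∀ k, f (ghost by' k) = V k := by
  let f₀ : FreeAlgebra ℚ (ℕ+ ⊕ ℕ+) →ₐ[ℚ] A :=
    FreeAlgebra.lift ℚ (Sum.elim (ghostSolve W) (ghostSolve V))
  have hx : ∀ k, f₀ (ghost bXf k) = W k := fun k => by
    rw [← ghost_ghostSolve W k]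
    refine (map_ghost f₀.toRingHom bXf k).trans ?_
    congr 1
    ext d
    simp [f₀, bXf]
  have hy : ∀ k, f₀ (ghost bYf k) = V k := fun k => by
    rw [← ghost_ghostSolve V k]
    refine (map_ghost f₀.toRingHom bYf k).trans ?_
    congr 1
    ext d
    simp [f₀, bYf]
  let f : BQ →ₐ[ℚ] A := RingQuot.liftAlgHom ℚ ⟨f₀, fun a b h => by
    cases h with
    | xx k l => rw [map_mul, map_mul, hx, hx, (hW k l).eq]
    | yy k l => rw [map_mul, map_mul, hy, hy, (hV k l).eq]
    | yx k l =>
      rw [map_mul, map_add, map_mul, hx, hy, hVW]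
      split_ifs <;> simp⟩
  refine ⟨f, fun k => ?_, fun k => ?_⟩
  · rw [ghost_bx, ← hx]
    exact RingQuot.liftAlgHom_mkAlgHom_apply ..
  · rw [ghost_by, ← hy]
    exact RingQuot.liftAlgHom_mkAlgHom_apply ..

open MvPolynomial in
theorem pderiv_comm {σ R : Type*} [CommRing R] (i j : σ) (q : MvPolynomial σ R) :
    pderiv i (pderiv j q) = pderiv j (pderiv i q) := by
  classical
  have h : ⁅pderiv (R := R) i, pderiv j⁆ = 0 := MvPolynomial.derivation_ext fun k => by
    rw [Derivation.commutator_apply, pderiv_X, pderiv_X, Pi.single_apply, Pi.single_apply]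
    split_ifs <;> simp
  simpa [Derivation.commutator_apply, sub_eq_zero] using congrArg (fun D => D q) h

open MvPolynomial in
theorem nontrivial_bq : Nontrivial BQ := by
  let P := MvPolynomial ℕ+ ℚ
  obtain ⟨f, -, -⟩ := exists_bq_hom (A := Module.End ℚ P) (fun k => LinearMap.mulLeft ℚ (X k))
    (fun k => ((k : ℕ) : ℚ) • (pderiv k).toLinearMap)
    (fun k l => LinearMap.ext fun q => by
      simp only [Module.End.mul_apply, LinearMap.mulLeft_apply]; ring)
    (fun k l => LinearMap.ext fun q => by
      simp only [Module.End.mul_apply, LinearMap.smul_apply, map_smul]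
      rw [smul_comm]
      congr 2
      exact pderiv_comm k l q)
    (fun k l => LinearMap.ext fun q => by
      have h1 : ∀ u : P, (pderiv l).toLinearMap u = pderiv l u := fun _ => rfl
      simp only [Module.End.mul_apply, LinearMap.smul_apply, LinearMap.mulLeft_apply,
        LinearMap.add_apply, h1]
      rw [pderiv_mul]
      by_cases h : k = l
      · subst h
        simp [smul_add, add_comm, Nat.cast_smul_eq_nsmul, mul_left_comm]
      · rw [pderiv_X_of_ne h]
        simp [h])
  exact f.toRingHom.domain_nontrivial

end BQ

section Gamma

/-- The generator `x_{p^i}` of `B(ℚ)`. -/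
def bX (p i : ℕ) : BQ := bx (ppow p i)

/-- The generator `y_{p^j}` of `B(ℚ)`. -/
def bY (p j : ℕ) : BQ := by' (ppow p j)

/-- The `p`-typical version of `IsCFamily`, the variables being indexed by exponents. -/
structure IsGamma (p : ℕ) (γ : ℕ → ℕ → MvPolynomial (ℕ ⊕ₗ ℕ) ℤ) : Prop where
  vars : ∀ i j, ∀ v ∈ (γ i j).vars, (∃ r < i, v = renL r) ∨ ∃ s < j, v = renR s
  rel : ∀ i j, bY p j * bX p i = bX p i * bY p j + intEval (bX p) (bY p) (γ i j)

/-- The `p`-typical part of a family `c`, with the variables reindexed by exponents. -/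
def gammaOf (p : ℕ) (c : ℕ+ → ℕ+ → MvPolynomial (ℕ+ ⊕ₗ ℕ+) ℤ) (i j : ℕ) :
    MvPolynomial (ℕ ⊕ₗ ℕ) ℤ :=
  rename (fun v => toLex (Sum.map (fun d : ℕ+ => padicValNat p d) (fun d : ℕ+ => padicValNat p d)
    (ofLex v))) (c (ppow p i) (ppow p j))

variable {p : ℕ}

theorem cEval_ppow {A : Type*} [Ring A] {x y : ℕ → A} (hx : CommFam x) (hy : CommFam y)
    (c : ℕ+ → ℕ+ → MvPolynomial (ℕ+ ⊕ₗ ℕ+) ℤ) (i j : ℕ) :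
    cEval (fun d => x (padicValNat p d)) (fun d => y (padicValNat p d)) (c (ppow p i) (ppow p j)) =
      intEval x y (gammaOf p c i j) := by
  rw [cEval_eq_intEval, gammaOf, intEval_rename hx hy]
  rfl

theorem wsum_bX (hp : p.Prime) (i : ℕ) : wsum p (bX p) i = ghost bx (ppow p i) :=
  (ghost_ppow hp bx i).symm

theorem wsum_bY (hp : p.Prime) (j : ℕ) : wsum p (bY p) j = ghost by' (ppow p j) :=
  (ghost_ppow hp by' j).symm

theorem commFam_bX (hp : p.Prime) : CommFam (bX p) :=
  commFam_of_wsum hp fun i k => by rw [wsum_bX hp, wsum_bX hp]; exact ghost_bx_comm _ _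

theorem commFam_bY (hp : p.Prime) : CommFam (bY p) :=
  commFam_of_wsum hp fun i k => by rw [wsum_bY hp, wsum_bY hp]; exact ghost_by_comm _ _

theorem ppow_injective (hp : p.Prime) : Function.Injective (ppow p) := fun i j h =>
  Nat.pow_right_injective hp.two_le (by
    simpa only [coe_ppow hp] using congrArg (fun k : ℕ+ => (k : ℕ)) h)

theorem wsum_bY_bX (hp : p.Prime) (i j : ℕ) : wsum p (bY p) j * wsum p (bX p) i =
    wsum p (bX p) i * wsum p (bY p) j + if i = j then (p : BQ) ^ i else 0 := by
  rw [wsum_bX hp, wsum_bY hp, ghost_by_bx, coe_ppow hp, Nat.cast_pow]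
  simp only [(ppow_injective hp).eq_iff]

theorem wsum_zero {A : Type*} [Ring A] (x : ℕ → A) : wsum p x 0 = x 0 := by simp [wsum]

theorem ppow_padicValNat (hp : p.Prime) {d : ℕ+} {i : ℕ} (h : (d : ℕ) ∣ (ppow p i : ℕ)) :
    ppow p (padicValNat p d) = d ∧ padicValNat p d ≤ i := by
  have := Fact.mk hp
  rw [coe_ppow hp] at h
  obtain ⟨r, hr, hd⟩ := (Nat.dvd_prime_pow hp).1 h
  have : padicValNat p (d : ℕ) = r := by rw [hd, padicValNat.prime_pow]
  rw [this]
  exact ⟨PNat.coe_injective (by rw [coe_ppow hp, hd]), hr⟩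

theorem isGamma_gammaOf (hp : p.Prime) {c : ℕ+ → ℕ+ → MvPolynomial (ℕ+ ⊕ₗ ℕ+) ℤ}
    (hc : IsCFamily c) : IsGamma p (gammaOf p c) where
  vars i j v hv := by
    classical
    obtain ⟨w, hw, rfl⟩ := Finset.mem_image.1 (vars_rename _ _ hv)
    rcases (hc _ _).1 w hw with ⟨d, hd, hne, hw⟩ | ⟨d, hd, hne, hw⟩
    · obtain ⟨h1, h2⟩ := ppow_padicValNat hp hd
      refine Or.inl ⟨_, lt_of_le_of_ne h2 fun h => hne ?_, by rw [hw]; rfl⟩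
      rw [← h1, h]
    · obtain ⟨h1, h2⟩ := ppow_padicValNat hp hd
      refine Or.inr ⟨_, lt_of_le_of_ne h2 fun h => hne ?_, by rw [hw]; rfl⟩
      rw [← h1, h]
  rel i j := by
    rw [← cEval_ppow (commFam_bX hp) (commFam_bY hp), ← sub_eq_iff_eq_add', bX, bY,
      ← (hc (ppow p i) (ppow p j)).2, cEval_eq_intEval, cEval_eq_intEval]
    refine intEval_congr (fun d hd => ?_) (fun d hd => ?_)
    · rcases (hc _ _).1 _ hd with ⟨d', hd', -, h⟩ | ⟨d', -, -, h⟩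
      · obtain rfl : d = d' := Sum.inl_injective h
        rw [bX, (ppow_padicValNat hp hd').1]
      · cases h
    · rcases (hc _ _).1 _ hd with ⟨d', -, -, h⟩ | ⟨d', hd', -, h⟩
      · cases h
      · obtain rfl : d = d' := Sum.inr_injective h
        rw [bY, (ppow_padicValNat hp hd').1]

/-- The family `γ` with the roles of the two sets of variables exchanged. -/
def swapGamma (γ : ℕ → ℕ → MvPolynomial (ℕ ⊕ₗ ℕ) ℤ) (j i : ℕ) : MvPolynomial (ℕ ⊕ₗ ℕ) ℤ :=
  rename swapVar (γ i j)

theorem IsGamma.swap (hp : p.Prime) {γ : ℕ → ℕ → MvPolynomial (ℕ ⊕ₗ ℕ) ℤ} (hγ : IsGamma p γ) :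
    IsGamma p (swapGamma γ) where
  vars j i v hv := by
    classical
    obtain ⟨w, hw, rfl⟩ := Finset.mem_image.1 (vars_rename _ _ hv)
    rcases hγ.vars i j w hw with ⟨r, hr, rfl⟩ | ⟨s, hs, rfl⟩
    · exact Or.inr ⟨r, hr, rfl⟩
    · exact Or.inl ⟨s, hs, rfl⟩
  rel j i := by
    obtain ⟨f, hf, hg⟩ := exists_bq_hom (A := BQᵐᵒᵖ) (fun k => MulOpposite.op (ghost by' k))
      (fun k => MulOpposite.op (ghost bx k)) (fun k l => (ghost_by_comm k l).op)
      (fun k l => (ghost_bx_comm k l).op) (fun k l => by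
        rw [← MulOpposite.op_mul, ← MulOpposite.op_mul, ghost_by_bx]
        by_cases h : k = l
        · subst h; simp
        · simp [h, Ne.symm h])
    have hwop : ∀ (x : ℕ → BQ) (i : ℕ),
        wsum p (fun r => MulOpposite.op (x r)) i = MulOpposite.op (wsum p x i) := fun x i => by
      refine Eq.trans (Finset.sum_congr rfl fun r _ => ?_)
        (map_sum MulOpposite.opAddEquiv _ _).symm
      rw [MulOpposite.opAddEquiv_apply, ← MulOpposite.op_pow, ← MulOpposite.op_natCast,
        ← MulOpposite.op_pow, ← MulOpposite.op_mul, ((Nat.cast_commute p _).pow_left r).eq]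
    have hX : ∀ i, f (bX p i) = MulOpposite.op (bY p i) := wsum_injective hp fun i => by
      rw [hwop, wsum_bY hp, ← hf, ← wsum_bX hp]
      exact (map_wsum f.toRingHom p (bX p) i).symm
    have hY : ∀ i, f (bY p i) = MulOpposite.op (bX p i) := wsum_injective hp fun i => by
      rw [hwop, wsum_bX hp, ← hg, ← wsum_bY hp]
      exact (map_wsum f.toRingHom p (bY p) i).symm
    have h := congrArg f (hγ.rel i j)
    rw [map_add, map_mul, map_mul, hX, hY, map_intEval] at h
    simp only [hX, hY] at h
    have hswap : rename swapVar (swapGamma γ j i) = γ i j := by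
      rw [swapGamma, rename_rename]
      have : (swapVar ∘ swapVar : ℕ ⊕ₗ ℕ → ℕ ⊕ₗ ℕ) = id := by
        funext v
        rcases hv : ofLex v with i | j <;> simp [swapVar, hv] <;> rw [← hv] <;> rfl
      rw [this, rename_id_apply]
    rw [← hswap, intEval_op_swap (commFam_bX hp) (commFam_bY hp), ← MulOpposite.op_mul,
      ← MulOpposite.op_mul, ← MulOpposite.op_add] at h
    exact MulOpposite.op_injective h

end Gamma

section FrobFam
variable {p : ℕ} [Fact p.Prime] {A : Type*} [Ring A]

/-- The Frobenius of a commuting family, viewed as the components of a Witt vector. -/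
def frobFam (p : ℕ) [Fact p.Prime] {x : ℕ → A} (hx : CommFam x) (i : ℕ) : A :=
  commEval ℤ hx (WittVector.frobeniusPoly p i)

theorem commFam_frobFam {x : ℕ → A} (hx : CommFam x) : CommFam (frobFam p hx) := fun i j => by
  rw [commute_iff_eq, frobFam, frobFam, ← map_mul, ← map_mul, mul_comm]

theorem map_frobFam {B : Type*} [Ring B] (f : A →+* B) {x : ℕ → A} (hx : CommFam x) (i : ℕ) :
    f (frobFam p hx i) = frobFam p (hx.map f) i :=
  map_commEval hx f.toIntAlgHom _

theorem frobFam_eq_pow (hp : (p : A) = 0) {x : ℕ → A} (hx : CommFam x) (i : ℕ) :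
    frobFam p hx i = x i ^ p := by
  rw [frobFam, WittVector.frobeniusPoly]
  simp [hp]

theorem wsum_frobFam {x : ℕ → A} (hx : CommFam x) (i : ℕ) :
    wsum p (frobFam p hx) i = wsum p x (i + 1) := by
  rw [← commEval_wittPolynomial (R := ℤ) hx, ← WittVector.bind₁_frobeniusPoly_wittPolynomial,
    ← commEval_wittPolynomial (R := ℤ) (commFam_frobFam hx)]
  exact (commEval_aeval hx (commFam_frobFam hx) (fun _ => rfl) _).symm

end FrobFam

section Shift
variable {p : ℕ} [Fact p.Prime]

theorem bY_zero (p : ℕ) : bY p 0 = ghost by' 1 := by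
  have : ppow p 0 = 1 := by simp [ppow]; rfl
  rw [bY, this, ghost_eq_low_add, ghostLow_eq_sum]
  simp

omit [Fact p.Prime] in
theorem bY_zero_commute_ghost {k : ℕ+} (hk : k ≠ 1) : Commute (bY p 0) (ghost bx k) := by
  rw [commute_iff_eq, bY_zero, ghost_by_bx, if_neg hk, add_zero]

omit [Fact p.Prime] in
theorem bY_zero_commute_ghost_by (k : ℕ+) : Commute (bY p 0) (ghost by' k) := by
  rw [bY_zero]
  exact ghost_by_comm _ _

theorem ppow_ne_one (i : ℕ) : ppow p (i + 1) ≠ 1 := fun h => by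
  have hp : p.Prime := Fact.out
  have := congrArg (fun k : ℕ+ => (k : ℕ)) h
  simp only [coe_ppow hp, PNat.one_coe, Nat.pow_eq_one] at this
  exact absurd this (by simp [hp.one_lt.ne'])

theorem exists_shift_hom (p : ℕ) [Fact p.Prime] : ∃ f : BQ →ₐ[ℚ] BQ,
    (∀ i, f (bX p i) = frobFam p (commFam_bX (p := p) Fact.out) i) ∧
      ∀ j, f (bY p j) = bY p (j + 1) := by
  classical
  have hp : p.Prime := Fact.out
  have hp0 : (p : ℚ) ≠ 0 := by exact_mod_cast hp.ne_zero
  let v : ℕ+ → ℕ := fun k => padicValNat p k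
  have hv : ∀ i, v (ppow p i) = i := fun i => by simp [v, coe_ppow hp]
  let s : ℕ+ → ℕ+ := fun k => if k = ppow p (v k) then ppow p (v k + 1) else k
  let r : ℕ+ → ℚ := fun k => if k = ppow p (v k) then (p : ℚ)⁻¹ else 1
  let z : ℕ+ → BQ := fun k => if k = ppow p (v k) then bY p 0 ^ p ^ (v k + 1) else 0
  have hs1 : ∀ k, s k ≠ 1 := fun k => by
    by_cases hk : k = ppow p (v k)
    · simp only [s, if_pos hk]
      exact ppow_ne_one _
    · simp only [s, if_neg hk]
      rintro rfl
      exact hk (PNat.coe_injective (by simp [v, coe_ppow hp]))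
  have hsinj : Function.Injective s := fun k l h => by
    by_cases hk : k = ppow p (v k) <;> by_cases hl : l = ppow p (v l)
    · simp only [s, if_pos hk, if_pos hl] at h
      rw [hk, hl, Nat.succ_injective (ppow_injective hp h)]
    · simp only [s, if_pos hk, if_neg hl] at h
      exact absurd (by rw [← h, hv]) hl
    · simp only [s, if_neg hk, if_pos hl] at h
      exact absurd (by rw [h, hv]) hk
    · simpa only [s, if_neg hk, if_neg hl] using h
  have hrs : ∀ k, r k * (s k : ℕ) = (k : ℕ) := fun k => by
    by_cases hk : k = ppow p (v k)
    · simp only [s, r, if_pos hk]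
      conv_rhs => rw [hk]
      rw [coe_ppow hp, coe_ppow hp, pow_succ]
      push_cast
      field_simp
    · simp [s, r, if_neg hk]
  have hzx : ∀ k l, Commute (z k) (ghost bx (s l)) := fun k l => by
    by_cases hk : k = ppow p (v k)
    · simp only [z, if_pos hk]
      exact (bY_zero_commute_ghost (hs1 l)).pow_left _
    · simp [z, if_neg hk]
  have hzy : ∀ k l, Commute (z k) (ghost by' l) := fun k l => by
    by_cases hk : k = ppow p (v k)
    · simp only [z, if_pos hk]
      exact (bY_zero_commute_ghost_by l).pow_left _
    · simp [z, if_neg hk]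
  have hzz : ∀ k l, Commute (z k) (z l) := fun k l => by
    by_cases hl : l = ppow p (v l)
    · simp only [z, if_pos hl]
      have h := hzy k 1
      rw [← bY_zero p] at h
      exact h.pow_right _
    · simp [z, if_neg hl]
  obtain ⟨f, hfx, hfy⟩ := exists_bq_hom (fun k => ghost bx (s k))
    (fun k => r k • (ghost by' (s k) - z k)) (fun k l => ghost_bx_comm _ _)
    (fun k l => ((((ghost_by_comm _ _).sub_right (hzy l (s k)).symm).sub_left
      ((hzy k (s l)).sub_right (hzz k l))).smul_left _).smul_right _)
    (fun k l => by
      rw [smul_mul_assoc, mul_smul_comm, sub_mul, mul_sub, ghost_by_bx, (hzx l k).eq,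
        add_sub_right_comm, smul_add]
      congr 1
      by_cases h : k = l
      · subst h
        rw [if_pos rfl, if_pos rfl, ← nsmul_one, ← Nat.cast_smul_eq_nsmul ℚ, smul_smul, hrs,
          Nat.cast_smul_eq_nsmul, nsmul_one]
      · rw [if_neg h, if_neg fun h' => h (hsinj h'), smul_zero])
  have hsp : ∀ i, s (ppow p i) = ppow p (i + 1) := fun i => by simp only [s, hv, if_true]
  refine ⟨f, wsum_injective hp fun i => ?_, wsum_injective hp fun j => ?_⟩
  · rw [wsum_frobFam, wsum_bX hp, ← hsp, ← hfx, ← wsum_bX hp]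
    exact (map_wsum f.toRingHom p (bX p) i).symm
  · have h1 : wsum p (fun j => f (bY p j)) j = f (wsum p (bY p) j) :=
      (map_wsum f.toRingHom p (bY p) j).symm
    have hr : r (ppow p j) = (p : ℚ)⁻¹ := by simp only [r, hv, if_true]
    have hz : z (ppow p j) = bY p 0 ^ p ^ (j + 1) := by simp only [z, hv, if_true]
    have h2 : wsum p (bY p) (j + 1) =
        (p : ℚ) • wsum p (fun j => bY p (j + 1)) j + bY p 0 ^ p ^ (j + 1) := by
      rw [wsum, Finset.sum_range_succ', wsum, Finset.smul_sum]
      congr 1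
      · refine Finset.sum_congr rfl fun r _ => ?_
        rw [pow_succ', Nat.add_sub_add_right, Nat.cast_smul_eq_nsmul, nsmul_eq_mul, mul_assoc]
      · simp
    rw [h1, wsum_bY hp, hfy, hsp, ← wsum_bY hp, hr, hz, h2, add_sub_cancel_right, smul_smul,
      inv_mul_cancel₀ hp0, one_smul]

theorem bY_succ_frobFam {γ : ℕ → ℕ → MvPolynomial (ℕ ⊕ₗ ℕ) ℤ} (hγ : IsGamma p γ) (i j : ℕ) :
    bY p (j + 1) * frobFam p (commFam_bX (p := p) Fact.out) i =
      frobFam p (commFam_bX (p := p) Fact.out) i * bY p (j + 1) +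
        intEval (frobFam p (commFam_bX (p := p) Fact.out)) (fun j => bY p (j + 1)) (γ i j) := by
  obtain ⟨f, hx, hy⟩ := exists_shift_hom p
  have h := congrArg f (hγ.rel i j)
  rw [map_add, map_mul, map_mul, map_intEval] at h
  simp only [hx, hy] at h
  exact h

theorem bY_zero_frobFam (i : ℕ) :
    Commute (bY p 0) (frobFam p (commFam_bX (p := p) Fact.out) i) := by
  have hp : p.Prime := Fact.out
  refine commute_of_wsum hp (fun i => ?_) i
  rw [wsum_frobFam, wsum_bX hp]
  exact bY_zero_commute_ghost (ppow_ne_one i)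

theorem bY_zero_bX_zero : bY p 0 * bX p 0 = bX p 0 * bY p 0 + 1 := by
  have := wsum_bY_bX (p := p) Fact.out 0 0
  simpa [wsum_zero] using this

end Shift

section PBW
variable {p : ℕ}

theorem commEval_heisenberg {A : Type*} [Ring A] [Algebra ℚ A] {x : ℕ → A} (hx : CommFam x) {z : A}
    {i : ℕ} {r : ℚ} (hz : ∀ k, z * x k = x k * z + if k = i then algebraMap ℚ A r else 0)
    (f : MvPolynomial ℕ ℚ) :
    z * commEval ℚ hx f = commEval ℚ hx f * z + r • commEval ℚ hx (pderiv i f) := by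
  induction f using MvPolynomial.induction_on with
  | C a =>
    rw [pderiv_C, ← MvPolynomial.algebraMap_eq, AlgHom.commutes, map_zero, smul_zero, add_zero,
      Algebra.commutes]
  | add p q hp hq => simp only [map_add, mul_add, add_mul, hp, hq, smul_add]; abel
  | mul_X q k hq =>
    rw [map_mul, commEval_X, ← mul_assoc, hq, add_mul, mul_assoc, hz, pderiv_mul, map_add, map_mul,
      map_mul, commEval_X, mul_add, smul_add, smul_mul_assoc, mul_assoc]
    have : commEval ℚ hx q * (if k = i then algebraMap ℚ A r else 0) =
        r • (commEval ℚ hx q * commEval ℚ hx (pderiv i (X k))) := by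
      by_cases h : k = i
      · subst h
        rw [if_pos rfl, pderiv_X_self, map_one, mul_one, ← Algebra.commutes, Algebra.smul_def]
      · rw [if_neg h, pderiv_X_of_ne h, map_zero, mul_zero, smul_zero]
    rw [this]
    abel

theorem totalDegree_pderiv_lt {σ : Type*} {q : MvPolynomial σ ℚ} {i : σ} {n : ℕ}
    (hq : q.totalDegree ≤ n + 1) : (pderiv i q).totalDegree ≤ n := by
  classical
  rw [totalDegree, Finset.sup_le_iff]
  intro e he
  rw [mem_support_iff, coeff_pderiv] at he
  have h1 : e + Finsupp.single i 1 ∈ q.support := mem_support_iff.2 (left_ne_zero_of_mul he)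
  have h2 := le_totalDegree h1
  rw [Finsupp.sum_add_index' (by simp) (by simp), Finsupp.sum_single_index rfl] at h2
  omega

theorem eq_C_of_pderiv_eq_zero {σ : Type*} {q : MvPolynomial σ ℚ} (h : ∀ i, pderiv i q = 0) :
    q = C (coeff 0 q) := by
  classical
  ext e
  rw [coeff_C]
  split_ifs with he
  · rw [he]
  · obtain ⟨i, hi⟩ : ∃ i, e i ≠ 0 := by
      by_contra! hc
      exact he (Finsupp.ext fun i => (hc i).symm)
    have h1 := congrArg (coeff (e - Finsupp.single i 1)) (h i)
    have h2 : e - Finsupp.single i 1 + Finsupp.single i 1 = e := by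
      refine tsub_add_cancel_of_le ?_
      rw [Finsupp.single_le_iff]
      omega
    rw [coeff_pderiv, h2, coeff_zero] at h1
    refine (mul_eq_zero.1 h1).resolve_right ?_
    positivity

theorem eq_bot_of_pderiv_stable {σ : Type*} (P : MvPolynomial σ ℚ → Prop)
    (hP : ∀ q i, P q → P (pderiv i q)) (hC : ∀ r, P (C r) → r = 0) {q : MvPolynomial σ ℚ}
    (hq : P q) : q = 0 := by
  suffices ∀ n, ∀ q : MvPolynomial σ ℚ, q.totalDegree ≤ n → P q → q = 0 from
    this _ q le_rfl hq
  intro n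
  induction n with
  | zero =>
    intro q h hq
    rw [totalDegree_eq_zero_iff_eq_C.1 (Nat.le_zero.1 h)] at hq ⊢
    rw [hC _ hq, map_zero]
  | succ n ih =>
    intro q h hq
    have := eq_C_of_pderiv_eq_zero fun i => ih _ (totalDegree_pderiv_lt h) (hP q i hq)
    rw [this] at hq ⊢
    rw [hC _ hq, map_zero]

theorem pderiv_renL_split {σ τ : Type*} (i : σ) (f : MvPolynomial σ ℚ) (g : MvPolynomial τ ℚ) :
    pderiv (renL i) (rename renL f * rename (renR : τ → σ ⊕ₗ τ) g) =
      rename renL (pderiv i f) * rename renR g := by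
  classical
  have hinj : Function.Injective (renL : σ → σ ⊕ₗ τ) := fun a b h => Sum.inl_injective h
  rw [pderiv_mul, pderiv_rename hinj, pderiv_eq_zero_of_notMem_vars (f := rename renR g), mul_zero,
    add_zero]
  intro h
  obtain ⟨w, -, hw⟩ := Finset.mem_image.1 (vars_rename _ _ h)
  cases hw

theorem pderiv_renR_split {σ τ : Type*} (i : τ) (f : MvPolynomial σ ℚ) (g : MvPolynomial τ ℚ) :
    pderiv (renR i) (rename (renL : σ → σ ⊕ₗ τ) f * rename renR g) =
      rename renL f * rename renR (pderiv i g) := by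
  classical
  have hinj : Function.Injective (renR : τ → σ ⊕ₗ τ) := fun a b h => Sum.inr_injective h
  rw [pderiv_mul, pderiv_rename hinj, pderiv_eq_zero_of_notMem_vars (f := rename renL f), zero_mul,
    zero_add]
  intro h
  obtain ⟨w, -, hw⟩ := Finset.mem_image.1 (vars_rename _ _ h)
  cases hw

theorem commEval_heisenberg' {A : Type*} [Ring A] [Algebra ℚ A] {y : ℕ → A} (hy : CommFam y) {z : A}
    {i : ℕ} {r : ℚ} (hz : ∀ k, z * y k + (if k = i then algebraMap ℚ A r else 0) = y k * z)
    (f : MvPolynomial ℕ ℚ) :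
    z * commEval ℚ hy f + r • commEval ℚ hy (pderiv i f) = commEval ℚ hy f * z := by
  rw [commEval_heisenberg hy (r := -r) (i := i), neg_smul, neg_add_cancel_right]
  intro k
  rw [← hz k]
  split_ifs <;> simp

theorem normEval_heisenberg {A : Type*} [Ring A] [Algebra ℚ A] {x y : ℕ → A} (hx : CommFam x)
    (hy : CommFam y) {z : A} {i : ℕ} {r : ℚ} (hzy : ∀ k, Commute z (y k))
    (hz : ∀ k, z * x k = x k * z + if k = i then algebraMap ℚ A r else 0)
    (q : MvPolynomial (ℕ ⊕ₗ ℕ) ℚ) :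
    z * normEval ℚ x y q = normEval ℚ x y q * z + r • normEval ℚ x y (pderiv (renL i) q) := by
  induction q using induction_split with
  | hadd p q hp hq => simp only [map_add, mul_add, add_mul, hp, hq, smul_add]; abel
  | hmul f g =>
    rw [pderiv_renL_split, normEval_mul hx hy, normEval_mul hx hy, ← mul_assoc,
      commEval_heisenberg hx hz, add_mul, mul_assoc, (commute_commEval hy hzy g).eq,
      smul_mul_assoc, mul_assoc]

theorem normEval_heisenberg' {A : Type*} [Ring A] [Algebra ℚ A] {x y : ℕ → A} (hx : CommFam x)
    (hy : CommFam y) {z : A} {i : ℕ} {r : ℚ} (hzx : ∀ k, Commute z (x k))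
    (hz : ∀ k, z * y k + (if k = i then algebraMap ℚ A r else 0) = y k * z)
    (q : MvPolynomial (ℕ ⊕ₗ ℕ) ℚ) :
    z * normEval ℚ x y q + r • normEval ℚ x y (pderiv (renR i) q) = normEval ℚ x y q * z := by
  induction q using induction_split with
  | hadd p q hp hq => simp only [map_add, mul_add, add_mul, ← hp, ← hq, smul_add]; abel
  | hmul f g =>
    rw [pderiv_renR_split, normEval_mul hx hy, normEval_mul hx hy, ← mul_assoc,
      (commute_commEval hx hzx f).eq, mul_assoc _ _ z, ← commEval_heisenberg' hy hz, mul_add,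
      mul_assoc, mul_smul_comm]

theorem normEval_wsum_injective (hp : p.Prime) {q : MvPolynomial (ℕ ⊕ₗ ℕ) ℚ}
    (hq : normEval ℚ (wsum p (bX p)) (wsum p (bY p)) q = 0) : q = 0 := by
  have hp0 : ∀ i : ℕ, (p : ℚ) ^ i ≠ 0 := fun i => pow_ne_zero _ (by exact_mod_cast hp.ne_zero)
  have hx : CommFam (wsum p (bX p)) := fun i k => by
    rw [wsum_bX hp, wsum_bX hp]; exact ghost_bx_comm _ _
  have hy : CommFam (wsum p (bY p)) := fun i k => by
    rw [wsum_bY hp, wsum_bY hp]; exact ghost_by_comm _ _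
  have := nontrivial_bq
  refine eq_bot_of_pderiv_stable
    (fun q => normEval ℚ (wsum p (bX p)) (wsum p (bY p)) q = 0) (fun q v hq => ?_)
    (fun r hr => ?_) hq
  · rcases hv : ofLex v with i | i
    · have hv' : v = renL i := by rw [renL, ← hv]; rfl
      have h := normEval_heisenberg hx hy (z := wsum p (bY p) i) (i := i) (r := (p : ℚ) ^ i)
        (fun k => hy i k) (fun k => by
          rw [wsum_bY_bX hp]
          by_cases h : k = i
          · rw [if_pos h, if_pos h, h]; simp
          · rw [if_neg h, if_neg h]) q
      rw [hq, mul_zero, zero_mul, zero_add] at h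
      rw [hv']
      exact (smul_eq_zero_iff_right (hp0 i)).1 h.symm
    · have hv' : v = renR i := by rw [renR, ← hv]; rfl
      have h := normEval_heisenberg' hx hy (z := wsum p (bX p) i) (i := i) (r := (p : ℚ) ^ i)
        (fun k => hx i k) (fun k => by
          rw [wsum_bY_bX hp]
          by_cases h : k = i
          · rw [if_pos h, if_pos h.symm]; simp
          · rw [if_neg h, if_neg (Ne.symm h)]) q
      rw [hq, mul_zero, zero_mul, zero_add] at h
      rw [hv']
      exact (smul_eq_zero_iff_right (hp0 i)).1 h
  · have h : C r = rename (renL : ℕ → ℕ ⊕ₗ ℕ) (C r) * rename renR (C (1 : ℚ)) := by simp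
    rw [h, normEval_mul hx hy, ← MvPolynomial.algebraMap_eq, AlgHom.commutes, map_one, map_one,
      mul_one] at hr
    exact (map_eq_zero_iff _ (algebraMap ℚ BQ).injective).1 hr

theorem normEval_bX_bY_injective (hp : p.Prime) {q : MvPolynomial (ℕ ⊕ₗ ℕ) ℚ}
    (hq : normEval ℚ (bX p) (bY p) q = 0) : q = 0 := by
  have := Fact.mk hp
  have hx : CommFam (wsum p (bX p)) := fun i k => by
    rw [wsum_bX hp, wsum_bX hp]; exact ghost_bx_comm _ _
  have hy : CommFam (wsum p (bY p)) := fun i k => by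
    rw [wsum_bY hp, wsum_bY hp]; exact ghost_by_comm _ _
  have hsolve : ∀ (x : ℕ → BQ) (hx : CommFam x) (hw : CommFam (wsum p x)) (i : ℕ),
      commEval ℚ hw (xInTermsOfW p ℚ i) = x i := fun x hx hw i => by
    rw [← commEval_aeval hx hw (commEval_wittPolynomial hx)]
    have := bind₁_wittPolynomial_xInTermsOfW p ℚ i
    exact (congrArg _ this).trans (commEval_X hx i)
  let t : MvPolynomial (ℕ ⊕ₗ ℕ) ℚ →ₐ[ℚ] MvPolynomial (ℕ ⊕ₗ ℕ) ℚ := aeval fun v =>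
    Sum.elim (fun i => rename renL (xInTermsOfW p ℚ i)) (fun i => rename renR (xInTermsOfW p ℚ i))
      (ofLex v)
  let u : MvPolynomial (ℕ ⊕ₗ ℕ) ℚ →ₐ[ℚ] MvPolynomial (ℕ ⊕ₗ ℕ) ℚ := aeval fun v =>
    Sum.elim (fun i => rename renL (wittPolynomial p ℚ i))
      (fun i => rename renR (wittPolynomial p ℚ i)) (ofLex v)
  have htL : ∀ f, t (rename renL f) = rename renL (bind₁ (xInTermsOfW p ℚ) f) := fun f => by
    refine DFunLike.congr_fun (f := t.comp (rename renL))
      (g := (rename renL).comp (bind₁ (xInTermsOfW p ℚ))) (algHom_ext fun i => ?_) f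
    simp [t]
  have htR : ∀ f, t (rename renR f) = rename renR (bind₁ (xInTermsOfW p ℚ) f) := fun f => by
    refine DFunLike.congr_fun (f := t.comp (rename renR))
      (g := (rename renR).comp (bind₁ (xInTermsOfW p ℚ))) (algHom_ext fun i => ?_) f
    simp [t]
  have huL : ∀ f, u (rename renL f) = rename renL (bind₁ (wittPolynomial p ℚ) f) := fun f => by
    refine DFunLike.congr_fun (f := u.comp (rename renL))
      (g := (rename renL).comp (bind₁ (wittPolynomial p ℚ))) (algHom_ext fun i => ?_) f
    simp [u]
  have huR : ∀ f, u (rename renR f) = rename renR (bind₁ (wittPolynomial p ℚ) f) := fun f => by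
    refine DFunLike.congr_fun (f := u.comp (rename renR))
      (g := (rename renR).comp (bind₁ (wittPolynomial p ℚ))) (algHom_ext fun i => ?_) f
    simp [u]
  have hut : ∀ q, u (t q) = q := fun q => by
    refine DFunLike.congr_fun (f := u.comp t) (g := AlgHom.id ℚ _) (algHom_ext fun v => ?_) q
    rcases hv : ofLex v with i | i
    · have hv' : v = renL i := by rw [renL, ← hv]; rfl
      rw [hv', AlgHom.comp_apply, ← rename_X (R := ℚ) renL, htL, bind₁_X_right, huL,
        bind₁_wittPolynomial_xInTermsOfW]
      rfl
    · have hv' : v = renR i := by rw [renR, ← hv]; rfl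
      rw [hv', AlgHom.comp_apply, ← rename_X (R := ℚ) renR, htR, bind₁_X_right, huR,
        bind₁_wittPolynomial_xInTermsOfW]
      rfl
  have ht : ∀ q, normEval ℚ (wsum p (bX p)) (wsum p (bY p)) (t q) = normEval ℚ (bX p) (bY p) q :=
    fun q => by
    induction q using induction_split with
    | hadd p q hp hq => simp only [map_add, hp, hq]
    | hmul f g =>
      rw [map_mul, htL, htR, normEval_mul hx hy, normEval_mul (commFam_bX hp) (commFam_bY hp)]
      congr 1
      · exact commEval_aeval hx _ (hsolve _ (commFam_bX hp) hx) f
      · exact commEval_aeval hy _ (hsolve _ (commFam_bY hp) hy) g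
  rw [← ht] at hq
  rw [← hut q, normEval_wsum_injective hp hq, map_zero]

theorem intEval_bX_bY_injective (hp : p.Prime) {q : MvPolynomial (ℕ ⊕ₗ ℕ) ℤ}
    (hq : intEval (bX p) (bY p) q = 0) : q = 0 := by
  rw [intEval_eq_normEval ℚ] at hq
  exact map_injective (Int.castRingHom ℚ) (RingHom.injective_int _)
    (by rw [normEval_bX_bY_injective hp hq, map_zero])

end PBW

section Span
variable {R : Type*} [CommRing R] {D : Type*} [Ring D] [Algebra R D]

open Subalgebra in
theorem toSubmodule_sup_adjoin_mul_le {S : Set D} {V : Subalgebra R D} {y : D}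
    (hV : toSubmodule V * toSubmodule (Algebra.adjoin R S) ≤
      toSubmodule (Algebra.adjoin R S) * toSubmodule V)
    (hy : ∀ x ∈ S, y * x - x * y ∈ toSubmodule (Algebra.adjoin R S) * toSubmodule V) :
    toSubmodule (V ⊔ Algebra.adjoin R {y}) * toSubmodule (Algebra.adjoin R S) ≤
      toSubmodule (Algebra.adjoin R S) * toSubmodule (V ⊔ Algebra.adjoin R {y}) := by
  set U := Algebra.adjoin R S
  set V' := V ⊔ Algebra.adjoin R {y}
  have hVV' : toSubmodule V ≤ toSubmodule V' := le_sup_left (a := V)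
  have hyV' : y ∈ V' := (le_sup_right : _ ≤ V') (Algebra.self_mem_adjoin_singleton R y)
  have hUU : toSubmodule U * toSubmodule U = toSubmodule U := isIdempotentElem_toSubmodule U
  have hVV : toSubmodule V' * toSubmodule V' = toSubmodule V' := isIdempotentElem_toSubmodule V'
  have hcomm : ∀ u ∈ U, y * u - u * y ∈ toSubmodule U * toSubmodule V := by
    intro u hu
    induction hu using Algebra.adjoin_induction with
    | mem x hx => exact hy x hx
    | algebraMap r => rw [Algebra.commutes, sub_self]; exact zero_mem _
    | add u v _ _ h1 h2 =>
      have : y * (u + v) - (u + v) * y = (y * u - u * y) + (y * v - v * y) := by noncomm_ring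
      rw [this]
      exact add_mem h1 h2
    | mul u v hu hv h1 h2 =>
      have : y * (u * v) - (u * v) * y = (y * u - u * y) * v + u * (y * v - v * y) := by
        noncomm_ring
      rw [this]
      refine add_mem ?_ ?_
      · have h3 : (y * u - u * y) * v ∈ toSubmodule U * toSubmodule V * toSubmodule U :=
          Submodule.mul_mem_mul h1 hv
        have h4 : toSubmodule U * toSubmodule V * toSubmodule U ≤
            toSubmodule U * toSubmodule V := by
          rw [mul_assoc]
          refine (mul_le_mul_right hV _).trans ?_
          rw [← mul_assoc, hUU]
        exact h4 h3
      · have h3 : u * (y * v - v * y) ∈ toSubmodule U * (toSubmodule U * toSubmodule V) :=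
          Submodule.mul_mem_mul hu h2
        rwa [← mul_assoc, hUU] at h3
  have hstab : ∀ v ∈ Algebra.adjoin R ((V : Set D) ∪ {y}), ∀ w ∈ toSubmodule U * toSubmodule V',
      v * w ∈ toSubmodule U * toSubmodule V' := by
    intro v hv
    induction hv using Algebra.adjoin_induction with
    | mem x hx =>
      rcases hx with hx | rfl
      · intro w hw
        have h3 : x * w ∈ toSubmodule V * (toSubmodule U * toSubmodule V') :=
          Submodule.mul_mem_mul hx hw
        rw [← mul_assoc] at h3
        have h4 := (mul_le_mul_left hV (toSubmodule V')).trans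
          (le_of_eq (mul_assoc _ _ _)) h3
        refine mul_le_mul_right (?_ : _ ≤ toSubmodule V') _ h4
        exact (mul_le_mul_left hVV' _).trans_eq hVV
      · intro w hw
        induction hw using Submodule.mul_induction_on' with
        | mem_mul_mem u hu v hv =>
          have : x * (u * v) = (x * u - u * x) * v + u * (x * v) := by noncomm_ring
          rw [this]
          refine add_mem ?_ (Submodule.mul_mem_mul hu (V'.mul_mem hyV' hv))
          have h3 : (x * u - u * x) * v ∈ toSubmodule U * toSubmodule V * toSubmodule V' :=
            Submodule.mul_mem_mul (hcomm u hu) hv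
          rw [mul_assoc] at h3
          refine mul_le_mul_right (?_ : _ ≤ toSubmodule V') _ h3
          exact (mul_le_mul_left hVV' _).trans_eq hVV
        | add u _ v _ h1 h2 => rw [mul_add]; exact add_mem h1 h2
    | algebraMap r => intro w hw; rw [← Algebra.smul_def]; exact Submodule.smul_mem _ r hw
    | add u v _ _ h1 h2 =>
      intro w hw
      rw [add_mul]
      exact add_mem (h1 w hw) (h2 w hw)
    | mul u v _ _ h1 h2 => intro w hw; rw [mul_assoc]; exact h1 _ (h2 w hw)
  rw [Submodule.mul_le]
  intro v hv u hu
  refine hstab v (by rw [Algebra.adjoin_union, Algebra.adjoin_eq]; exact hv) u ?_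
  rw [← mul_one u]
  exact Submodule.mul_mem_mul hu V'.one_mem

end Span

section Sys
variable {R : Type*} [CommRing R] {D : Type*} [Ring D] [Algebra R D]

/-- The subalgebra generated by the first `m` members of a family. -/
def lowAdj (R : Type*) [CommRing R] {D : Type*} [Ring D] [Algebra R D] (x : ℕ → D) (m : ℕ) :
    Subalgebra R D := Algebra.adjoin R (x '' Set.Iio m)

theorem lowAdj_zero (x : ℕ → D) : lowAdj R x 0 = ⊥ := by
  simp [lowAdj]

theorem lowAdj_succ (x : ℕ → D) (m : ℕ) :
    lowAdj R x (m + 1) = lowAdj R x m ⊔ Algebra.adjoin R {x m} := by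
  rw [lowAdj, lowAdj, ← Algebra.adjoin_union, ← Set.image_singleton, ← Set.image_union]
  congr 2
  ext i
  simp only [Set.mem_Iio, Set.union_singleton, Set.mem_insert_iff]
  omega

theorem lowAdj_mono (x : ℕ → D) {m m' : ℕ} (h : m ≤ m') : lowAdj R x m ≤ lowAdj R x m' :=
  Algebra.adjoin_mono (Set.image_mono (Set.Iio_subset_Iio h))

theorem mem_lowAdj (x : ℕ → D) {i m : ℕ} (h : i < m) : x i ∈ lowAdj R x m :=
  Algebra.subset_adjoin ⟨i, h, rfl⟩

open Subalgebra

theorem sup_eq_mul {U V : Subalgebra R D}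
    (h : toSubmodule V * toSubmodule U ≤ toSubmodule U * toSubmodule V) :
    toSubmodule (U ⊔ V) = toSubmodule U * toSubmodule V := by
  refine le_antisymm ?_ (mul_toSubmodule_le U V)
  let W : Subalgebra R D := (toSubmodule U * toSubmodule V).toSubalgebra
    (by
      rw [← one_mul (1 : D)]
      exact Submodule.mul_mem_mul ((mem_toSubmodule _).2 U.one_mem)
        ((mem_toSubmodule _).2 V.one_mem)) (by
      intro a b ha hb
      have h1 := Submodule.mul_mem_mul ha hb
      rw [mul_assoc, ← mul_assoc (toSubmodule V)] at h1
      have h2 := mul_le_mul_right (mul_le_mul_left h (toSubmodule V)) (toSubmodule U) h1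
      rwa [mul_assoc, isIdempotentElem_toSubmodule V, ← mul_assoc,
        isIdempotentElem_toSubmodule U] at h2)
  have hW : U ⊔ V ≤ W := sup_le
    (fun u hu => mul_one u ▸ Submodule.mul_mem_mul ((mem_toSubmodule _).2 hu)
      ((mem_toSubmodule _).2 V.one_mem))
    (fun v hv => one_mul v ▸ Submodule.mul_mem_mul ((mem_toSubmodule _).2 U.one_mem)
      ((mem_toSubmodule _).2 hv))
  exact hW

theorem intEval_mem_mul {x y : ℕ → D} (hx : CommFam x) (hy : CommFam y) {U V : Subalgebra R D}
    {q : MvPolynomial (ℕ ⊕ₗ ℕ) ℤ} (hU : ∀ i, renL i ∈ q.vars → x i ∈ U)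
    (hV : ∀ j, renR j ∈ q.vars → y j ∈ V) :
    intEval x y q ∈ toSubmodule U * toSubmodule V := by
  rw [q.as_sum, map_sum]
  refine Submodule.sum_mem _ fun e he => ?_
  rw [intEval_eq_normEval R, map_monomial, normEval_monomial' hx hy]
  have hv : ∀ v ∈ e.support, v ∈ q.vars := fun v hv => (mem_vars_iff_mem_support v).2 ⟨e, he, hv⟩
  refine Submodule.smul_mem _ _ (Submodule.mul_mem_mul ?_ ?_)
  · refine Finset.prod_induction _ (fun f => commEval R hx f ∈ U)
      (fun f g hf hg => by rw [map_mul]; exact U.mul_mem hf hg) (by rw [map_one]; exact U.one_mem)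
      fun v hv' => ?_
    rw [map_pow]
    refine pow_mem ?_ _
    rcases v with i | j
    · exact (commEval_X (R := R) hx i).symm ▸ hU i (hv _ hv')
    · exact (map_one (commEval R hx)).symm ▸ U.one_mem
  · refine Finset.prod_induction _ (fun f => commEval R hy f ∈ V)
      (fun f g hf hg => by rw [map_mul]; exact V.mul_mem hf hg) (by rw [map_one]; exact V.one_mem)
      fun v hv' => ?_
    rw [map_pow]
    refine pow_mem ?_ _
    rcases v with i | j
    · exact (map_one (commEval R hy)).symm ▸ V.one_mem
    · exact (commEval_X (R := R) hy j).symm ▸ hV j (hv _ hv')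

/-- Families of elements satisfying the relations of `B_{m,n}`. -/
structure Sys (γ : ℕ → ℕ → MvPolynomial (ℕ ⊕ₗ ℕ) ℤ) (m n : ℕ) {D : Type*} [Ring D]
    (x y : ℕ → D) : Prop where
  cx : CommFam x
  cy : CommFam y
  rel : ∀ i < m, ∀ j < n, y j * x i = x i * y j + intEval x y (γ i j)

variable {p : ℕ} {γ : ℕ → ℕ → MvPolynomial (ℕ ⊕ₗ ℕ) ℤ} {m n : ℕ} {x y : ℕ → D}

omit [Algebra R D] in
theorem Sys.mono (h : Sys γ m n x y) {m' n' : ℕ} (hm : m' ≤ m) (hn : n' ≤ n) :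
    Sys γ m' n' x y :=
  ⟨h.cx, h.cy, fun i hi j hj => h.rel i (hi.trans_le hm) j (hj.trans_le hn)⟩

theorem Sys.map {D B F : Type*} [Ring D] [Ring B] [FunLike F D B] [RingHomClass F D B]
    {x y : ℕ → D} (h : Sys γ m n x y) (f : F) :
    Sys γ m n (fun i => f (x i)) (fun j => f (y j)) :=
  ⟨h.cx.map f, h.cy.map f, fun i hi j hj => by
    rw [← map_mul, h.rel i hi j hj, map_add, map_mul, map_intEval]⟩

theorem Sys.of_injective {D B F : Type*} [Ring D] [Ring B] [FunLike F D B] [RingHomClass F D B]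
    {x y : ℕ → D} (f : F) (hf : Function.Injective f)
    (h : Sys γ m n (fun i => f (x i)) (fun j => f (y j))) : Sys γ m n x y :=
  ⟨fun i j => (hf (by simpa only [map_mul] using (h.cx i j).eq)),
    fun i j => (hf (by simpa only [map_mul] using (h.cy i j).eq)), fun i hi j hj => hf (by
      rw [map_mul, h.rel i hi j hj, map_add, map_mul, map_intEval])⟩

theorem Sys.op {D : Type*} [Ring D] {x y : ℕ → D} (h : Sys γ m n x y) :
    Sys (swapGamma γ) n m (fun j => MulOpposite.op (y j)) (fun i => MulOpposite.op (x i)) :=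
  ⟨h.cy.op, h.cx.op, fun j hj i hi => by
    rw [swapGamma, intEval_op_swap h.cx h.cy, ← MulOpposite.op_mul, h.rel i hi j hj]
    rfl⟩

theorem IsGamma.intEval_congr (hγ : IsGamma p γ) {D : Type*} [Ring D] {x y x' y' : ℕ → D} {i j : ℕ}
    (hx : ∀ r < i, x r = x' r) (hy : ∀ s < j, y s = y' s) :
    intEval x y (γ i j) = intEval x' y' (γ i j) := by
  refine _root_.intEval_congr (fun r hr => ?_) fun s hs => ?_
  · obtain ⟨r', h, e⟩ | ⟨s, h, e⟩ := hγ.vars i j _ hr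
    · obtain rfl : r = r' := by simpa [renL] using e
      exact hx r h
    · simp [renR] at e
  · obtain ⟨r', h, e⟩ | ⟨s', h, e⟩ := hγ.vars i j _ hs
    · simp [renL] at e
    · obtain rfl : s = s' := by simpa [renR] using e
      exact hy s h

theorem Sys.congr (hγ : IsGamma p γ) {D : Type*} [Ring D] {x y x' y' : ℕ → D}
    (h : Sys γ m n x y) (cx : CommFam x') (cy : CommFam y') (hx : ∀ i < m, x i = x' i)
    (hy : ∀ j < n, y j = y' j) : Sys γ m n x' y' :=
  ⟨cx, cy, fun i hi j hj => by
    rw [← hx i hi, ← hy j hj, h.rel i hi j hj]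
    congr 1
    exact hγ.intEval_congr (fun r hr => hx r (hr.trans hi)) fun s hs => hy s (hs.trans hj)⟩

theorem IsGamma.intEval_mem (hγ : IsGamma p γ) (cx : CommFam x) (cy : CommFam y) (i j : ℕ) :
    intEval x y (γ i j) ∈ toSubmodule (lowAdj R x i) * toSubmodule (lowAdj R y j) := by
  refine intEval_mem_mul cx cy (fun r hr => ?_) fun s hs => ?_
  · obtain ⟨r', h, e⟩ | ⟨s, h, e⟩ := hγ.vars i j _ hr
    · obtain rfl : r = r' := by simpa [renL] using e
      exact mem_lowAdj x h
    · simp [renR] at e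
  · obtain ⟨r', h, e⟩ | ⟨s', h, e⟩ := hγ.vars i j _ hs
    · simp [renL] at e
    · obtain rfl : s = s' := by simpa [renR] using e
      exact mem_lowAdj y h

theorem Sys.mul_le (hγ : IsGamma p γ) (h : Sys γ m n x y) :
    toSubmodule (lowAdj R y n) * toSubmodule (lowAdj R x m) ≤
      toSubmodule (lowAdj R x m) * toSubmodule (lowAdj R y n) := by
  induction n with
  | zero => simp [lowAdj_zero, Algebra.toSubmodule_bot]
  | succ n ih =>
    rw [lowAdj_succ]
    refine toSubmodule_sup_adjoin_mul_le (ih (h.mono le_rfl n.le_succ)) ?_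
    rintro _ ⟨i, hi, rfl⟩
    rw [h.rel i hi n n.lt_succ_self, add_sub_cancel_left]
    exact mul_le_mul_left (toSubmodule.monotone (lowAdj_mono x (le_of_lt hi))) _
      (hγ.intEval_mem h.cx h.cy i n)

theorem Sys.mul_le' (hγ : IsGamma p γ) (h : Sys γ m n x y) :
    toSubmodule (lowAdj R x m) * toSubmodule (lowAdj R y n) ≤
      toSubmodule (lowAdj R y n) * toSubmodule (lowAdj R x m) := by
  induction m with
  | zero => simp [lowAdj_zero, Algebra.toSubmodule_bot]
  | succ m ih =>
    have ih' := ih (h.mono m.le_succ le_rfl)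
    rw [lowAdj_succ]
    refine toSubmodule_sup_adjoin_mul_le ih' ?_
    rintro _ ⟨j, hj, rfl⟩
    rw [h.rel m m.lt_succ_self j hj, sub_add_cancel_left]
    exact neg_mem (ih' (mul_le_mul_right (toSubmodule.monotone (lowAdj_mono y (le_of_lt hj))) _
      (hγ.intEval_mem h.cx h.cy m j)))

theorem Sys.mul_comm (hγ : IsGamma p γ) (h : Sys γ m n x y) :
    toSubmodule (lowAdj R x m) * toSubmodule (lowAdj R y n) =
      toSubmodule (lowAdj R y n) * toSubmodule (lowAdj R x m) :=
  le_antisymm (h.mul_le' hγ) (h.mul_le hγ)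

theorem Sys.sup_eq (hγ : IsGamma p γ) (h : Sys γ m n x y) :
    toSubmodule (lowAdj R x m ⊔ lowAdj R y n) =
      toSubmodule (lowAdj R x m) * toSubmodule (lowAdj R y n) :=
  sup_eq_mul (h.mul_le hγ)

theorem exists_commEval_of_mem_lowAdj (cx : CommFam x) {u : D} (hu : u ∈ lowAdj R x m) :
    ∃ f, commEval R cx f = u := by
  have : lowAdj R x m ≤ (commEval R cx).range := by
    refine Algebra.adjoin_le ?_
    rintro _ ⟨i, _, rfl⟩
    exact ⟨X i, commEval_X cx i⟩
  exact this hu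

theorem Sys.exists_intEval (hγ : IsGamma p γ) {D : Type*} [Ring D] {x y : ℕ → D}
    (h : Sys γ m n x y) {u : D}
    (hu : u ∈ Subring.closure (x '' Set.Iio m ∪ y '' Set.Iio n)) : ∃ t, u = intEval x y t := by
  have hu' : u ∈ lowAdj ℤ x m ⊔ lowAdj ℤ y n := by
    rw [lowAdj, lowAdj, ← Algebra.adjoin_union]
    refine (Subring.closure_le (t := (Algebra.adjoin ℤ _).toSubring)).2 ?_ hu
    exact Algebra.subset_adjoin
  rw [← mem_toSubmodule, h.sup_eq hγ] at hu'
  clear hu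
  induction hu' using Submodule.mul_induction_on' with
  | mem_mul_mem a ha b hb =>
    obtain ⟨f, rfl⟩ := exists_commEval_of_mem_lowAdj h.cx ha
    obtain ⟨g, rfl⟩ := exists_commEval_of_mem_lowAdj h.cy hb
    exact ⟨_, (normEval_mul h.cx h.cy f g).symm⟩
  | add a _ b _ ha hb =>
    obtain ⟨s, rfl⟩ := ha
    obtain ⟨t, rfl⟩ := hb
    exact ⟨s + t, (map_add _ _ _).symm⟩

theorem intEval_mem_subring {D : Type*} [Ring D] {x y : ℕ → D} {T : Subring D}
    (hx : ∀ i, x i ∈ T) (hy : ∀ j, y j ∈ T) (q : MvPolynomial (ℕ ⊕ₗ ℕ) ℤ) :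
    intEval x y q ∈ T := by
  have h := map_intEval T.subtype (fun i => (⟨x i, hx i⟩ : T)) (fun j => (⟨y j, hy j⟩ : T)) q
  exact h ▸ (intEval (fun i => (⟨x i, hx i⟩ : T)) (fun j => (⟨y j, hy j⟩ : T)) q).2

end Sys

section Model
variable {p : ℕ} {γ : ℕ → ℕ → MvPolynomial (ℕ ⊕ₗ ℕ) ℤ}

/-- A ring of characteristic `p` which is freely spanned over `ℤ/p` by the normal ordered
monomials in two families satisfying the relations given by `γ`. -/
structure IsModel (p : ℕ) (γ : ℕ → ℕ → MvPolynomial (ℕ ⊕ₗ ℕ) ℤ) {Q : Type*} [Ring Q]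
    (x y : ℕ → Q) : Prop where
  char : (p : Q) = 0
  sys : ∀ m n, Sys γ m n x y
  surj : ∀ s, ∃ t, intEval x y t = s
  ker : ∀ t, intEval x y t = 0 → ∃ s, t = p • s
  frob : ∀ i j, y (j + 1) * x i ^ p = x i ^ p * y (j + 1) +
    intEval (fun i => x i ^ p) (fun j => y (j + 1)) (γ i j)
  frob_zero : ∀ i, Commute (y 0) (x i ^ p)
  one : y 0 * x 0 = x 0 * y 0 + 1

theorem Sys.exists_intEval_of_forall (hγ : IsGamma p γ) {B : Type*} [Ring B] {x y : ℕ → B}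
    (h : ∀ m n, Sys γ m n x y) {u : B} (hu : u ∈ Subring.closure (Set.range x ∪ Set.range y)) :
    ∃ t, u = intEval x y t := by
  have key : ∃ N, u ∈ Subring.closure (x '' Set.Iio N ∪ y '' Set.Iio N) := by
    have mono : ∀ {M N : ℕ}, M ≤ N → Subring.closure (x '' Set.Iio M ∪ y '' Set.Iio M) ≤
        Subring.closure (x '' Set.Iio N ∪ y '' Set.Iio N) := fun h =>
      Subring.closure_mono (Set.union_subset_union (Set.image_mono (Set.Iio_subset_Iio h))
        (Set.image_mono (Set.Iio_subset_Iio h)))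
    induction hu using Subring.closure_induction with
    | mem u hu =>
      rcases hu with ⟨i, rfl⟩ | ⟨i, rfl⟩
      · exact ⟨i + 1, Subring.subset_closure (Or.inl ⟨i, i.lt_succ_self, rfl⟩)⟩
      · exact ⟨i + 1, Subring.subset_closure (Or.inr ⟨i, i.lt_succ_self, rfl⟩)⟩
    | zero => exact ⟨0, zero_mem _⟩
    | one => exact ⟨0, one_mem _⟩
    | add u v _ _ hu hv =>
      obtain ⟨M, hM⟩ := hu
      obtain ⟨N, hN⟩ := hv
      exact ⟨max M N, add_mem (mono (le_max_left _ _) hM) (mono (le_max_right _ _) hN)⟩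
    | neg u _ hu => obtain ⟨M, hM⟩ := hu; exact ⟨M, neg_mem hM⟩
    | mul u v _ _ hu hv =>
      obtain ⟨M, hM⟩ := hu
      obtain ⟨N, hN⟩ := hv
      exact ⟨max M N, mul_mem (mono (le_max_left _ _) hM) (mono (le_max_right _ _) hN)⟩
  obtain ⟨N, hN⟩ := key
  exact (h N N).exists_intEval hγ hN

variable [Fact p.Prime]

theorem exists_isModel_of (hγ : IsGamma p γ) {B : Type*} [Ring B] {x y : ℕ → B}
    (h : ∀ m n, Sys γ m n x y) (hinj : ∀ t, intEval x y t = 0 → t = 0)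
    (hfrob : ∀ (cx : CommFam x) (i j : ℕ), y (j + 1) * frobFam p cx i =
      frobFam p cx i * y (j + 1) + intEval (frobFam p cx) (fun j => y (j + 1)) (γ i j))
    (hfrob0 : ∀ (cx : CommFam x) (i : ℕ), Commute (y 0) (frobFam p cx i))
    (hone : y 0 * x 0 = x 0 * y 0 + 1) :
    ∃ (I : Ideal (Subring.closure (Set.range x ∪ Set.range y))) (_ : I.IsTwoSided)
      (x' y' : ℕ → _ ⧸ I), IsModel p γ x' y' := by
  let S := Subring.closure (Set.range x ∪ Set.range y)
  let I : Ideal S := Ideal.span {(p : S)}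
  have hI : I.IsTwoSided := ⟨fun {a} b ha => by
    obtain ⟨c, rfl⟩ := Ideal.mem_span_singleton'.1 ha
    exact Ideal.mem_span_singleton'.2 ⟨c * b, by
      rw [mul_assoc, mul_assoc, (Nat.cast_commute p b).eq]⟩⟩
  let x₁ : ℕ → S := fun i => ⟨x i, Subring.subset_closure (Or.inl ⟨i, rfl⟩)⟩
  let y₁ : ℕ → S := fun i => ⟨y i, Subring.subset_closure (Or.inr ⟨i, rfl⟩)⟩
  have hS : Function.Injective S.subtype := Subtype.val_injective
  have h₁ : ∀ m n, Sys γ m n x₁ y₁ := fun m n => Sys.of_injective S.subtype hS (h m n)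
  have hev : ∀ t, S.subtype (intEval x₁ y₁ t) = intEval x y t := fun t => map_intEval _ _ _ _
  have hsurj : ∀ u : S, ∃ t, intEval x₁ y₁ t = u := fun u => by
    obtain ⟨t, ht⟩ := Sys.exists_intEval_of_forall hγ h u.2
    exact ⟨t, hS ((hev t).trans ht.symm)⟩
  let q := Ideal.Quotient.mk I
  have hchar : (p : S ⧸ I) = 0 := by
    rw [← map_natCast q, Ideal.Quotient.eq_zero_iff_mem]
    exact Ideal.mem_span_singleton_self _
  have cx := (h 0 0).cx
  have cx₁ := (h₁ 0 0).cx
  have hpow : ∀ i, q (frobFam p cx₁ i) = q (x₁ i) ^ p := fun i => by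
    rw [map_frobFam, frobFam_eq_pow hchar]
  refine ⟨I, hI, fun i => q (x₁ i), fun j => q (y₁ j), hchar, fun m n => (h₁ m n).map q,
    fun s => ?_, fun t ht => ?_, fun i j => ?_, fun i => ?_, ?_⟩
  · obtain ⟨u, rfl⟩ := Ideal.Quotient.mk_surjective s
    obtain ⟨t, rfl⟩ := hsurj u
    exact ⟨t, (map_intEval q x₁ y₁ t).symm⟩
  · rw [← map_intEval q, Ideal.Quotient.eq_zero_iff_mem] at ht
    obtain ⟨c, hc⟩ := Ideal.mem_span_singleton'.1 ht
    obtain ⟨s, rfl⟩ := hsurj c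
    refine ⟨s, sub_eq_zero.1 (hinj _ ?_)⟩
    rw [← hev, map_sub, map_nsmul, ← hc, nsmul_eq_mul, (Nat.cast_commute p _).eq, sub_self,
      map_zero]
  · have e : y₁ (j + 1) * frobFam p cx₁ i = frobFam p cx₁ i * y₁ (j + 1) +
        intEval (frobFam p cx₁) (fun j => y₁ (j + 1)) (γ i j) := hS (by
      simp only [map_mul, map_add, map_intEval, map_frobFam]
      exact hfrob cx i j)
    simpa only [map_mul, map_add, map_intEval, hpow] using congrArg q e
  · have e : Commute (y₁ 0) (frobFam p cx₁ i) := hS (by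
      simp only [map_mul, map_frobFam]
      exact hfrob0 cx i)
    simpa only [hpow] using e.map q
  · have e : y₁ 0 * x₁ 0 = x₁ 0 * y₁ 0 + 1 := hS hone
    simpa only [map_mul, map_add, map_one] using congrArg q e

theorem exists_isModel (hγ : IsGamma p γ) :
    ∃ (Q : Type) (_ : Ring Q) (x y : ℕ → Q), IsModel p γ x y := by
  have hp : p.Prime := Fact.out
  obtain ⟨I, hI, x, y, h⟩ := exists_isModel_of hγ (x := bX p) (y := bY p)
    (fun m n => ⟨commFam_bX hp, commFam_bY hp, fun i _ j _ => hγ.rel i j⟩)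
    (fun t => intEval_bX_bY_injective hp) (fun _ i j => bY_succ_frobFam hγ i j)
    (fun _ i => bY_zero_frobFam i) bY_zero_bX_zero
  exact ⟨_, _, x, y, h⟩

end Model

section Transfer
variable {p : ℕ} {γ : ℕ → ℕ → MvPolynomial (ℕ ⊕ₗ ℕ) ℤ} {m n : ℕ}

theorem IsGamma.intEval_mem_subring (hγ : IsGamma p γ) {D : Type*} [Ring D] {x y : ℕ → D}
    {T : Subring D} {i j : ℕ} (hx : ∀ r < i, x r ∈ T) (hy : ∀ s < j, y s ∈ T) :
    intEval x y (γ i j) ∈ T := by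
  classical
  rw [hγ.intEval_congr (x' := fun r => if r < i then x r else 0)
    (y' := fun s => if s < j then y s else 0) (fun r hr => (if_pos hr).symm)
    fun s hs => (if_pos hs).symm]
  refine _root_.intEval_mem_subring (fun r => ?_) (fun s => ?_) _
  · split_ifs with h
    exacts [hx r h, T.zero_mem]
  · split_ifs with h
    exacts [hy s h, T.zero_mem]

theorem Sys.prod {D Q : Type*} [Ring D] [Ring Q] {x y : ℕ → D} {x' y' : ℕ → Q}
    (h : Sys γ m n x y) (h' : Sys γ m n x' y') :
    Sys γ m n (fun i => (x i, x' i)) (fun j => (y j, y' j)) := by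
  refine ⟨fun i j => (h.cx i j).prod (h'.cx i j), fun i j => (h.cy i j).prod (h'.cy i j),
    fun i hi j hj => Prod.ext ?_ ?_⟩
  · rw [Prod.fst_add, ← RingHom.coe_fst, map_intEval]
    exact h.rel i hi j hj
  · rw [Prod.snd_add, ← RingHom.coe_snd, map_intEval]
    exact h'.rel i hi j hj

theorem IsModel.transfer (hγ : IsGamma p γ) {Q : Type*} [Ring Q] {x' y' : ℕ → Q}
    (hQ : IsModel p γ x' y') {D : Type*} [Ring D] {x y : ℕ → D} (hD : (p : D) = 0)
    (h : Sys γ m n x y) {s t : D × Q}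
    (hs : s ∈ Subring.closure ((fun i => (x i, x' i)) '' Set.Iio m ∪
      (fun j => (y j, y' j)) '' Set.Iio n))
    (ht : t ∈ Subring.closure ((fun i => (x i, x' i)) '' Set.Iio m ∪
      (fun j => (y j, y' j)) '' Set.Iio n)) (hst : s.2 = t.2) : s.1 = t.1 := by
  obtain ⟨q, hq⟩ := (h.prod (hQ.sys m n)).exists_intEval hγ (sub_mem hs ht)
  obtain ⟨r, rfl⟩ := hQ.ker q (by
    have h2 := congrArg (RingHom.snd D Q) hq
    rw [map_intEval] at h2
    exact h2.symm.trans (sub_eq_zero.2 hst))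
  rw [map_nsmul] at hq
  have h1 := congrArg Prod.fst hq
  rw [Prod.smul_fst, nsmul_eq_mul, hD, zero_mul] at h1
  exact sub_eq_zero.1 h1

theorem swapGamma_swapGamma (γ : ℕ → ℕ → MvPolynomial (ℕ ⊕ₗ ℕ) ℤ) :
    swapGamma (swapGamma γ) = γ := by
  funext i j
  rw [swapGamma, swapGamma, rename_rename]
  have : (swapVar ∘ swapVar : ℕ ⊕ₗ ℕ → ℕ ⊕ₗ ℕ) = id := by
    funext v
    rcases v with i | i <;> rfl
  rw [this, rename_id_apply]

theorem Sys.of_op {D : Type*} [Ring D] {x y : ℕ → D}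
    (h : Sys (swapGamma γ) n m (fun j => MulOpposite.op (y j)) (fun i => MulOpposite.op (x i))) :
    Sys γ m n x y := by
  have cx : CommFam x := fun i j => MulOpposite.op_injective (h.cy i j).eq.symm
  have cy : CommFam y := fun i j => MulOpposite.op_injective (h.cx i j).eq.symm
  refine ⟨cx, cy, fun i hi j hj => MulOpposite.op_injective ?_⟩
  have := h.rel j hj i hi
  rw [swapGamma, intEval_op_swap cx cy] at this
  exact this

variable [Fact p.Prime] {D : Type*} [Ring D] {x y : ℕ → D}

theorem Sys.frob (hγ : IsGamma p γ) (hD : (p : D) = 0) (h : Sys γ m (n + 1) x y) :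
    Sys γ m n (fun i => x i ^ p) (fun j => y (j + 1)) := by
  obtain ⟨Q, _, x', y', hQ⟩ := exists_isModel hγ
  refine ⟨fun i j => (h.cx i j).pow_pow p p, fun i j => h.cy _ _, fun i hi j hj => ?_⟩
  set T := Subring.closure ((fun i => (x i, x' i)) '' Set.Iio m ∪
      (fun j => (y j, y' j)) '' Set.Iio (n + 1)) with hT
  have hx : ∀ i < m, (x i, x' i) ∈ T := fun i hi => Subring.subset_closure (Or.inl ⟨i, hi, rfl⟩)
  have hy : ∀ j < n + 1, (y j, y' j) ∈ T := fun j hj =>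
    Subring.subset_closure (Or.inr ⟨j, hj, rfl⟩)
  have hs := T.mul_mem (hy (j + 1) (by omega)) (T.pow_mem (hx i hi) p)
  have ht := T.add_mem (T.mul_mem (T.pow_mem (hx i hi) p) (hy (j + 1) (by omega)))
    (hγ.intEval_mem_subring (x := fun i => (x i, x' i) ^ p) (y := fun j => (y (j + 1), y' (j + 1)))
      (i := i) (j := j) (fun r hr => T.pow_mem (hx r (hr.trans hi)) p)
      fun s hs => hy (s + 1) (by omega))
  have := hQ.transfer hγ hD h hs ht (by
    rw [Prod.snd_add, ← RingHom.coe_snd, map_intEval]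
    exact hQ.frob i j)
  rw [Prod.fst_add, ← RingHom.coe_fst, map_intEval] at this
  exact this

theorem Sys.commute_zero (hγ : IsGamma p γ) (hD : (p : D) = 0) (h : Sys γ m (n + 1) x y) {i : ℕ}
    (hi : i < m) : Commute (y 0) (x i ^ p) := by
  obtain ⟨Q, _, x', y', hQ⟩ := exists_isModel hγ
  set T := Subring.closure ((fun i => (x i, x' i)) '' Set.Iio m ∪
      (fun j => (y j, y' j)) '' Set.Iio (n + 1)) with hT
  have hx : (x i, x' i) ∈ T := Subring.subset_closure (Or.inl ⟨i, hi, rfl⟩)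
  have hy : (y 0, y' 0) ∈ T := Subring.subset_closure (Or.inr ⟨0, n.succ_pos, rfl⟩)
  exact hQ.transfer hγ hD h (T.mul_mem hy (T.pow_mem hx p)) (T.mul_mem (T.pow_mem hx p) hy)
    (hQ.frob_zero i)

theorem Sys.one (hγ : IsGamma p γ) (hD : (p : D) = 0) (h : Sys γ (m + 1) (n + 1) x y) :
    y 0 * x 0 = x 0 * y 0 + 1 := by
  obtain ⟨Q, _, x', y', hQ⟩ := exists_isModel hγ
  set T := Subring.closure ((fun i => (x i, x' i)) '' Set.Iio (m + 1) ∪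
      (fun j => (y j, y' j)) '' Set.Iio (n + 1)) with hT
  have hx : (x 0, x' 0) ∈ T := Subring.subset_closure (Or.inl ⟨0, m.succ_pos, rfl⟩)
  have hy : (y 0, y' 0) ∈ T := Subring.subset_closure (Or.inr ⟨0, n.succ_pos, rfl⟩)
  exact hQ.transfer hγ hD h (T.mul_mem hy hx) (T.add_mem (T.mul_mem hx hy) T.one_mem) hQ.one

omit [Fact p.Prime] in
theorem op_natCast_eq_zero {D : Type*} [Ring D] (hD : (p : D) = 0) : (p : Dᵐᵒᵖ) = 0 :=
  MulOpposite.unop_injective hD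

theorem Sys.frob' (hγ : IsGamma p γ) (hD : (p : D) = 0) (h : Sys γ (m + 1) n x y) :
    Sys γ m n (fun i => x (i + 1)) (fun j => y j ^ p) :=
  Sys.of_op (h.op.frob (hγ.swap Fact.out) (op_natCast_eq_zero hD))

theorem Sys.iterate_frob (hγ : IsGamma p γ) (hD : (p : D) = 0) (k : ℕ)
    (h : Sys γ m (n + k) x y) : Sys γ m n (fun i => x i ^ p ^ k) (fun j => y (j + k)) := by
  induction k generalizing x y with
  | zero => simpa using h
  | succ k ih => simpa only [← pow_mul, ← pow_succ', add_assoc, add_comm 1] using ih (h.frob hγ hD)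

theorem Sys.iterate_frob' (hγ : IsGamma p γ) (hD : (p : D) = 0) (k : ℕ)
    (h : Sys γ (m + k) n x y) : Sys γ m n (fun i => x (i + k)) (fun j => y j ^ p ^ k) := by
  induction k generalizing x y with
  | zero => simpa using h
  | succ k ih => simpa only [← pow_mul, ← pow_succ', add_assoc, add_comm 1] using ih (h.frob' hγ hD)

theorem Sys.commute_pow_right (hγ : IsGamma p γ) (hD : (p : D) = 0) (h : Sys γ m n x y)
    {i j k : ℕ} (hi : i < m) (hj : j < n) (hk : j < k) : Commute (y j) (x i ^ p ^ k) := by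
  obtain ⟨k, rfl⟩ := Nat.exists_eq_add_of_lt hk
  obtain ⟨n, rfl⟩ := Nat.exists_eq_add_of_lt hj
  have h' : Sys γ m (n + 1) (fun i => x i ^ p ^ j) (fun s => y (s + j)) :=
    Sys.iterate_frob hγ hD j (by convert h using 1; omega)
  have := (h'.commute_zero hγ hD hi).pow_right (p ^ k)
  simp only [zero_add, ← pow_mul, ← pow_add, ← pow_succ] at this
  rwa [show j + 1 + k = j + k + 1 by omega] at this

theorem Sys.commute_pow_left (hγ : IsGamma p γ) (hD : (p : D) = 0) (h : Sys γ m n x y)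
    {i j k : ℕ} (hi : i < m) (hj : j < n) (hk : i < k) : Commute (y j ^ p ^ k) (x i) :=
  MulOpposite.op_injective
    (h.op.commute_pow_right (hγ.swap Fact.out) (op_natCast_eq_zero hD) hj hi hk)

theorem Sys.commute_pow_pow (hγ : IsGamma p γ) (hD : (p : D) = 0) (h : Sys γ m n x y)
    {i j i' j' : ℕ} (hi' : i' < m) (hj : j < n) (hk : i' < i ∨ j < j') :
    Commute (y j ^ p ^ i) (x i' ^ p ^ j') := by
  rcases hk with hk | hk
  · exact (h.commute_pow_left hγ hD hi' hj hk).pow_right _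
  · exact (h.commute_pow_right hγ hD hi' hj hk).pow_left _

theorem Sys.one_pow_pow (hγ : IsGamma p γ) (hD : (p : D) = 0) (h : Sys γ m n x y)
    {i j : ℕ} (hi : i < m) (hj : j < n) :
    y j ^ p ^ i * x i ^ p ^ j = x i ^ p ^ j * y j ^ p ^ i + 1 := by
  obtain ⟨n, rfl⟩ := Nat.exists_eq_add_of_lt hj
  obtain ⟨m, rfl⟩ := Nat.exists_eq_add_of_lt hi
  have h1 : Sys γ (m + 1 + i) (n + 1) (fun i => x i ^ p ^ j) (fun s => y (s + j)) :=
    Sys.iterate_frob hγ hD j (by convert h using 1 <;> omega)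
  simpa only [zero_add] using (h1.iterate_frob' hγ hD i).one hγ hD

end Transfer

section LowerBound

theorem mul_pow_succ_of_commutator {D : Type*} [Ring D] {P z : D} (h : P * z = z * P + 1) (e : ℕ) :
    P * z ^ (e + 1) = z ^ (e + 1) * P + (e + 1 : ℕ) • z ^ e := by
  induction e with
  | zero => simpa using h
  | succ e ih =>
    rw [pow_succ z (e + 1), ← mul_assoc, ih, add_mul, mul_assoc, h, smul_mul_assoc, ← pow_succ,
      mul_add, mul_one, ← mul_assoc, add_assoc, succ_nsmul' _ (e + 1)]

variable {p : ℕ} {K D : Type*} [Field K] [CharP K p] [Ring D] [Algebra K D]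

theorem eq_zero_of_sum_pow_mul_eq_zero (K : Type*) {D : Type*} [Field K] [CharP K p] [Ring D]
    [Algebra K D] {P z : D} (h : P * z = z * P + 1) :
    ∀ d ≤ p, ∀ β : ℕ → D, (∀ e, Commute P (β e)) → ∑ e ∈ Finset.range d, z ^ e * β e = 0 →
      ∀ e < d, β e = 0 := by
  intro d
  induction d with
  | zero => intro _ _ _ _ e he; omega
  | succ d ih =>
    intro hd β hβ hsum
    have h1 : ∑ e ∈ Finset.range d, z ^ e * ((e + 1 : ℕ) • β (e + 1)) = 0 := by
      have h2 : P * ∑ e ∈ Finset.range (d + 1), z ^ e * β e -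
          (∑ e ∈ Finset.range (d + 1), z ^ e * β e) * P = 0 := by rw [hsum]; simp
      rw [Finset.sum_range_succ', mul_add, add_mul, pow_zero, one_mul, (hβ 0).eq,
        add_sub_add_right_eq_sub, Finset.mul_sum, Finset.sum_mul, ← Finset.sum_sub_distrib] at h2
      rw [← h2]
      refine Finset.sum_congr rfl fun e _ => ?_
      rw [← mul_assoc, mul_pow_succ_of_commutator h, mul_assoc, ← (hβ (e + 1)).eq, add_mul,
        ← mul_assoc, add_sub_cancel_left, smul_mul_assoc, mul_smul_comm]
    have h3 := ih (by omega) (fun e => (e + 1 : ℕ) • β (e + 1))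
      (fun e => (hβ (e + 1)).smul_right _) h1
    have h4 : ∀ e < d, β (e + 1) = 0 := fun e he => by
      have h5 : ((e + 1 : ℕ) : K) • β (e + 1) = 0 := by
        rw [Nat.cast_smul_eq_nsmul]; exact h3 e he
      refine (smul_eq_zero.1 h5).resolve_left fun h0 => ?_
      have := Nat.le_of_dvd (by omega) ((CharP.cast_eq_zero_iff K p _).1 h0)
      omega
    have h0 : β 0 = 0 := by
      rw [Finset.sum_range_succ', Finset.sum_eq_zero fun e he => by
        rw [h4 e (Finset.mem_range.1 he), mul_zero]] at hsum
      simpa using hsum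
    rintro (_ | e) he
    exacts [h0, h4 e (by omega)]

theorem exists_submodule_finrank_eq_pow [Fact p.Prime] [Nontrivial D] (L : List (D × D))
    (hL : ∀ a ∈ L, a.1 * a.2 = a.2 * a.1 + 1) (hc : L.Pairwise fun a b => Commute a.1 b.2) :
    ∃ B : Submodule K D, B ≤ Subalgebra.toSubmodule (Algebra.adjoin K {z | ∃ a ∈ L, z = a.2}) ∧
      Module.finrank K B = p ^ L.length := by
  have hp : p.Prime := Fact.out
  induction L with
  | nil => exact ⟨Subalgebra.toSubmodule ⊥, by simp, by
      simp [Subalgebra.finrank_bot]⟩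
  | cons a L ih =>
    obtain ⟨B, hB, hr⟩ := ih (fun b hb => hL b (List.mem_cons_of_mem _ hb)) hc.tail
    have hcomm : ∀ b ∈ B, Commute a.1 b := fun b hb => by
      have : Algebra.adjoin K {z | ∃ a ∈ L, z = a.2} ≤ Subalgebra.centralizer K {a.1} := by
        refine Algebra.adjoin_le ?_
        rintro _ ⟨c, hcL, rfl⟩ _ rfl
        exact ((List.pairwise_cons.1 hc).1 c hcL).eq
      exact this (hB hb) _ rfl
    have : Module.Finite K B := Module.finite_of_finrank_pos (by rw [hr]; exact pow_pos hp.pos _)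
    let φ : (Fin p → B) →ₗ[K] D :=
      ∑ e : Fin p, LinearMap.mulLeft K (a.2 ^ (e : ℕ)) ∘ₗ B.subtype ∘ₗ LinearMap.proj e
    have hφ : ∀ β, φ β = ∑ e : Fin p, a.2 ^ (e : ℕ) * (β e : D) := fun β => by
      simp [φ]
    have hinj : Function.Injective φ := by
      rw [injective_iff_map_eq_zero]
      intro β hβ
      let β' : ℕ → D := fun e => if h : e < p then (β ⟨e, h⟩ : D) else 0
      have h0 := eq_zero_of_sum_pow_mul_eq_zero K (hL a List.mem_cons_self) p le_rfl β'
        (fun e => by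
          by_cases h : e < p
          · simp only [β', dif_pos h]; exact hcomm _ (β ⟨e, h⟩).2
          · simp only [β', dif_neg h]; exact Commute.zero_right _)
        (by rw [Finset.sum_range, ← hβ, hφ]
            simp [β'])
      funext e
      have := h0 e e.2
      simpa [β'] using this
    have hmono : Algebra.adjoin K {z | ∃ a ∈ L, z = a.2} ≤
        Algebra.adjoin K {z | ∃ b ∈ a :: L, z = b.2} :=
      Algebra.adjoin_mono fun z ⟨b, hb, hz⟩ => ⟨b, List.mem_cons_of_mem _ hb, hz⟩
    have hz : a.2 ∈ Algebra.adjoin K {z | ∃ b ∈ a :: L, z = b.2} :=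
      Algebra.subset_adjoin (Set.mem_ofPred.2 ⟨a, List.mem_cons_self, rfl⟩)
    refine ⟨LinearMap.range φ, ?_, ?_⟩
    · rintro _ ⟨β, rfl⟩
      rw [hφ]
      refine Submodule.sum_mem _ fun e _ => ?_
      exact Subalgebra.mul_mem (Algebra.adjoin K {z | ∃ b ∈ a :: L, z = b.2})
        (pow_mem hz _)
        (hmono (hB (β e).2))
    · rw [LinearMap.finrank_range_of_inj hinj, Module.finrank_pi_fintype]
      simp [hr, pow_succ']

/-- The pairs of indices below `m` and `n`, ordered such that `(i, j)` comes before `(i', j')`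
only if `i' < i` or `j < j'`. -/
def indexPairs (m n : ℕ) : List (ℕ × ℕ) :=
  (List.range m).reverse.flatMap fun i => (List.range n).map fun j => (i, j)

theorem mem_indexPairs {m n : ℕ} {a : ℕ × ℕ} : a ∈ indexPairs m n ↔ a.1 < m ∧ a.2 < n := by
  rcases a with ⟨i, j⟩
  simp [indexPairs]

theorem length_indexPairs (m n : ℕ) : (indexPairs m n).length = m * n := by
  simp [indexPairs, List.length_flatMap]

theorem pairwise_indexPairs (m n : ℕ) :
    (indexPairs m n).Pairwise fun a b => b.1 < a.1 ∨ a.2 < b.2 := by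
  rw [indexPairs, List.pairwise_flatMap]
  refine ⟨fun i _ => ?_, ?_⟩
  · rw [List.pairwise_map]
    exact List.pairwise_lt_range.imp Or.inr
  · rw [List.pairwise_reverse]
    refine List.pairwise_lt_range.imp fun {a b} h => ?_
    simp only [List.mem_map]
    rintro _ ⟨j, _, rfl⟩ _ ⟨j', _, rfl⟩
    exact Or.inl h

theorem Sys.pow_le_finrank [Fact p.Prime] {γ : ℕ → ℕ → MvPolynomial (ℕ ⊕ₗ ℕ) ℤ} {m n : ℕ}
    (hγ : IsGamma p γ) [Nontrivial D] [Module.Finite K D] {x y : ℕ → D} (h : Sys γ m n x y) :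
    p ^ (2 * (m * n)) ≤ Module.finrank K D := by
  have hD : (p : D) = 0 := by
    rw [← map_natCast (algebraMap K D), CharP.cast_eq_zero, map_zero]
  let f : ℕ × ℕ → D × D := fun a => (y a.2 ^ p ^ a.1, x a.1 ^ p ^ a.2)
  let g : ℕ × ℕ → D × D := fun a => (-x a.1 ^ p ^ a.2, y a.2 ^ p ^ a.1)
  obtain ⟨B, -, hB⟩ := exists_submodule_finrank_eq_pow (p := p) (K := K)
    ((indexPairs m n).map f ++ (indexPairs m n).reverse.map g) (by
      intro a ha
      rw [List.mem_append, List.mem_map, List.mem_map] at ha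
      rcases ha with ⟨b, hb, rfl⟩ | ⟨b, hb, rfl⟩
      · rw [mem_indexPairs] at hb
        exact h.one_pow_pow hγ hD hb.1 hb.2
      · rw [List.mem_reverse, mem_indexPairs] at hb
        simp only [g]
        rw [mul_neg, h.one_pow_pow hγ hD hb.1 hb.2, neg_mul]
        abel) (by
      rw [List.pairwise_append]
      refine ⟨?_, ?_, ?_⟩
      · rw [List.pairwise_map]
        refine List.Pairwise.imp_of_mem (fun {a b} ha hb hab => ?_) (pairwise_indexPairs m n)
        rw [mem_indexPairs] at ha hb
        exact h.commute_pow_pow hγ hD hb.1 ha.2 hab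
      · rw [List.pairwise_map, List.pairwise_reverse]
        refine List.Pairwise.imp_of_mem (fun {a b} ha hb hab => ?_) (pairwise_indexPairs m n)
        rw [mem_indexPairs] at ha hb
        exact (h.commute_pow_pow hγ hD hb.1 ha.2 hab).symm.neg_left
      · intro a ha b hb
        obtain ⟨a, _, rfl⟩ := List.mem_map.1 ha
        obtain ⟨b, _, rfl⟩ := List.mem_map.1 hb
        exact (h.cy _ _).pow_pow _ _)
  rw [List.length_append, List.length_map, List.length_map, List.length_reverse,
    length_indexPairs, ← two_mul] at hB
  rw [← hB]
  exact B.finrank_le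

end LowerBound

section SpannedBy
variable {R : Type*} [CommRing R] {D : Type*} [Ring D] [Algebra R D]

open Subalgebra

/-- `W` is contained in a left `V`-span of `r` elements. -/
def SpannedBy (r : ℕ) (V W : Subalgebra R D) : Prop :=
  ∃ g : Fin r → D, ∀ w ∈ W, ∃ v : Fin r → D, (∀ k, v k ∈ V) ∧ w = ∑ k, v k * g k

theorem SpannedBy.refl (V : Subalgebra R D) : SpannedBy 1 V V :=
  ⟨fun _ => 1, fun w hw => ⟨fun _ => w, fun _ => hw, by simp⟩⟩

theorem SpannedBy.trans {r s : ℕ} {V W U : Subalgebra R D} (h : SpannedBy r V W)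
    (h' : SpannedBy s W U) : SpannedBy (r * s) V U := by
  obtain ⟨g, hg⟩ := h
  obtain ⟨g', hg'⟩ := h'
  refine ⟨fun k => g (finProdFinEquiv.symm k).1 * g' (finProdFinEquiv.symm k).2, fun u hu => ?_⟩
  obtain ⟨w, hw, rfl⟩ := hg' u hu
  choose v hv hvw using fun l => hg (w l) (hw l)
  refine ⟨fun k => v (finProdFinEquiv.symm k).2 (finProdFinEquiv.symm k).1, fun k => hv _ _, ?_⟩
  rw [finProdFinEquiv.symm.sum_comp
    (fun kl : Fin r × Fin s => v kl.2 kl.1 * (g kl.1 * g' kl.2)), Fintype.sum_prod_type_right]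
  refine Finset.sum_congr rfl fun l _ => ?_
  rw [hvw l, Finset.sum_mul]
  simp only [mul_assoc]

theorem spannedBy_sup_adjoin_singleton {V : Subalgebra R D} {z : D} {q : ℕ} (hq : 0 < q)
    (hz : ∀ v ∈ V, Commute z v) (hzq : z ^ q ∈ V) :
    SpannedBy q V (V ⊔ Algebra.adjoin R {z}) := by
  have hle : toSubmodule (Algebra.adjoin R {z}) * toSubmodule V ≤
      toSubmodule V * toSubmodule (Algebra.adjoin R {z}) := by
    rw [Submodule.mul_le]
    intro t ht v hv
    have : Algebra.adjoin R {z} ≤ Subalgebra.centralizer R {v} :=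
      Algebra.adjoin_le (by rintro _ rfl _ rfl; exact (hz _ hv).eq.symm)
    have h : v * t = t * v := this ht v rfl
    exact h ▸ Submodule.mul_mem_mul hv ht
  refine ⟨fun k => z ^ (k : ℕ), fun w hw => ?_⟩
  rw [← mem_toSubmodule, sup_eq_mul hle] at hw
  have hadd : ∀ a b : D, (∃ v : Fin q → D, (∀ k, v k ∈ V) ∧ a = ∑ k, v k * z ^ (k : ℕ)) →
      (∃ v : Fin q → D, (∀ k, v k ∈ V) ∧ b = ∑ k, v k * z ^ (k : ℕ)) →
      ∃ v : Fin q → D, (∀ k, v k ∈ V) ∧ a + b = ∑ k, v k * z ^ (k : ℕ) := by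
    rintro _ _ ⟨v, hv, rfl⟩ ⟨w, hw, rfl⟩
    exact ⟨fun k => v k + w k, fun k => V.add_mem (hv k) (hw k), by
      simp only [add_mul, Finset.sum_add_distrib]⟩
  induction hw using Submodule.mul_induction_on' with
  | add a _ b _ ha hb => exact hadd a b ha hb
  | mem_mul_mem v hv t ht =>
    rw [mem_toSubmodule, Algebra.adjoin_singleton_eq_range_aeval] at ht
    obtain ⟨f, rfl⟩ := ht
    induction f using Polynomial.induction_on' with
    | add f g hf hg =>
      rw [map_add, mul_add]
      exact hadd _ _ hf hg
    | monomial N r =>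
      refine ⟨Pi.single ⟨N % q, Nat.mod_lt _ hq⟩ (r • (v * (z ^ q) ^ (N / q))), fun k => ?_, ?_⟩
      · by_cases h : k = ⟨N % q, Nat.mod_lt _ hq⟩
        · subst h
          rw [Pi.single_eq_same]
          exact V.smul_mem (V.mul_mem hv (V.pow_mem hzq _)) r
        · rw [Pi.single_eq_of_ne h]
          exact V.zero_mem
      · rw [Finset.sum_eq_single ⟨N % q, Nat.mod_lt _ hq⟩ (fun k _ hk => by
          rw [Pi.single_eq_of_ne hk, zero_mul]) (by simp), Pi.single_eq_same]
        have h : (Polynomial.aeval z : Polynomial R →ₐ[R] D) (Polynomial.monomial N r) =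
            r • z ^ N := by
          rw [Polynomial.aeval_monomial, Algebra.smul_def]
        refine (congrArg (v * ·) h).trans ?_
        beta_reduce
        rw [smul_mul_assoc, mul_assoc, ← pow_mul, ← pow_add, Nat.div_add_mod, mul_smul_comm]

theorem spannedBy_sup_lowAdj {V : Subalgebra R D} {x : ℕ → D} {m q : ℕ} (hq : 0 < q)
    (hx : ∀ i < m, ∀ v ∈ V, Commute (x i) v) (cx : CommFam x) (hxq : ∀ i < m, x i ^ q ∈ V) :
    SpannedBy (q ^ m) V (V ⊔ lowAdj R x m) := by
  induction m with
  | zero => rw [lowAdj_zero, sup_bot_eq, pow_zero]; exact .refl V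
  | succ m ih =>
    rw [lowAdj_succ, ← sup_assoc, pow_succ]
    refine (ih (fun i hi => hx i (by omega)) fun i hi => hxq i (by omega)).trans
      (spannedBy_sup_adjoin_singleton hq (fun v hv => ?_) (le_sup_left (a := V) (hxq m (by omega))))
    have : V ⊔ lowAdj R x m ≤ Subalgebra.centralizer R {x m} := by
      refine sup_le ?_ (Algebra.adjoin_le ?_)
      · rintro v hv _ rfl
        exact hx m (by omega) v hv
      · rintro _ ⟨i, _, rfl⟩ _ rfl
        exact cx m i
    exact this hv _ rfl

theorem SpannedBy.le_span {r : ℕ} {W : Subalgebra R D} (h : SpannedBy r ⊥ W) :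
    ∃ g : Fin r → D, toSubmodule W ≤ Submodule.span R (Set.range g) := by
  obtain ⟨g, hg⟩ := h
  refine ⟨g, fun w hw => ?_⟩
  obtain ⟨v, hv, rfl⟩ := hg w hw
  refine Submodule.sum_mem _ fun k _ => ?_
  obtain ⟨s, hs⟩ := Algebra.mem_bot.1 (hv k)
  rw [← hs, ← Algebra.smul_def]
  exact Submodule.smul_mem _ _ (Submodule.subset_span ⟨k, rfl⟩)

theorem Sys.finite_and_finrank_le {K D : Type*} [Field K] [Ring D] [Algebra K D]
    {p m n : ℕ} (hp : 0 < p) {γ : ℕ → ℕ → MvPolynomial (ℕ ⊕ₗ ℕ) ℤ} (hγ : IsGamma p γ) {x y : ℕ → D}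
    (h : Sys γ m n x y) (hx : ∀ i < m, x i ^ p ^ n ∈ (⊥ : Subalgebra K D))
    (hy : ∀ j < n, y j ^ p ^ m ∈ (⊥ : Subalgebra K D))
    (htop : lowAdj K x m ⊔ lowAdj K y n = ⊤) :
    Module.Finite K D ∧ Module.finrank K D ≤ p ^ (2 * (m * n)) := by
  have hbot : ∀ z : D, ∀ v ∈ (⊥ : Subalgebra K D), Commute z v := fun z v hv => by
    obtain ⟨s, rfl⟩ := Algebra.mem_bot.1 hv
    exact (Algebra.commutes s z).symm
  have h1 := spannedBy_sup_lowAdj (m := m) (pow_pos hp n) (fun i _ => hbot (x i)) h.cx hx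
  have h2 := spannedBy_sup_lowAdj (m := n) (pow_pos hp m) (fun i _ => hbot (y i)) h.cy hy
  rw [bot_sup_eq] at h1 h2
  obtain ⟨g, hg⟩ := h1.le_span
  obtain ⟨g', hg'⟩ := h2.le_span
  have htop' : Submodule.span K (Set.range fun a : Fin _ × Fin _ => g a.1 * g' a.2) = ⊤ := by
    rw [eq_top_iff, ← Algebra.top_toSubmodule, ← htop, h.sup_eq hγ]
    refine (mul_le_mul' hg hg').trans ?_
    rw [Submodule.span_mul_span]
    refine Submodule.span_mono ?_
    rintro _ ⟨_, ⟨k, rfl⟩, _, ⟨l, rfl⟩, rfl⟩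
    exact ⟨(k, l), rfl⟩
  refine ⟨⟨⟨(Set.finite_range _).toFinset, by simpa using htop'⟩⟩, ?_⟩
  have h3 := finrank_range_le_card (R := K) fun a : Fin ((p ^ n) ^ m) × Fin ((p ^ m) ^ n) =>
    g a.1 * g' a.2
  rw [Set.finrank, htop', finrank_top] at h3
  refine h3.trans (le_of_eq ?_)
  rw [Fintype.card_prod, Fintype.card_fin, Fintype.card_fin, ← pow_mul, ← pow_mul, ← pow_add]
  congr 1
  ring

end SpannedBy

section Symb
universe u

/-- The elements `x_i`, `y_j` present the `K`-algebra `A` as the symbol algebra with parameters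
`a_i` (`i < m`) and `b_j` (`j < n`). -/
structure IsSymb (p : ℕ) (γ : ℕ → ℕ → MvPolynomial (ℕ ⊕ₗ ℕ) ℤ) (m n : ℕ) {K : Type u} [Field K]
    (a b : ℕ → K) {A : Type u} [Ring A] [Algebra K A] (x y : ℕ → A) : Prop where
  sys : Sys γ m n x y
  pow_x : ∀ i < m, x i ^ p ^ n = algebraMap K A (a i)
  pow_y : ∀ j < n, y j ^ p ^ m = algebraMap K A (b j)
  top : lowAdj K x m ⊔ lowAdj K y n = ⊤
  lift : ∀ (D : Type u) [Ring D] [Algebra K D] (x' y' : ℕ → D), Sys γ m n x' y' →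
    (∀ i < m, x' i ^ p ^ n = algebraMap K D (a i)) →
    (∀ j < n, y' j ^ p ^ m = algebraMap K D (b j)) →
    ∃ f : A →ₐ[K] D, (∀ i < m, f (x i) = x' i) ∧ ∀ j < n, f (y j) = y' j

variable {p : ℕ} {γ : ℕ → ℕ → MvPolynomial (ℕ ⊕ₗ ℕ) ℤ} {m n : ℕ} {K : Type u} [Field K]
  {a b : ℕ → K} {A : Type u} [Ring A] [Algebra K A] {x y : ℕ → A}

theorem op_lowAdj (x : ℕ → A) (m : ℕ) :
    (lowAdj K x m).op = lowAdj K (fun i => MulOpposite.op (x i)) m := by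
  rw [lowAdj, lowAdj, Subalgebra.op_adjoin]
  congr 1
  ext z
  constructor
  · rintro ⟨i, hi, h⟩
    exact ⟨i, hi, MulOpposite.unop_injective h⟩
  · rintro ⟨i, hi, rfl⟩
    exact ⟨i, hi, rfl⟩

theorem IsSymb.op (h : IsSymb p γ m n a b x y) : IsSymb p (swapGamma γ) n m b a
    (fun j => MulOpposite.op (y j)) (fun i => MulOpposite.op (x i)) where
  sys := h.sys.op
  pow_x j hj := congrArg MulOpposite.op (h.pow_y j hj)
  pow_y i hi := congrArg MulOpposite.op (h.pow_x i hi)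
  top := by
    rw [← op_lowAdj, ← op_lowAdj, ← Subalgebra.op_sup, sup_comm, h.top, Subalgebra.op_top]
  lift D _ _ y' x' hD hy hx := by
    have hD' := hD.op
    rw [swapGamma_swapGamma] at hD'
    obtain ⟨f, hfx, hfy⟩ := h.lift Dᵐᵒᵖ _ _ hD' (fun i hi => congrArg MulOpposite.op (hx i hi))
      fun j hj => congrArg MulOpposite.op (hy j hj)
    exact ⟨AlgHom.opComm f, fun j hj => congrArg MulOpposite.unop (hfy j hj),
      fun i hi => congrArg MulOpposite.unop (hfx i hi)⟩

end Symb

section Asymb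
variable {K : Type*} [Field K] {p : ℕ} [Fact p.Prime]
  {c : ℕ+ → ℕ+ → MvPolynomial (ℕ+ ⊕ₗ ℕ+) ℤ} {m n : ℕ}
  {a : TruncatedWittVector p m K} {b : TruncatedWittVector p n K}

/-- Extension of a finite family by zero. -/
def extendZero {M : Type*} [Zero M] {m : ℕ} (x : Fin m → M) (i : ℕ) : M :=
  if h : i < m then x ⟨i, h⟩ else 0

theorem extendZero_of_lt {M : Type*} [Zero M] {m : ℕ} (x : Fin m → M) {i : ℕ} (h : i < m) :
    extendZero x i = x ⟨i, h⟩ := dif_pos h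

theorem map_extendZero {M N F : Type*} [Zero M] [Zero N] [FunLike F M N] [ZeroHomClass F M N]
    (f : F) {m : ℕ} (x : Fin m → M) (i : ℕ) :
    f (extendZero x i) = extendZero (fun k => f (x k)) i := by
  by_cases h : i < m
  · rw [extendZero_of_lt _ h, extendZero_of_lt _ h]
  · rw [extendZero, dif_neg h, extendZero, dif_neg h, map_zero]

theorem commFam_extendZero {M : Type*} [Ring M] {m : ℕ} {x : Fin m → M} (hx : CommFam x) :
    CommFam (extendZero x) := fun i j => by
  by_cases hi : i < m
  · by_cases hj : j < m
    · rw [extendZero_of_lt _ hi, extendZero_of_lt _ hj]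
      exact hx _ _
    · rw [extendZero, extendZero, dif_neg hj]
      exact Commute.zero_right _
  · rw [extendZero, dif_neg hi]
    exact Commute.zero_left _

omit [Fact p.Prime] in
theorem map_cEval_sxm_syn {B : Type*} [Ring B] [Algebra K B]
    (f : FreeAlgebra K (Fin m ⊕ Fin n) →ₐ[K] B)
    (hx : CommFam fun i : Fin m => f (FreeAlgebra.ι K (Sum.inl i)))
    (hy : CommFam fun j : Fin n => f (FreeAlgebra.ι K (Sum.inr j))) (i j : ℕ) :
    f (cEval (sxm K p m n) (syn K p m n) (c (ppow p i) (ppow p j))) =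
      intEval (extendZero fun i : Fin m => f (FreeAlgebra.ι K (Sum.inl i)))
        (extendZero fun j : Fin n => f (FreeAlgebra.ι K (Sum.inr j))) (gammaOf p c i j) := by
  rw [← cEval_ppow (commFam_extendZero hx) (commFam_extendZero hy), cEval_eq_intEval,
    cEval_eq_intEval, map_intEval]
  congr 2
  · funext d
    exact map_extendZero f (fun i : Fin m => FreeAlgebra.ι K (Sum.inl i)) _
  · funext d
    exact map_extendZero f (fun i : Fin n => FreeAlgebra.ι K (Sum.inr i)) _

/-- The canonical map from the free algebra to a symbol algebra. -/
def freeToAsymb (K : Type*) [Field K] (p : ℕ) [Fact p.Prime]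
    (c : ℕ+ → ℕ+ → MvPolynomial (ℕ+ ⊕ₗ ℕ+) ℤ) (m n : ℕ)
    (a : TruncatedWittVector p m K) (b : TruncatedWittVector p n K) :
    FreeAlgebra K (Fin m ⊕ Fin n) →ₐ[K] Asymb K p c m n a b :=
  (RingQuot.mkAlgHom K (ASRel K p c m n a b)).comp (RingQuot.mkAlgHom K (BmnRel K p c m n))

theorem freeToAsymb_surjective : Function.Surjective (freeToAsymb K p c m n a b) :=
  (RingQuot.mkAlgHom_surjective _ _).comp (RingQuot.mkAlgHom_surjective _ _)

theorem freeToAsymb_eq {s t : FreeAlgebra K (Fin m ⊕ Fin n)} (h : BmnRel K p c m n s t) :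
    freeToAsymb K p c m n a b s = freeToAsymb K p c m n a b t := by
  rw [freeToAsymb, AlgHom.comp_apply, AlgHom.comp_apply, RingQuot.mkAlgHom_rel _ h]

theorem commFam_aX : CommFam (aX K p c m n a b) := fun i i' => by
  have := freeToAsymb_eq (a := a) (b := b) (BmnRel.xx (R := K) (p := p) (c := c) i i')
  rwa [map_mul, map_mul] at this

theorem commFam_aY : CommFam (aY K p c m n a b) := fun i i' => by
  have := freeToAsymb_eq (a := a) (b := b) (BmnRel.yy (R := K) (p := p) (c := c) i i')
  rwa [map_mul, map_mul] at this

theorem aX_pow (i : Fin m) : aX K p c m n a b i ^ p ^ n = algebraMap K _ (a.coeff i) := by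
  have := RingQuot.mkAlgHom_rel K (ASRel.xa (K := K) (p := p) (c := c) (a := a) (b := b) i)
  rwa [map_pow, AlgHom.commutes] at this

theorem aY_pow (i : Fin n) : aY K p c m n a b i ^ p ^ m = algebraMap K _ (b.coeff i) := by
  have := RingQuot.mkAlgHom_rel K (ASRel.yb (K := K) (p := p) (c := c) (a := a) (b := b) i)
  rwa [map_pow, AlgHom.commutes] at this

theorem isSymb_asymb (hγ : IsGamma p (gammaOf p c)) :
    IsSymb p (gammaOf p c) m n (extendZero a.coeff) (extendZero b.coeff)
    (extendZero (aX K p c m n a b)) (extendZero (aY K p c m n a b)) where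
  sys := by
    have cx : CommFam (aX K p c m n a b) := commFam_aX
    have cy : CommFam (aY K p c m n a b) := commFam_aY
    refine ⟨commFam_extendZero (M := Asymb K p c m n a b) cx,
      commFam_extendZero (M := Asymb K p c m n a b) cy, fun i hi j hj => ?_⟩
    have := freeToAsymb_eq (a := a) (b := b) (BmnRel.yx (R := K) (p := p) (c := c) ⟨i, hi⟩ ⟨j, hj⟩)
    rw [map_mul, map_add, map_mul] at this
    rw [extendZero_of_lt _ hi, extendZero_of_lt _ hj]
    exact this.trans (congrArg _ (map_cEval_sxm_syn (B := Asymb K p c m n a b)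
      (freeToAsymb K p c m n a b) cx cy i j))
  pow_x i hi := by rw [extendZero_of_lt _ hi, extendZero_of_lt _ hi, aX_pow]
  pow_y i hi := by rw [extendZero_of_lt _ hi, extendZero_of_lt _ hi, aY_pow]
  top := by
    have h : (freeToAsymb K p c m n a b).range = ⊤ :=
      (AlgHom.range_eq_top _).2 freeToAsymb_surjective
    rw [eq_top_iff, ← h, ← Algebra.map_top, ← FreeAlgebra.adjoin_range_ι,
      AlgHom.map_adjoin]
    refine Algebra.adjoin_le ?_
    rintro _ ⟨_, ⟨i | j, rfl⟩, rfl⟩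
    · exact (le_sup_left : lowAdj K (extendZero (aX K p c m n a b)) m ≤ _)
        (Algebra.subset_adjoin ⟨i, i.2, extendZero_of_lt _ i.2⟩)
    · exact (le_sup_right : lowAdj K (extendZero (aY K p c m n a b)) n ≤ _)
        (Algebra.subset_adjoin ⟨j, j.2, extendZero_of_lt _ j.2⟩)
  lift D _ _ x' y' h hx hy := by
    let f₀ : FreeAlgebra K (Fin m ⊕ Fin n) →ₐ[K] D :=
      FreeAlgebra.lift K (Sum.elim (fun i => x' i) fun j => y' j)
    have f₀x (i : Fin m) : f₀ (FreeAlgebra.ι K (Sum.inl i)) = x' i := by simp [f₀]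
    have f₀y (j : Fin n) : f₀ (FreeAlgebra.ι K (Sum.inr j)) = y' j := by simp [f₀]
    have hcx : CommFam fun i : Fin m => x' i := fun i i' => h.cx _ _
    have hcy : CommFam fun j : Fin n => y' j := fun i i' => h.cy _ _
    have h₀ : ∀ ⦃s t⦄, BmnRel K p c m n s t → f₀ s = f₀ t := by
      intro s t hst
      cases hst with
      | xx i i' => rw [map_mul, map_mul, f₀x, f₀x]; exact h.cx _ _
      | yy i i' => rw [map_mul, map_mul, f₀y, f₀y]; exact h.cy _ _
      | yx i j =>
        rw [map_add, map_mul, map_mul, map_cEval_sxm_syn f₀ (by simpa only [f₀x] using hcx)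
          (by simpa only [f₀y] using hcy), f₀x, f₀y, h.rel i i.2 j j.2]
        congr 1
        refine hγ.intEval_congr (fun r hr => ?_) fun r hr => ?_
        · rw [extendZero_of_lt _ (hr.trans i.2), f₀x]
        · rw [extendZero_of_lt _ (hr.trans j.2), f₀y]
    let f₁ : Bmn K p c m n →ₐ[K] D := RingQuot.liftAlgHom K ⟨f₀, h₀⟩
    have f₁x (i : Fin m) : f₁ (gx K p c m n i) = x' i :=
      (RingQuot.liftAlgHom_mkAlgHom_apply K f₀ h₀ _).trans (f₀x i)
    have f₁y (j : Fin n) : f₁ (gy K p c m n j) = y' j :=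
      (RingQuot.liftAlgHom_mkAlgHom_apply K f₀ h₀ _).trans (f₀y j)
    have h₁ : ∀ ⦃s t⦄, ASRel K p c m n a b s t → f₁ s = f₁ t := by
      intro s t hst
      cases hst with
      | xa i => rw [map_pow, f₁x, AlgHom.commutes, hx i i.2, extendZero_of_lt _ i.2]
      | yb j => rw [map_pow, f₁y, AlgHom.commutes, hy j j.2, extendZero_of_lt _ j.2]
    refine ⟨RingQuot.liftAlgHom K ⟨f₁, h₁⟩, fun i hi => ?_, fun j hj => ?_⟩
    · rw [extendZero_of_lt _ hi]
      exact (RingQuot.liftAlgHom_mkAlgHom_apply K f₁ h₁ _).trans (f₁x ⟨i, hi⟩)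
    · rw [extendZero_of_lt _ hj]
      exact (RingQuot.liftAlgHom_mkAlgHom_apply K f₁ h₁ _).trans (f₁y ⟨j, hj⟩)

end Asymb

section intEvalMul
variable {A : Type*} [Ring A] {σ τ : Type*} [LinearOrder σ] [LinearOrder τ] {x : σ → A} {y : τ → A}

theorem intEval_renL_mul (hx : CommFam x) (hy : CommFam y) (f : MvPolynomial σ ℤ)
    (t : MvPolynomial (σ ⊕ₗ τ) ℤ) :
    intEval x y (rename renL f * t) = commEval ℤ hx f * intEval x y t := by
  induction t using induction_split with
  | hadd p q hp hq => rw [mul_add, map_add, hp, hq, map_add, mul_add]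
  | hmul g h =>
    rw [← mul_assoc, ← map_mul]
    exact (normEval_mul hx hy _ _).trans
      (by rw [map_mul, mul_assoc]; exact congrArg _ (normEval_mul hx hy _ _).symm)

theorem intEval_mul_renR (hx : CommFam x) (hy : CommFam y) (f : MvPolynomial τ ℤ)
    (t : MvPolynomial (σ ⊕ₗ τ) ℤ) :
    intEval x y (t * rename renR f) = intEval x y t * commEval ℤ hy f := by
  induction t using induction_split with
  | hadd p q hp hq => rw [add_mul, map_add, hp, hq, map_add, add_mul]
  | hmul g h =>
    rw [mul_assoc, ← map_mul]
    exact (normEval_mul hx hy _ _).trans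
      (by rw [map_mul, ← mul_assoc]; exact congrArg (· * _) (normEval_mul hx hy _ _).symm)

theorem intEval_one (hx : CommFam x) (hy : CommFam y) : intEval x y 1 = 1 := by
  have := normEval_mul (R := ℤ) hx hy 1 1
  rwa [map_one, map_one, map_one, map_one, one_mul, one_mul] at this

end intEvalMul

section Nontrivial
variable {p : ℕ} {γ : ℕ → ℕ → MvPolynomial (ℕ ⊕ₗ ℕ) ℤ}

theorem IsModel.exists_functional {Q : Type*} [Ring Q] {x y : ℕ → Q} (hQ : IsModel p γ x y)
    {L : Type*} [Field L] [CharP L p] (α β : ℕ → L) :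
    ∃ Λ : Q →+ L, Λ 1 = 1 ∧ (∀ i k w, Λ (x i ^ k * w) = α i ^ k * Λ w) ∧
      ∀ j k w, Λ (w * y j ^ k) = Λ w * β j ^ k := by
  have cx := (hQ.sys 0 0).cx
  have cy := (hQ.sys 0 0).cy
  have cα : CommFam α := fun _ _ => Commute.all _ _
  have cβ : CommFam β := fun _ _ => Commute.all _ _
  have hker : (intEval x y).ker ≤ (intEval α β).ker := fun t ht => by
    obtain ⟨s, rfl⟩ := hQ.ker t ht
    rw [AddMonoidHom.mem_ker, map_nsmul, nsmul_eq_mul, CharP.cast_eq_zero, zero_mul]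
  have hs : Function.Surjective (intEval x y) := hQ.surj
  let Λ : Q →+ L := (intEval x y).liftOfSurjective hs ⟨intEval α β, hker⟩
  have hΛ (t) : Λ (intEval x y t) = intEval α β t :=
    AddMonoidHom.liftOfRightInverse_comp_apply _ _ _ _ _
  refine ⟨Λ, ?_, fun i k w => ?_, fun j k w => ?_⟩
  · rw [← intEval_one cx cy, hΛ, intEval_one cα cβ]
  · obtain ⟨t, rfl⟩ := hs w
    have h := intEval_renL_mul cx cy (X i ^ k) t
    rw [map_pow (commEval ℤ cx), commEval_X] at h
    have hαβ := intEval_renL_mul cα cβ (X i ^ k) t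
    rw [map_pow (commEval ℤ cα), commEval_X] at hαβ
    rw [← h, hΛ, hΛ, hαβ]
  · obtain ⟨t, rfl⟩ := hs w
    have h := intEval_mul_renR cx cy (X j ^ k) t
    rw [map_pow (commEval ℤ cy), commEval_X] at h
    have hαβ := intEval_mul_renR cα cβ (X j ^ k) t
    rw [map_pow (commEval ℤ cβ), commEval_X] at hαβ
    rw [← h, hΛ, hΛ, hαβ]

/-- The additive functions on a ring which transform under certain right translations by scalars. -/
def transSubmodule (K : Type*) [Field K] (L : Type*) [Field L] [Algebra K L] {S : Type*} [Ring S]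
    (c : Set (S × K)) : Submodule K (S →+ L) where
  carrier := {h | ∀ z ∈ c, ∀ w, h (w * z.1) = z.2 • h w}
  add_mem' {f g} hf hg z hz w := by
    rw [AddMonoidHom.add_apply, AddMonoidHom.add_apply, hf z hz, hg z hz, smul_add]
  zero_mem' z _ w := (smul_zero _).symm
  smul_mem' r f hf z hz w := by
    rw [AddMonoidHom.smul_apply, AddMonoidHom.smul_apply, hf z hz, smul_comm]

/-- The action by right translations on `transSubmodule`. -/
def transAct (K : Type*) [Field K] (L : Type*) [Field L] [Algebra K L] {S : Type*} [Ring S]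
    (c : Set (S × K)) (hc : ∀ z ∈ c, ∀ s, Commute s z.1) :
    S →+* Module.End K (transSubmodule K L c) where
  toFun s :=
    { toFun f := ⟨f.1.comp (AddMonoidHom.mulRight s), fun z hz w => by
        change f.1 (w * z.1 * s) = z.2 • f.1 (w * s)
        rw [← f.2 z hz, mul_assoc, mul_assoc, (hc z hz s).eq]⟩
      map_add' _ _ := rfl
      map_smul' _ _ := rfl }
  map_one' := by
    ext f w
    exact congrArg f.1 (mul_one w)
  map_mul' s t := by
    ext f w
    exact congrArg f.1 (mul_assoc w s t).symm
  map_zero' := by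
    ext f w
    exact (congrArg f.1 (mul_zero w)).trans (map_zero f.1)
  map_add' s t := by
    ext f w
    exact (congrArg f.1 (mul_add w s t)).trans (map_add f.1 _ _)

theorem transAct_eq {K L : Type*} [Field K] [Field L] [Algebra K L] {S : Type*} [Ring S]
    {c : Set (S × K)} (hc : ∀ z ∈ c, ∀ s, Commute s z.1) {z : S × K} (hz : z ∈ c) :
    transAct K L c hc z.1 = algebraMap K _ z.2 := by
  ext f w
  exact f.2 z hz w

theorem exists_pow_eq_algebraMap {K L : Type*} [Field K] [Field L] [Algebra K L] [IsAlgClosed L]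
    {q : ℕ} (hq : 0 < q) (a : ℕ → K) : ∃ α : ℕ → L, ∀ i, α i ^ q = algebraMap K L (a i) :=
  ⟨_, fun i => (IsAlgClosed.exists_pow_nat_eq (algebraMap K L (a i)) hq).choose_spec⟩

universe u
variable [Fact p.Prime] {K : Type u} [Field K] [CharP K p]

set_option maxSynthPendingDepth 3 in
theorem exists_nontrivial_sys (hγ : IsGamma p γ) (m n : ℕ) (a b : ℕ → K) :
    ∃ (D : Type u) (_ : Ring D) (_ : Algebra K D) (x y : ℕ → D), Nontrivial D ∧ Sys γ m n x y ∧
      (∀ i < m, x i ^ p ^ n = algebraMap K D (a i)) ∧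
      ∀ j < n, y j ^ p ^ m = algebraMap K D (b j) := by
  obtain ⟨Q, _, x, y, hQ⟩ := exists_isModel hγ
  have hsys := hQ.sys m n
  have hp : 0 < p := (Fact.out : p.Prime).pos
  let L := AlgebraicClosure K
  have : CharP L p := charP_of_injective_algebraMap (algebraMap K L).injective p
  obtain ⟨α, hα⟩ := exists_pow_eq_algebraMap (L := L) (pow_pos hp n) a
  obtain ⟨β, hβ⟩ := exists_pow_eq_algebraMap (L := L) (pow_pos hp m) b
  obtain ⟨Λ, hΛ1, hΛx, hΛy⟩ := hQ.exists_functional α β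
  let Z : Set Q := (fun i => x i ^ p ^ n) '' Set.Iio m ∪ (fun j => y j ^ p ^ m) '' Set.Iio n
  let S := Subring.centralizer Z
  have hxS {i} (hi : i < m) : x i ∈ S := by
    rw [Subring.mem_centralizer_iff]
    rintro _ (⟨k, _, rfl⟩ | ⟨j, hj, rfl⟩)
    · exact (hsys.cx k i).pow_left _
    · exact hsys.commute_pow_left hγ hQ.char hi hj hi
  have hyS {j} (hj : j < n) : y j ∈ S := by
    rw [Subring.mem_centralizer_iff]
    rintro _ (⟨i, hi, rfl⟩ | ⟨k, _, rfl⟩)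
    · exact (hsys.commute_pow_right hγ hQ.char hi hj hj).symm
    · exact (hsys.cy k j).pow_left _
  have hS (s : S) {z} (hz : z ∈ Z) : z * s = s * z := Subring.mem_centralizer_iff.1 s.2 z hz
  let xS : ℕ → S := extendZero fun i : Fin m => ⟨x i, hxS i.2⟩
  let yS : ℕ → S := extendZero fun j : Fin n => ⟨y j, hyS j.2⟩
  have hxS' {i} (hi : i < m) : (xS i : Q) = x i := by
    rw [show xS i = _ from extendZero_of_lt _ hi]
  have hyS' {j} (hj : j < n) : (yS j : Q) = y j := by
    rw [show yS j = _ from extendZero_of_lt _ hj]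
  have cxS : CommFam xS := commFam_extendZero fun i i' => Subtype.ext (hsys.cx i i')
  have cyS : CommFam yS := commFam_extendZero fun i i' => Subtype.ext (hsys.cy i i')
  have hSys : Sys γ m n xS yS := Sys.of_injective S.subtype Subtype.val_injective
    (hsys.congr hγ (cxS.map S.subtype) (cyS.map S.subtype) (fun i hi => (hxS' hi).symm)
      fun j hj => (hyS' hj).symm)
  let c : Set (S × K) := (fun i => (xS i ^ p ^ n, a i)) '' Set.Iio m ∪
    (fun j => (yS j ^ p ^ m, b j)) '' Set.Iio n
  have hc : ∀ z ∈ c, ∀ s, Commute s z.1 := by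
    rintro _ (⟨i, hi, rfl⟩ | ⟨j, hj, rfl⟩) s
    · refine Subtype.ext ?_
      simp only [Subring.coe_mul, Subring.coe_pow, hxS' hi]
      exact (hS s (Or.inl ⟨i, hi, rfl⟩)).symm
    · refine Subtype.ext ?_
      simp only [Subring.coe_mul, Subring.coe_pow, hyS' hj]
      exact (hS s (Or.inr ⟨j, hj, rfl⟩)).symm
  have hmem : Λ.comp S.subtype.toAddMonoidHom ∈ transSubmodule K L c := by
    rintro _ (⟨i, hi, rfl⟩ | ⟨j, hj, rfl⟩) w
    · change Λ (w * xS i ^ p ^ n : Q) = a i • Λ w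
      rw [hxS' hi, ← hS w (Or.inl ⟨i, hi, rfl⟩), hΛx, hα, Algebra.smul_def]
    · change Λ (w * yS j ^ p ^ m : Q) = b j • Λ w
      rw [hyS' hj, hΛy, hβ, Algebra.smul_def, mul_comm]
  have : Nontrivial (transSubmodule K L c) := by
    refine ⟨⟨⟨_, hmem⟩, 0, fun h => one_ne_zero (α := L) ?_⟩⟩
    rw [← hΛ1]
    exact DFunLike.congr_fun (congrArg Subtype.val h) (1 : S)
  refine ⟨Module.End K (transSubmodule K L c), inferInstance, inferInstance, _, _, inferInstance,
    hSys.map (transAct K L c hc), fun i hi => ?_, fun j hj => ?_⟩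
  · rw [← map_pow]
    exact transAct_eq hc (z := (xS i ^ p ^ n, a i)) (Or.inl ⟨i, hi, rfl⟩)
  · rw [← map_pow]
    exact transAct_eq hc (z := (yS j ^ p ^ m, b j)) (Or.inr ⟨j, hj, rfl⟩)

variable {m n : ℕ} {a b : ℕ → K} {A : Type u} [Ring A] [Algebra K A] {x y : ℕ → A}

theorem IsSymb.nontrivial (hγ : IsGamma p γ) (h : IsSymb p γ m n a b x y) : Nontrivial A := by
  obtain ⟨D, _, _, x', y', _, hD, hx, hy⟩ := exists_nontrivial_sys hγ m n a b
  obtain ⟨f, -⟩ := h.lift D x' y' hD hx hy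
  exact f.toRingHom.domain_nontrivial

theorem IsSymb.finite_and_finrank (hγ : IsGamma p γ) (h : IsSymb p γ m n a b x y) :
    Module.Finite K A ∧ Module.finrank K A = p ^ (2 * (m * n)) := by
  have := h.nontrivial hγ
  obtain ⟨hf, hle⟩ := h.sys.finite_and_finrank_le (K := K) (Fact.out : p.Prime).pos hγ
    (fun i hi => h.pow_x i hi ▸ Subalgebra.algebraMap_mem _ _)
    (fun j hj => h.pow_y j hj ▸ Subalgebra.algebraMap_mem _ _) h.top
  exact ⟨hf, hle.antisymm (h.sys.pow_le_finrank hγ)⟩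

theorem IsSymb.injective (hγ : IsGamma p γ) (h : IsSymb p γ m n a b x y) {D : Type*} [Ring D]
    [Algebra K D] [Nontrivial D] (f : A →ₐ[K] D) : Function.Injective f := by
  obtain ⟨_, hA⟩ := h.finite_and_finrank hγ
  have hs : Sys γ m n (fun i => f.rangeRestrict (x i)) fun j => f.rangeRestrict (y j) :=
    h.sys.map f.rangeRestrict
  have : Module.Finite K f.range := Module.Finite.of_surjective f.rangeRestrict.toLinearMap
    f.rangeRestrict_surjective
  have hle := hs.pow_le_finrank (K := K) hγ
  have hinj : Function.Injective f.rangeRestrict.toLinearMap :=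
    (LinearMap.injective_iff_surjective_of_finrank_eq_finrank (le_antisymm (hA ▸ hle)
      (LinearMap.finrank_le_finrank_of_surjective (f := f.rangeRestrict.toLinearMap)
        f.rangeRestrict_surjective))).2
      f.rangeRestrict_surjective
  exact fun s t hst => hinj (Subtype.ext hst)

end Nontrivial

section Morita
open Module

theorem exists_matrix_equiv {K A A' N : Type*} [Field K] [Ring A] [Algebra K A] [Ring A']
    [Algebra K A'] [AddCommGroup N] [Module K N] [Module.Finite K A] [Module.Finite K A']
    (ρ : A →ₐ[K] Module.End K N) (L : A' →ₐ[K] (Module.End K N)ᵐᵒᵖ) (hL : Function.Injective L)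
    (hcomm : ∀ s z n, (L z).unop (ρ s n) = ρ s ((L z).unop n)) {r : ℕ} (hr : 0 < r)
    (hdim : finrank K A' = r ^ 2 * finrank K A) (g : Fin r → N)
    (hg : ∀ n, ∃ v : Fin r → A, n = ∑ k, ρ (v k) (g k)) :
    Nonempty (A' ≃ₐ[K] Matrix (Fin r) (Fin r) A) := by
  let π : (Fin r → A) →ₗ[K] N := ∑ k, (LinearMap.applyₗ (g k)) ∘ₗ ρ.toLinearMap ∘ₗ LinearMap.proj k
  have hπ (v) : π v = ∑ k, ρ (v k) (g k) := by
    simp [π, LinearMap.sum_apply]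
  have hπs : Function.Surjective π := fun n => by
    obtain ⟨v, hv⟩ := hg n
    exact ⟨v, (hπ v).trans hv.symm⟩
  have : Module.Finite K N := Module.Finite.of_surjective π hπs
  let M₀ : A' →ₗ[K] (Fin r → N) :=
    LinearMap.pi fun k => (LinearMap.applyₗ (g k)) ∘ₗ
      (MulOpposite.opLinearEquiv K).symm.toLinearMap ∘ₗ L.toLinearMap
  have hM₀ (z k) : M₀ z k = (L z).unop (g k) := rfl
  have hM₀i : Function.Injective M₀ := by
    rw [injective_iff_map_eq_zero]
    intro z hz
    refine hL (MulOpposite.unop_injective (LinearMap.ext fun n => ?_))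
    obtain ⟨v, rfl⟩ := hg n
    rw [map_zero, MulOpposite.unop_zero, LinearMap.zero_apply, map_sum]
    refine Finset.sum_eq_zero fun k _ => ?_
    rw [hcomm, ← hM₀, hz, Pi.zero_apply, map_zero]
  have h1 : finrank K A' ≤ r * finrank K N := by
    simpa [Module.finrank_pi_fintype] using LinearMap.finrank_le_finrank_of_injective hM₀i
  have h2 : finrank K (Fin r → A) = r * finrank K A := by
    rw [Module.finrank_pi_fintype, Finset.sum_const, Finset.card_univ, Fintype.card_fin,
      smul_eq_mul]
  have h3 : finrank K (Fin r → A) = finrank K N := by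
    refine le_antisymm (Nat.le_of_mul_le_mul_left ?_ hr)
      (LinearMap.finrank_le_finrank_of_surjective hπs)
    rw [h2, ← mul_assoc, ← pow_two, ← hdim]
    exact h1
  let e : (Fin r → A) ≃ₗ[K] N := LinearEquiv.ofBijective π
    ⟨(LinearMap.injective_iff_surjective_of_finrank_eq_finrank h3).2 hπs, hπs⟩
  let M : A' →ₗ[K] Matrix (Fin r) (Fin r) A :=
    (Matrix.ofLinearEquiv K).toLinearMap ∘ₗ
      (LinearEquiv.piCongrRight fun _ : Fin r => e.symm).toLinearMap ∘ₗ M₀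
  have heM (z k) : ∑ l, ρ (M z k l) (g l) = (L z).unop (g k) :=
    (hπ (M z k)).symm.trans (e.apply_symm_apply _)
  have huniq {B C : Matrix (Fin r) (Fin r) A}
      (h : ∀ k, ∑ l, ρ (B k l) (g l) = ∑ l, ρ (C k l) (g l)) : B = C := by
    funext k
    exact e.injective ((hπ _).trans ((h k).trans (hπ _).symm))
  have hone : M 1 = 1 := huniq fun k => by
    rw [heM, map_one, MulOpposite.unop_one, End.one_apply, Finset.sum_eq_single k]
    · rw [Matrix.one_apply_eq, map_one, End.one_apply]
    · intro l _ hl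
      rw [Matrix.one_apply_ne hl.symm, map_zero, LinearMap.zero_apply]
    · simp
  have hmul (z z') : M (z * z') = M z * M z' := huniq fun k => by
    rw [heM, map_mul, MulOpposite.unop_mul, End.mul_apply, ← heM, map_sum]
    simp only [hcomm, ← heM, map_sum, Matrix.mul_apply, map_mul, LinearMap.sum_apply,
      End.mul_apply]
    exact Finset.sum_comm
  have hMi : Function.Injective M := by
    exact (Matrix.ofLinearEquiv K).injective.comp
      ((LinearEquiv.piCongrRight fun _ : Fin r => e.symm).injective.comp hM₀i)
  have h4 : finrank K A' = finrank K (Matrix (Fin r) (Fin r) A) := by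
    rw [Module.finrank_matrix, hdim, Fintype.card_fin, pow_two]
  exact ⟨AlgEquiv.ofBijective (AlgHom.ofLinearMap M hone hmul)
    ⟨hMi, (LinearMap.injective_iff_surjective_of_finrank_eq_finrank h4).1 hMi⟩⟩

end Morita

section RightIdeal
variable (K : Type*) [Field K] {A : Type*} [Ring A] [Algebra K A] (w : A)

/-- The right ideal generated by an element. -/
abbrev rightIdeal : Submodule K A := LinearMap.range (LinearMap.mulLeft K w)

/-- The centralizer of an element acts on the right ideal generated by it by left
multiplication. -/
def centralizerAct : Subalgebra.centralizer K {w} →ₐ[K] Module.End K (rightIdeal K w) where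
  toFun c := (LinearMap.mulLeft K (c : A)).restrict (p := rightIdeal K w) (q := rightIdeal K w) (by
    rintro _ ⟨z, rfl⟩
    refine ⟨c * z, ?_⟩
    have := c.2 w rfl
    simp only [LinearMap.mulLeft_apply, ← mul_assoc, this])
  map_one' := by ext z; exact one_mul _
  map_mul' c d := by ext z; exact mul_assoc _ _ _
  map_zero' := by ext z; exact zero_mul _
  map_add' c d := by ext z; exact add_mul _ _ _
  commutes' r := by ext z; exact (Algebra.smul_def _ _).symm

theorem coe_centralizerAct (c : Subalgebra.centralizer K {w}) (z : rightIdeal K w) :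
    (centralizerAct K w c z : A) = c * z := rfl

/-- The right multiplication on a right ideal. -/
def rightIdealAct : A →ₐ[K] (Module.End K (rightIdeal K w))ᵐᵒᵖ where
  toFun c := MulOpposite.op ((LinearMap.mulRight K c).restrict
    (p := rightIdeal K w) (q := rightIdeal K w) (by
    rintro _ ⟨z, rfl⟩
    exact ⟨z * c, (mul_assoc _ _ _).symm⟩))
  map_one' := MulOpposite.unop_injective (by ext z; exact mul_one _)
  map_mul' c d := MulOpposite.unop_injective (by ext z; exact (mul_assoc _ _ _).symm)
  map_zero' := MulOpposite.unop_injective (by ext z; exact mul_zero _)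
  map_add' c d := MulOpposite.unop_injective (by ext z; exact mul_add _ _ _)
  commutes' r := MulOpposite.unop_injective (by
    ext z
    exact (Algebra.commutes r (z : A)).symm.trans (Algebra.smul_def _ _).symm)

end RightIdeal

section Corner
universe u
variable {p : ℕ} [Fact p.Prime] {γ : ℕ → ℕ → MvPolynomial (ℕ ⊕ₗ ℕ) ℤ} {K : Type u} [Field K]
  [CharP K p] {m n n' : ℕ} {a b a' b' : ℕ → K} {A A' : Type u} [Ring A] [Algebra K A] [Ring A']
  [Algebra K A'] {x y : ℕ → A} {x' y' : ℕ → A'}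

theorem IsSymb.exists_matrix_equiv (hγ : IsGamma p γ) (h : IsSymb p γ m n a b x y)
    (h' : IsSymb p γ m (n + 1) a' b' x' y') {w : A'} (hw : w ≠ 0) {u v : ℕ → A'}
    (huv : Sys γ m n u v) (hu : ∀ i < m, Commute w (u i)) (hv : ∀ j < n, Commute w (v j))
    (hua : ∀ i < m, w * u i ^ p ^ n = w * algebraMap K A' (a i))
    (hvb : ∀ j < n, w * v j ^ p ^ m = w * algebraMap K A' (b j))
    (g : Fin (p ^ m) → A') (hg : ∀ z, ∃ t : Fin (p ^ m) → A',
      (∀ k, t k ∈ lowAdj K u m ⊔ lowAdj K v n) ∧ w * z = ∑ k, w * t k * g k) :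
    Nonempty (A' ≃ₐ[K] Matrix (Fin (p ^ m)) (Fin (p ^ m)) A) := by
  have hp : 0 < p := (Fact.out : p.Prime).pos
  obtain ⟨hf, hA⟩ := h.finite_and_finrank hγ
  obtain ⟨hf', hA'⟩ := h'.finite_and_finrank hγ
  let C := Subalgebra.centralizer K {w}
  have huC {i} (hi : i < m) : u i ∈ C := by
    rintro _ rfl
    exact hu i hi
  have hvC {j} (hj : j < n) : v j ∈ C := by
    rintro _ rfl
    exact hv j hj
  let uC : ℕ → C := extendZero fun i : Fin m => ⟨u i, huC i.2⟩
  let vC : ℕ → C := extendZero fun j : Fin n => ⟨v j, hvC j.2⟩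
  have huC' {i} (hi : i < m) : (uC i : A') = u i := by
    rw [show uC i = _ from extendZero_of_lt _ hi]
  have hvC' {j} (hj : j < n) : (vC j : A') = v j := by
    rw [show vC j = _ from extendZero_of_lt _ hj]
  have cu : CommFam uC := commFam_extendZero fun i i' => Subtype.ext (huv.cx i i')
  have cv : CommFam vC := commFam_extendZero fun i i' => Subtype.ext (huv.cy i i')
  have hSys : Sys γ m n uC vC := Sys.of_injective C.val Subtype.val_injective
    (huv.congr hγ (cu.map C.val) (cv.map C.val) (fun i hi => (huC' hi).symm)
      fun j hj => (hvC' hj).symm)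
  have hact {c : C} {q : ℕ} {r : K} (hc : w * (c : A') ^ q = w * algebraMap K A' r) :
      centralizerAct K w c ^ q = algebraMap K _ r := by
    rw [← map_pow]
    ext ⟨_, z, rfl⟩
    have := (c ^ q).2 w rfl
    rw [Subalgebra.coe_pow] at this
    rw [coe_centralizerAct, Subalgebra.coe_pow]
    change (c : A') ^ q * (w * z) = r • (w * z)
    rw [← mul_assoc, ← this, hc, ← Algebra.commutes, mul_assoc, ← Algebra.smul_def]
  obtain ⟨ρ, hρu, hρv⟩ := h.lift (Module.End K (rightIdeal K w)) _ _
    (hSys.map (centralizerAct K w)) (fun i hi => hact (by rw [huC' hi]; exact hua i hi))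
    fun j hj => hact (by rw [hvC' hj]; exact hvb j hj)
  have hT : lowAdj K u m ⊔ lowAdj K v n ≤ (ρ.range.comap (centralizerAct K w)).map C.val := by
    refine sup_le (Algebra.adjoin_le ?_) (Algebra.adjoin_le ?_)
    · rintro _ ⟨i, hi, rfl⟩
      exact ⟨uC i, ⟨x i, hρu i hi⟩, huC' hi⟩
    · rintro _ ⟨j, hj, rfl⟩
      exact ⟨vC j, ⟨y j, hρv j hj⟩, hvC' hj⟩
  have : Nontrivial (rightIdeal K w) :=
    ⟨⟨w, 1, mul_one w⟩, 0, fun h => hw (congrArg Subtype.val h)⟩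
  have hinj : Function.Injective (rightIdealAct K w) :=
    h'.injective (D := (Module.End K (rightIdeal K w))ᵐᵒᵖ) hγ (rightIdealAct K w)
  refine _root_.exists_matrix_equiv ρ (rightIdealAct K w) hinj (fun s z l => ?_)
    (pow_pos hp m) ?_ (fun k => ⟨w * g k, g k, rfl⟩) ?_
  · have hs : ∀ s, ∃ c, centralizerAct K w c = ρ s := by
      have : (⊤ : Subalgebra K A) ≤ (centralizerAct K w).range.comap ρ := by
        rw [← h.top]
        refine sup_le (Algebra.adjoin_le ?_) (Algebra.adjoin_le ?_)
        · rintro _ ⟨i, hi, rfl⟩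
          exact ⟨uC i, (hρu i hi).symm⟩
        · rintro _ ⟨j, hj, rfl⟩
          exact ⟨vC j, (hρv j hj).symm⟩
      exact fun s => this (Algebra.mem_top (x := s))
    obtain ⟨c, hc⟩ := hs s
    rw [← hc]
    exact Subtype.ext (mul_assoc _ _ _)
  · rw [hA, hA', ← pow_mul, ← pow_add]
    congr 1
    ring
  · rintro ⟨_, z, rfl⟩
    obtain ⟨t, ht, htz⟩ := hg z
    choose c hc hct using fun k => hT (ht k)
    choose s hs using hc
    refine ⟨s, Subtype.ext ?_⟩
    refine htz.trans ((?_ : _ = _).trans (AddSubmonoidClass.coe_finsetSum _ _).symm)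
    refine Finset.sum_congr rfl fun k _ => ?_
    have h1 : ρ (s k) = centralizerAct K w (c k) := hs k
    have h2 : (c k : A') = t k := hct k
    have h3 := (c k).2 w rfl
    rw [h1, coe_centralizerAct, ← h2, h3, mul_assoc]

end Corner

theorem exists_annihilator {A : Type*} [Ring A] [Nontrivial A] {u : ℕ → A} (hu : CommFam u)
    {m q : ℕ} (hq : ∀ i < m, u i ^ q = 0) :
    ∃ w ∈ Submonoid.closure (Set.range u), w ≠ 0 ∧ ∀ i < m, w * u i = 0 := by
  classical
  induction m with
  | zero => exact ⟨1, one_mem _, one_ne_zero, fun i hi => absurd hi i.not_lt_zero⟩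
  | succ m ih =>
    obtain ⟨w, hw, hw0, h⟩ := ih fun i hi => hq i (hi.trans m.lt_succ_self)
    have hex : ∃ k, w * u m ^ k = 0 := ⟨q, by rw [hq m m.lt_succ_self, mul_zero]⟩
    have hpos : Nat.find hex ≠ 0 := fun h0 => hw0 (by simpa [h0] using Nat.find_spec hex)
    obtain ⟨k, hk⟩ := Nat.exists_eq_succ_of_ne_zero hpos
    refine ⟨w * u m ^ k, mul_mem hw (pow_mem (Submonoid.subset_closure (Set.mem_range_self m)) k),
      Nat.find_min hex (by omega), fun i hi => ?_⟩
    rcases Nat.lt_succ_iff_lt_or_eq.1 hi with hi | rfl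
    · rw [mul_assoc, ((hu m i).pow_left k).eq, ← mul_assoc, h i hi, zero_mul]
    · rw [mul_assoc, ← pow_succ, ← Nat.succ_eq_add_one, ← hk]
      exact Nat.find_spec hex

theorem commute_of_mem_closure {A : Type*} [Ring A] {u : ℕ → A} {w s : A}
    (hw : w ∈ Submonoid.closure (Set.range u)) (h : ∀ i, Commute (u i) s) : Commute w s := by
  induction hw using Submonoid.closure_induction with
  | mem x hx => obtain ⟨i, rfl⟩ := hx; exact h i
  | one => exact Commute.one_left s
  | mul x y _ _ hx hy => exact hx.mul_left hy

theorem commute_of_mem_lowAdj {K A : Type*} [Field K] [Ring A] [Algebra K A] {u : ℕ → A} {m : ℕ}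
    {w s : A} (hs : s ∈ lowAdj K u m) (h : ∀ i < m, Commute w (u i)) : Commute w s := by
  induction hs using Algebra.adjoin_induction with
  | mem x hx => obtain ⟨i, hi, rfl⟩ := hx; exact h i hi
  | algebraMap r => exact (Algebra.commutes r w).symm
  | add x y _ _ hx hy => exact hx.add_right hy
  | mul x y _ _ hx hy => exact hx.mul_right hy

section Cases
universe u
variable {p : ℕ} [Fact p.Prime] {γ : ℕ → ℕ → MvPolynomial (ℕ ⊕ₗ ℕ) ℤ} {K : Type u} [Field K]
  [CharP K p] {m n : ℕ} {a b a' b' : ℕ → K} {A A' : Type u} [Ring A] [Algebra K A] [Ring A']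
  [Algebra K A'] {x y : ℕ → A} {x' y' : ℕ → A'}

theorem IsSymb.exists_matrix_equiv_frobenius (hγ : IsGamma p γ) (h : IsSymb p γ m n a b x y)
    (h' : IsSymb p γ m (n + 1) a' b' x' y') (ha : ∀ i < m, a' i = a i ^ p)
    (hb : ∀ j < n, b' j = b j) :
    Nonempty (A' ≃ₐ[K] Matrix (Fin (p ^ m)) (Fin (p ^ m)) A) := by
  have := h'.nontrivial hγ
  have : CharP A' p := charP_of_injective_algebraMap (algebraMap K A').injective p
  have hp : 0 < p := (Fact.out : p.Prime).pos
  let u : ℕ → A' := extendZero fun i : Fin m => x' i ^ p ^ n - algebraMap K A' (a i)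
  have hu {i} (hi : i < m) : u i = x' i ^ p ^ n - algebraMap K A' (a i) := extendZero_of_lt _ hi
  have hcu {s : A'} (hs : ∀ i < m, Commute (x' i ^ p ^ n) s) (i) : Commute (u i) s := by
    by_cases hi : i < m
    · rw [hu hi]
      exact (hs i hi).sub_left (Algebra.commutes _ _)
    · rw [show u i = 0 from dif_neg hi]
      exact Commute.zero_left s
  have cu : CommFam u := fun i j => hcu (fun k _ => (hcu (fun l _ =>
    (h'.sys.cx l k).pow_pow _ _) j).symm) i
  have hup : ∀ i < m, u i ^ p = 0 := fun i hi => by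
    rw [hu hi, sub_pow_char_of_commute p (Algebra.commutes _ _).symm, ← pow_mul, ← pow_succ,
      h'.pow_x i hi, ha i hi, map_pow, sub_self]
  obtain ⟨w, hw, hw0, hwu⟩ := exists_annihilator cu hup
  obtain ⟨g, hg⟩ : SpannedBy (p ^ m) (lowAdj K y' n) (lowAdj K y' (n + 1)) := by
    rw [lowAdj_succ]
    refine spannedBy_sup_adjoin_singleton (pow_pos hp m)
      (fun v hv => commute_of_mem_lowAdj hv fun i _ => h'.sys.cy n i) ?_
    rw [h'.pow_y n n.lt_succ_self]
    exact Subalgebra.algebraMap_mem _ _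
  refine h.exists_matrix_equiv hγ h' hw0 (h'.sys.mono le_rfl n.le_succ)
    (fun i hi => commute_of_mem_closure hw (hcu fun k _ => (h'.sys.cx k i).pow_left _))
    (fun j hj => commute_of_mem_closure hw (hcu fun k hk =>
      (h'.sys.commute_pow_right hγ (CharP.cast_eq_zero A' p) hk (hj.trans n.lt_succ_self) hj).symm))
    (fun i hi => ?_)
    (fun j hj => by rw [h'.pow_y j (hj.trans n.lt_succ_self), hb j hj]) g fun z => ?_
  · rw [← sub_eq_zero, ← mul_sub, ← hu hi, hwu i hi]
  · have hz : z ∈ Subalgebra.toSubmodule (lowAdj K x' m ⊔ lowAdj K y' (n + 1)) := by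
      rw [h'.top]
      exact (Algebra.mem_top : z ∈ (⊤ : Subalgebra K A'))
    rw [h'.sys.sup_eq (R := K) hγ] at hz
    induction hz using Submodule.mul_induction_on' with
    | mem_mul_mem c hc d hd =>
      obtain ⟨v, hv, rfl⟩ := hg d hd
      refine ⟨fun k => c * v k, fun k => mul_mem (le_sup_left (α := Subalgebra K A') hc)
        (le_sup_right (α := Subalgebra K A') (hv k)), ?_⟩
      simp only [Finset.mul_sum, mul_assoc]
    | add z₁ _ z₂ _ h₁ h₂ =>
      obtain ⟨t₁, ht₁, e₁⟩ := h₁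
      obtain ⟨t₂, ht₂, e₂⟩ := h₂
      refine ⟨fun k => t₁ k + t₂ k, fun k => add_mem (ht₁ k) (ht₂ k), ?_⟩
      simp only [mul_add, add_mul, Finset.sum_add_distrib, e₁, e₂]

theorem exists_mul_eq_of_mem_lowAdj_succ {w : A'} (hw : w * y' 0 = 0)
    (hc : ∀ j, Commute w (y' j)) {d : A'} (hd : d ∈ lowAdj K y' (n + 1)) :
    ∃ d' ∈ lowAdj K (fun j => y' (j + 1)) n, w * d = w * d' := by
  induction hd using Algebra.adjoin_induction with
  | mem z hz =>
    obtain ⟨_ | j, hj, rfl⟩ := hz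
    · exact ⟨0, zero_mem _, by rw [hw, mul_zero]⟩
    · exact ⟨y' (j + 1), mem_lowAdj (fun j => y' (j + 1)) (Nat.lt_of_succ_lt_succ hj), rfl⟩
  | algebraMap r => exact ⟨_, Subalgebra.algebraMap_mem _ r, rfl⟩
  | add s t _ _ hs ht =>
    obtain ⟨s', hs', es⟩ := hs
    obtain ⟨t', ht', et⟩ := ht
    exact ⟨s' + t', add_mem hs' ht', by rw [mul_add, es, et, mul_add]⟩
  | mul s t _ _ hs ht =>
    obtain ⟨s', hs', es⟩ := hs
    obtain ⟨t', ht', et⟩ := ht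
    refine ⟨s' * t', mul_mem hs' ht', ?_⟩
    have := (commute_of_mem_lowAdj hs' fun j _ => hc (j + 1)).eq
    rw [← mul_assoc, es, this, mul_assoc, et, ← mul_assoc, ← this, mul_assoc]

theorem IsSymb.exists_matrix_equiv_verschiebung (hγ : IsGamma p γ) (h : IsSymb p γ m n a b x y)
    (h' : IsSymb p γ m (n + 1) a' b' x' y') (ha : ∀ i < m, a' i = a i)
    (hb0 : b' 0 = 0) (hb : ∀ j < n, b' (j + 1) = b j) :
    Nonempty (A' ≃ₐ[K] Matrix (Fin (p ^ m)) (Fin (p ^ m)) A) := by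
  have := h'.nontrivial hγ
  have : CharP A' p := charP_of_injective_algebraMap (algebraMap K A').injective p
  have hA' : (p : A') = 0 := CharP.cast_eq_zero A' p
  have hp : 0 < p := (Fact.out : p.Prime).pos
  obtain ⟨w, hw, hw0, hwy⟩ := exists_annihilator (u := fun _ => y' 0) (m := 1) (q := p ^ m)
    (fun _ _ => Commute.refl _) fun _ _ => by rw [h'.pow_y 0 n.succ_pos, hb0, map_zero]
  have hcy (j) : Commute w (y' j) := commute_of_mem_closure hw fun _ => h'.sys.cy 0 j
  have hcx : CommFam fun i => x' i ^ p := fun i i' => (h'.sys.cx i i').pow_pow p p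
  obtain ⟨g, hg⟩ : SpannedBy (p ^ m) (lowAdj K (fun i => x' i ^ p) m)
      (lowAdj K (fun i => x' i ^ p) m ⊔ lowAdj K x' m) :=
    spannedBy_sup_lowAdj hp (fun i _ v hv => commute_of_mem_lowAdj hv fun i' _ =>
      (h'.sys.cx i i').pow_right p) h'.sys.cx fun i hi => mem_lowAdj (fun i => x' i ^ p) hi
  refine h.exists_matrix_equiv hγ h' hw0 (h'.sys.frob hγ hA')
    (fun i hi => commute_of_mem_closure hw fun _ => h'.sys.commute_zero hγ hA' hi)
    (fun j _ => hcy (j + 1))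
    (fun i hi => by rw [← pow_mul, ← pow_succ', h'.pow_x i hi, ha i hi])
    (fun j hj => by rw [h'.pow_y (j + 1) (Nat.succ_lt_succ hj), hb j hj]) g fun z => ?_
  have hz : z ∈ Subalgebra.toSubmodule (lowAdj K x' m ⊔ lowAdj K y' (n + 1)) := by
    rw [h'.top]
    exact (Algebra.mem_top : z ∈ (⊤ : Subalgebra K A'))
  rw [h'.sys.sup_eq (R := K) hγ, h'.sys.mul_comm (R := K) hγ] at hz
  induction hz using Submodule.mul_induction_on' with
  | mem_mul_mem d hd c hc =>
    obtain ⟨v, hv, rfl⟩ := hg c (le_sup_right (α := Subalgebra K A') hc)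
    obtain ⟨d', hd', e⟩ := exists_mul_eq_of_mem_lowAdj_succ (hwy 0 one_pos) hcy hd
    refine ⟨fun k => d' * v k, fun k => mul_mem (le_sup_right (α := Subalgebra K A') hd')
      (le_sup_left (α := Subalgebra K A') (hv k)), ?_⟩
    rw [← mul_assoc, e, Finset.mul_sum]
    simp only [mul_assoc]
  | add z₁ _ z₂ _ h₁ h₂ =>
    obtain ⟨t₁, ht₁, e₁⟩ := h₁
    obtain ⟨t₂, ht₂, e₂⟩ := h₂
    refine ⟨fun k => t₁ k + t₂ k, fun k => add_mem (ht₁ k) (ht₂ k), ?_⟩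
    simp only [mul_add, add_mul, Finset.sum_add_distrib, e₁, e₂]

end Cases

section Matrices
universe u
variable {K : Type u} [Field K] {A A' : Type u} [Ring A'] [Algebra K A'] [Ring A] [Algebra K A]

/-- Matrices of size one are the same as their entry. -/
def matrixOneEquiv (K A : Type*) [Field K] [Ring A] [Algebra K A] :
    Matrix (Fin 1) (Fin 1) A ≃ₐ[K] A where
  toFun M := M 0 0
  invFun a := Matrix.of fun _ _ => a
  left_inv M := Matrix.ext fun i j => by rw [Subsingleton.elim i 0, Subsingleton.elim j 0]; rfl
  right_inv _ := rfl
  map_mul' M N := by simp [Matrix.mul_apply]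
  map_add' _ _ := rfl
  commutes' r := by simp [Matrix.algebraMap_matrix_apply]

theorem brauerEquiv_of_matrix_equiv {r : ℕ} (hr : 0 < r) (e : A' ≃ₐ[K] Matrix (Fin r) (Fin r) A) :
    BrauerEquiv K A' A :=
  ⟨1, r, one_pos, hr, ⟨(matrixOneEquiv K A').trans e⟩⟩

/-- The transpose, as an isomorphism from matrices over the opposite algebra to the opposite of
the matrix algebra. -/
def matrixOpEquiv (K A : Type*) [Field K] [Ring A] [Algebra K A] (ι : Type*) [Fintype ι]
    [DecidableEq ι] : Matrix ι ι Aᵐᵒᵖ ≃ₐ[K] (Matrix ι ι A)ᵐᵒᵖ where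
  toFun M := MulOpposite.op (Matrix.of fun i j => (M j i).unop)
  invFun M := Matrix.of fun i j => MulOpposite.op (M.unop j i)
  left_inv _ := rfl
  right_inv _ := rfl
  map_mul' M N := by
    refine MulOpposite.unop_injective (Matrix.ext fun i j => ?_)
    simp [Matrix.mul_apply]
  map_add' M N := rfl
  commutes' r := by
    refine MulOpposite.unop_injective (Matrix.ext fun i j => ?_)
    by_cases h : i = j
    · subst h
      simp [Matrix.algebraMap_matrix_apply]
    · simp [Matrix.algebraMap_matrix_apply, h, Ne.symm h]

theorem brauerEquiv_of_op_matrix_equiv {r : ℕ} (hr : 0 < r)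
    (e : A'ᵐᵒᵖ ≃ₐ[K] Matrix (Fin r) (Fin r) Aᵐᵒᵖ) : BrauerEquiv K A' A :=
  brauerEquiv_of_matrix_equiv hr (AlgEquiv.op.symm (e.trans (matrixOpEquiv K A (Fin r))))

end Matrices

section Symbols
universe u
variable {p : ℕ} [Fact p.Prime] {K : Type u} [Field K]
  {c : ℕ+ → ℕ+ → MvPolynomial (ℕ+ ⊕ₗ ℕ+) ℤ}

theorem extendZero_coeff_truncate {m i : ℕ} (h : i < m) (u : WittVector p K) :
    extendZero (WittVector.truncate m u).coeff i = u.coeff i := by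
  rw [extendZero_of_lt _ h, WittVector.coeff_truncate]

theorem extendZero_coeff_truncate_succ {n j : ℕ} (h : j < n) (u : WittVector p K) :
    extendZero (WittVector.truncate (n + 1) u).coeff j =
      extendZero (WittVector.truncate n u).coeff j := by
  rw [extendZero_coeff_truncate h, extendZero_coeff_truncate (h.trans n.lt_succ_self)]

theorem extendZero_coeff_truncate_verschiebung_zero (n : ℕ) (u : WittVector p K) :
    extendZero (WittVector.truncate (n + 1) (WittVector.verschiebung u)).coeff 0 = 0 := by
  rw [extendZero_coeff_truncate n.succ_pos, WittVector.verschiebung_coeff_zero]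

theorem extendZero_coeff_truncate_verschiebung_succ {n j : ℕ} (h : j < n) (u : WittVector p K) :
    extendZero (WittVector.truncate (n + 1) (WittVector.verschiebung u)).coeff (j + 1) =
      extendZero (WittVector.truncate n u).coeff j := by
  rw [extendZero_coeff_truncate h, extendZero_coeff_truncate (Nat.succ_lt_succ h),
    WittVector.verschiebung_coeff_succ]

variable [CharP K p]

theorem extendZero_coeff_truncate_frobenius {m i : ℕ} (h : i < m) (u : WittVector p K) :
    extendZero (WittVector.truncate m (WittVector.frobenius u)).coeff i =
      extendZero (WittVector.truncate m u).coeff i ^ p := by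
  rw [extendZero_coeff_truncate h, extendZero_coeff_truncate h, WittVector.coeff_frobenius_charP]

theorem brauerEquiv_frobenius_left (hγ : IsGamma p (gammaOf p c)) (a b : WittVector p K)
    (m n : ℕ) : BrauerEquiv K
      (Asymb K p c m (n + 1) (WittVector.truncate m (WittVector.frobenius a))
        (WittVector.truncate (n + 1) b))
      (Asymb K p c m n (WittVector.truncate m a) (WittVector.truncate n b)) :=
  have ⟨e⟩ := (isSymb_asymb hγ).exists_matrix_equiv_frobenius hγ (isSymb_asymb hγ)
    (fun _ hi => extendZero_coeff_truncate_frobenius hi a)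
    (fun _ hj => extendZero_coeff_truncate_succ hj b)
  brauerEquiv_of_matrix_equiv (pow_pos (Fact.out : p.Prime).pos m) e

theorem brauerEquiv_verschiebung_right (hγ : IsGamma p (gammaOf p c)) (a b : WittVector p K)
    (m n : ℕ) : BrauerEquiv K
      (Asymb K p c m (n + 1) (WittVector.truncate m a)
        (WittVector.truncate (n + 1) (WittVector.verschiebung b)))
      (Asymb K p c m n (WittVector.truncate m a) (WittVector.truncate n b)) :=
  have ⟨e⟩ := (isSymb_asymb hγ).exists_matrix_equiv_verschiebung hγ (isSymb_asymb hγ)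
    (fun _ _ => rfl) (extendZero_coeff_truncate_verschiebung_zero n b)
    (fun _ hj => extendZero_coeff_truncate_verschiebung_succ hj b)
  brauerEquiv_of_matrix_equiv (pow_pos (Fact.out : p.Prime).pos m) e

theorem brauerEquiv_frobenius_right (hγ : IsGamma p (gammaOf p c)) (a b : WittVector p K)
    (m n : ℕ) : BrauerEquiv K
      (Asymb K p c (m + 1) n (WittVector.truncate (m + 1) a)
        (WittVector.truncate n (WittVector.frobenius b)))
      (Asymb K p c m n (WittVector.truncate m a) (WittVector.truncate n b)) :=
  have ⟨e⟩ := (isSymb_asymb hγ).op.exists_matrix_equiv_frobenius (hγ.swap Fact.out)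
    (isSymb_asymb hγ).op (fun _ hj => extendZero_coeff_truncate_frobenius hj b)
    (fun _ hi => extendZero_coeff_truncate_succ hi a)
  brauerEquiv_of_op_matrix_equiv (pow_pos (Fact.out : p.Prime).pos n) e

theorem brauerEquiv_verschiebung_left (hγ : IsGamma p (gammaOf p c)) (a b : WittVector p K)
    (m n : ℕ) : BrauerEquiv K
      (Asymb K p c (m + 1) n (WittVector.truncate (m + 1) (WittVector.verschiebung a))
        (WittVector.truncate n b))
      (Asymb K p c m n (WittVector.truncate m a) (WittVector.truncate n b)) :=
  have ⟨e⟩ := (isSymb_asymb hγ).op.exists_matrix_equiv_verschiebung (hγ.swap Fact.out)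
    (isSymb_asymb hγ).op (fun _ _ => rfl) (extendZero_coeff_truncate_verschiebung_zero m a)
    (fun _ hi => extendZero_coeff_truncate_verschiebung_succ hi a)
  brauerEquiv_of_op_matrix_equiv (pow_pos (Fact.out : p.Prime).pos n) e

end Symbols

end

set_option maxSynthPendingDepth 3 in
set_option synthInstance.maxHeartbeats 1000000 in
set_option maxHeartbeats 1000000 in
/-- Let `p` be a prime, `K` a field of characteristic `p`, and `a, b ∈ W(K)` `p`-typical
Witt vectors; write `u_{(k)}` for the truncation of `u` to length `k`, `F` for Frobenius
and `V` for Verschiebung.  Then (equalities of symbols in `Br(K)` being expressed by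
Brauer equivalence of the corresponding central simple algebras):
(i) for `m ≥ 0`, `n ≥ 1` (here `n := n+1`):
`(((Fa)_{(m)}, b_{(n)}))_{p^m,p^n} = ((a_{(m)}, (Vb)_{(n)}))_{p^m,p^n} = ((a_{(m)}, b_{(n−1)}))_{p^m,p^{n−1}}`;
(ii) for `m ≥ 1`, `n ≥ 0` (here `m := m+1`):
`((a_{(m)}, (Fb)_{(n)}))_{p^m,p^n} = (((Va)_{(m)}, b_{(n)}))_{p^m,p^n} = ((a_{(m−1)}, b_{(n)}))_{p^{m−1},p^n}`.
(Symbols with an index `p^0` vanish: indeed for `m = 0` or `n = 0` the algebra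
`A_{((·,·))}` is `K` itself, so its Brauer class is `0`; hence no convention is needed.) -/
theorem frobenius_verschiebung_adjoint (p : ℕ) [Fact p.Prime] (K : Type*) [Field K]
    [CharP K p] (c : ℕ+ → ℕ+ → MvPolynomial (ℕ+ ⊕ₗ ℕ+) ℤ) (hc : IsCFamily c)
    (a b : WittVector p K) :
    (∀ m n : ℕ,
      BrauerEquiv K
        (Asymb K p c m (n + 1) (WittVector.truncate m (WittVector.frobenius a))
          (WittVector.truncate (n + 1) b))
        (Asymb K p c m n (WittVector.truncate m a) (WittVector.truncate n b)) ∧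
      BrauerEquiv K
        (Asymb K p c m (n + 1) (WittVector.truncate m a)
          (WittVector.truncate (n + 1) (WittVector.verschiebung b)))
        (Asymb K p c m n (WittVector.truncate m a) (WittVector.truncate n b))) ∧
    (∀ m n : ℕ,
      BrauerEquiv K
        (Asymb K p c (m + 1) n (WittVector.truncate (m + 1) a)
          (WittVector.truncate n (WittVector.frobenius b)))
        (Asymb K p c m n (WittVector.truncate m a) (WittVector.truncate n b)) ∧
      BrauerEquiv K
        (Asymb K p c (m + 1) n (WittVector.truncate (m + 1) (WittVector.verschiebung a))
          (WittVector.truncate n b))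
        (Asymb K p c m n (WittVector.truncate m a) (WittVector.truncate n b))) := by
  have hγ := isGamma_gammaOf (Fact.out : p.Prime) hc
  exact ⟨fun m n => ⟨brauerEquiv_frobenius_left hγ a b m n,
      brauerEquiv_verschiebung_right hγ a b m n⟩,
    fun m n => ⟨brauerEquiv_frobenius_right hγ a b m n,
      brauerEquiv_verschiebung_left hγ a b m n⟩⟩

end
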